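/- Let E be a number field and let A and B be central division algebras over E. If there exists an E-algebra embedding of A into B, then dim_E A divides dim_E B, and the integers dim_E A and (dim_E B)/(dim_E A) are relatively prime. -/

import Mathlib

section
open IsDedekindDomain NumberField WithZero
namespace Cft
universe u
set_option linter.unusedSectionVars false
set_option linter.all false


lemma val_eq_one {F : Type u} [Field F] {w : Valuation F ℤᵐ⁰} {x : F} (h : w (x - 1) < 1) : w x = 1 := by
  have := Valuation.map_add_eq_of_lt_right w (x := x - 1) (y := 1) (by simpa using h)
  simpa using this

lemma mul_sub_one_lt {F : Type u} [Field F] {w : Valuation F ℤᵐ⁰} {x y : F} {t : ℤᵐ⁰} (ht : t ≤ 1)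
    (hx : w (x - 1) < t) (hy : w (y - 1) < t) : w (x * y - 1) < t := by
  have e : x * y - 1 = x * (y - 1) + (x - 1) := by ring
  rw [e]
  refine Valuation.map_add_lt _ ?_ hx
  rw [map_mul, val_eq_one (hx.trans_le ht), one_mul]; exact hy

lemma inv_sub_one_lt {F : Type u} [Field F] {w : Valuation F ℤᵐ⁰} {x : F} {t : ℤᵐ⁰} (ht : t ≤ 1)
    (hx : w (x - 1) < t) : w (x⁻¹ - 1) < t := by
  have h1 := val_eq_one (hx.trans_le ht)
  have hx0 : x ≠ 0 := by rintro rfl; simp at h1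
  have e : x⁻¹ - 1 = - (x⁻¹ * (x - 1)) := by field_simp; ring
  rw [e, Valuation.map_neg, map_mul, map_inv₀, h1]; simpa using hx

variable {F : Type u} [Field F] [NumberField F] (p : ℕ) [hp : Fact p.Prime] (v : HeightOneSpectrum (𝓞 F))

lemma val_nat_le (n : ℕ) : v.valuation F (n : F) ≤ 1 := by
  have := v.valuation_le_one (K := F) (n : 𝓞 F)
  simpa using this

lemma val_int_le (n : ℤ) : v.valuation F (n : F) ≤ 1 := by
  have := v.valuation_le_one (K := F) (n : 𝓞 F)
  simpa using this

lemma val_p_ne : v.valuation F (p : F) ≠ 0 := by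
  rw [Valuation.ne_zero_iff]; exact_mod_cast hp.out.ne_zero

lemma tv_le : (v.valuation F (p : F)) ^ p ≤ 1 := pow_le_one' (val_nat_le v p) _
lemma tv_pos : 0 < (v.valuation F (p : F)) ^ p := by
  rw [zero_lt_iff]; exact pow_ne_zero _ (val_p_ne p v)

/-- the group of elements `v`-adically close to `p`-th powers -/
def Pv : Subgroup Fˣ where
  carrier := {x | ∃ y : Fˣ, v.valuation F ((x : F) * (y : F) ^ p - 1) < (v.valuation F (p : F)) ^ p}
  one_mem' := ⟨1, by simpa using tv_pos p v⟩
  mul_mem' := by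
    rintro a b ⟨y, hy⟩ ⟨z, hz⟩
    refine ⟨y * z, ?_⟩
    have := mul_sub_one_lt (tv_le p v) hy hz
    convert this using 3
    push_cast; ring
  inv_mem' := by
    rintro a ⟨y, hy⟩
    refine ⟨y⁻¹, ?_⟩
    have := inv_sub_one_lt (tv_le p v) hy
    convert this using 3
    push_cast; rw [mul_inv, inv_pow]

variable {p v}
lemma mem_Pv {x : Fˣ} : x ∈ Pv p v ↔
    ∃ y : Fˣ, v.valuation F ((x : F) * (y : F) ^ p - 1) < (v.valuation F (p : F)) ^ p := Iff.rfl

lemma pow_mem_Pv (y : Fˣ) : y ^ p ∈ Pv p v := by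
  refine ⟨y⁻¹, ?_⟩
  have : ((y ^ p : Fˣ) : F) * ((y⁻¹ : Fˣ) : F) ^ p - 1 = 0 := by
    push_cast; rw [← mul_pow]; simp
  rw [this, map_zero]; exact tv_pos p v

lemma close_mem_Pv {x : Fˣ} (h : v.valuation F ((x : F) - 1) < (v.valuation F (p : F)) ^ p) : x ∈ Pv p v :=
  ⟨1, by simpa using h⟩

lemma lt_imp_le_mul_exp {a b : ℤᵐ⁰} (h : a < b) : a ≤ b * exp (-1) := by
  rcases eq_or_ne a 0 with rfl | ha
  · simp
  · have hb : b ≠ 0 := (lt_of_le_of_lt zero_le h).ne'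
    rw [← lt_mul_exp_iff_le (by simp [hb])]
    rw [mul_assoc, ← exp_add]; simpa using h

/-- one Newton step -/
lemma newton {x : F} (h : v.valuation F (x - 1) < (v.valuation F (p : F)) ^ p) :
    ∃ y : F, y ≠ 0 ∧ v.valuation F (x * y ^ p - 1) ≤ v.valuation F (x - 1) * exp (-1) := by
  set w := v.valuation F with hw
  have hp2 := hp.out.two_le
  have hp0 : (p : F) ≠ 0 := by exact_mod_cast hp.out.ne_zero
  have wp0 : w p ≠ 0 := val_p_ne p v
  have wp1 : w p ≤ 1 := val_nat_le v p
  rcases eq_or_ne (x - 1) 0 with h0 | h0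
  · exact ⟨1, one_ne_zero, by simp [h0]⟩
  set ε := x - 1 with hε
  set δ := ε / p with hδ
  have hεδ : ε = p * δ := by rw [hδ]; field_simp
  have wεδ : w ε = w p * w δ := by rw [hεδ, map_mul]
  have wε0 : w ε ≠ 0 := by rwa [Valuation.ne_zero_iff]
  have hδ1 : w δ < w p ^ (p - 1) := by
    rw [wεδ] at h
    have : w p ^ p = w p * w p ^ (p - 1) := by rw [← pow_succ']; congr 1; omega
    rw [this] at h
    exact lt_of_mul_lt_mul_left' h
  have hδp : w δ < w p := hδ1.trans_le (by
    calc w p ^ (p-1) ≤ w p ^ 1 := pow_le_pow_right_of_le_one' wp1 (by omega)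
      _ = w p := pow_one _)
  have hδlt : w δ < 1 := hδp.trans_le wp1
  have hδ0 : w δ ≠ 0 := by intro h'; rw [h', mul_zero] at wεδ; exact wε0 wεδ
  have wεlt1 : w ε < 1 := by rw [wεδ]; exact lt_of_le_of_lt (mul_le_of_le_one_left' wp1) hδlt
  have hεpos : 0 < w ε := zero_lt_iff.2 wε0
  -- expansion
  have key : w ((1 - δ) ^ p - (1 - ε)) < w ε := by
    have : (1 - δ) ^ p - (1 - ε) = ∑ k ∈ Finset.Ico 2 (p+1), (-δ) ^ k * (p.choose k : F) := by
      rw [sub_eq_add_neg 1 δ, add_comm 1 (-δ), add_pow, Finset.range_eq_Ico,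
        Finset.sum_eq_sum_Ico_succ_bot (by omega), Finset.sum_eq_sum_Ico_succ_bot (by omega)]
      simp [hεδ]; ring
    rw [this]
    refine Valuation.map_sum_lt _ wε0 ?_
    intro k hk
    rw [Finset.mem_Ico] at hk
    rw [map_mul, map_pow, Valuation.map_neg]
    rcases eq_or_ne k p with rfl | hkp
    · simp only [Nat.choose_self, Nat.cast_one, map_one, mul_one]
      have : w δ ^ k = w δ ^ (k-1) * w δ := by rw [← pow_succ]; congr 1; omega
      rw [this, wεδ]
      refine mul_lt_mul_of_pos_right ?_ (zero_lt_iff.2 hδ0)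
      refine lt_of_le_of_lt ?_ hδp
      calc w δ ^ (k-1) ≤ w δ ^ 1 := pow_le_pow_right_of_le_one' hδlt.le (by omega)
        _ = w δ := pow_one _
    · obtain ⟨m, hm⟩ := hp.out.dvd_choose_self (by omega : k ≠ 0) (by omega : k < p)
      rw [hm]; push_cast; rw [map_mul]
      have h1 : w δ ^ k < w δ := by
        calc w δ ^ k ≤ w δ ^ 2 := pow_le_pow_right_of_le_one' hδlt.le (by omega)
          _ = w δ * w δ := sq _
          _ < w δ * 1 := mul_lt_mul_of_pos_left hδlt (zero_lt_iff.2 hδ0)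
          _ = w δ := mul_one _
      calc w δ ^ k * (w p * w m) ≤ w δ ^ k * (w p * 1) := by
            gcongr; exact val_nat_le v m
        _ < w δ * (w p * 1) := mul_lt_mul_of_pos_right h1 (by simpa [zero_lt_iff] using wp0)
        _ = w ε := by rw [wεδ, mul_one, mul_comm]
  refine ⟨1 - δ, ?_, ?_⟩
  · intro h'
    have : δ = 1 := by linear_combination -h'
    rw [this, map_one] at hδlt; exact lt_irrefl _ hδlt
  · apply lt_imp_le_mul_exp
    have e : x * (1 - δ) ^ p - 1 = (1 + ε) * ((1 - δ) ^ p - (1 - ε)) + -(ε * ε) := by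
      have : x = 1 + ε := by rw [hε]; ring
      rw [this]; ring
    rw [e]
    refine Valuation.map_add_lt _ ?_ ?_
    · rw [map_mul]
      have : w (1 + ε) = 1 := val_eq_one (by simpa using wεlt1)
      rw [this, one_mul]; exact key
    · rw [Valuation.map_neg, map_mul]
      calc w ε * w ε < w ε * 1 := mul_lt_mul_of_pos_left wεlt1 hεpos
        _ = w ε := mul_one _

/-- approximation to arbitrary accuracy -/
lemma Pv_improve {x : Fˣ} (h : x ∈ Pv p v) (t : ℤᵐ⁰) (ht : t ≠ 0) :
    ∃ y : Fˣ, v.valuation F ((x : F) * (y : F) ^ p - 1) < t := by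
  have main : ∀ n : ℕ, ∃ y : Fˣ, v.valuation F ((x : F) * (y : F) ^ p - 1) < (v.valuation F (p : F)) ^ p * exp (-(n : ℤ)) := by
    intro n
    induction n with
    | zero => obtain ⟨y, hy⟩ := h; exact ⟨y, by simpa using hy⟩
    | succ n ih =>
      obtain ⟨y, hy⟩ := ih
      obtain ⟨z, hz0, hz⟩ := newton (p := p) (v := v) (x := (x : F) * (y : F) ^ p)
        (hy.trans_le (by
          refine mul_le_of_le_one_right' ?_
          rw [← exp_zero, exp_le_exp]; omega))
      refine ⟨y * Units.mk0 z hz0, ?_⟩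
      have e : (x : F) * ((y * Units.mk0 z hz0 : Fˣ) : F) ^ p - 1 = (x : F) * (y : F) ^ p * z ^ p - 1 := by
        push_cast; rw [Units.val_mk0, mul_pow, mul_assoc]
      rw [e]
      refine lt_of_le_of_lt hz ?_
      have : exp (-((n + 1 : ℕ) : ℤ)) = exp (-(n : ℤ)) * exp (-1) := by
        rw [← exp_add]; congr 1; push_cast; ring
      rw [this, ← mul_assoc]
      exact mul_lt_mul_of_pos_right hy (by simp [zero_lt_iff])
  obtain ⟨n, hn⟩ := exists_exp_neg_natCast_lt ht
  obtain ⟨y, hy⟩ := main n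
  refine ⟨y, hy.trans (lt_of_le_of_lt ?_ hn)⟩
  exact mul_le_of_le_one_left' (tv_le p v)

end Cft
end

section
open IsDedekindDomain NumberField WithZero Polynomial
namespace Cft
universe u
set_option linter.unusedSectionVars false
set_option linter.all false

section comp
variable {p : ℕ} [hp : Fact p.Prime]

/-- companion matrix of `X^p - a` -/
def comp (p : ℕ) [hp : Fact p.Prime] {R : Type*} [CommRing R] (a : R) : Matrix (Fin p) (Fin p) R :=
  haveI : NeZero p := ⟨hp.out.ne_zero⟩
  fun i j => if i = j + 1 then (if i = 0 then a else 1) else 0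

lemma comp_map {R S : Type*} [CommRing R] [CommRing S] (φ : R →+* S) (a : R) :
    (comp p a).map φ = comp p (φ a) := by
  ext i j
  simp only [comp, Matrix.map_apply]
  split_ifs <;> simp

lemma comp_eq_leftMulMatrix {R K : Type*} [CommRing R] [CommRing K] [Algebra R K]
    (b : Module.Basis (Fin p) R K) (α : K) (hb : ∀ i : Fin p, b i = α ^ (i : ℕ)) (a : R)
    (ha : α ^ p = algebraMap R K a) : comp p a = Algebra.leftMulMatrix b α := by
  haveI : NeZero p := ⟨hp.out.ne_zero⟩
  ext i j
  rw [Algebra.leftMulMatrix_eq_repr_mul]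
  have hp2 := hp.out.two_le
  have hval : ((j + 1 : Fin p) : ℕ) = ((j : ℕ) + 1) % p := by
    rw [Fin.val_add]; congr 2; rw [Fin.val_one']; exact Nat.mod_eq_of_lt (by omega)
  have hj := j.2
  rcases Nat.lt_or_ge ((j : ℕ) + 1) p with h | h
  · rw [Nat.mod_eq_of_lt h] at hval
    have : α * b j = b (j + 1) := by rw [hb, hb, hval, pow_succ']
    have h0 : (j + 1 : Fin p) ≠ 0 := by
      intro h'; rw [h'] at hval; simp at hval
    rw [this, Module.Basis.repr_self, Finsupp.single_apply]
    simp only [comp]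
    by_cases hi : i = j + 1
    · subst hi; simp [h0]
    · simp [hi, Ne.symm hi]
  · have hjp : (j : ℕ) + 1 = p := by omega
    rw [hjp, Nat.mod_self] at hval
    have h0 : (j + 1 : Fin p) = 0 := Fin.ext (by simpa using hval)
    have : α * b j = a • b 0 := by
      rw [hb, hb, ← pow_succ', hjp, ha]; simp [Algebra.smul_def]
    rw [this, map_smul, Module.Basis.repr_self]
    simp only [comp, h0]
    by_cases hi : i = 0
    · subst hi; simp
    · simp [hi, Finsupp.single_apply, Ne.symm hi]

lemma det_aeval_comp {R K : Type*} [CommRing R] [CommRing K] [Algebra R K]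
    (b : Module.Basis (Fin p) R K) (α : K) (hb : ∀ i : Fin p, b i = α ^ (i : ℕ)) (a : R)
    (ha : α ^ p = algebraMap R K a) (f : R[X]) :
    (aeval (comp p a) f).det = Algebra.norm R (aeval α f) := by
  rw [comp_eq_leftMulMatrix b α hb a ha, Algebra.norm_eq_matrix_det b, aeval_algHom_apply]

lemma monic_XpowC {R : Type*} [CommRing R] (a : R) : (X ^ p - C a : R[X]).Monic :=
  monic_X_pow_sub_C a hp.out.ne_zero

lemma exists_basis {R : Type*} [CommRing R] [Nontrivial R] (a : R) :
    ∃ b : Module.Basis (Fin p) R (AdjoinRoot (X ^ p - C a : R[X])),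
      ∀ i, b i = (AdjoinRoot.root (X ^ p - C a : R[X])) ^ (i : ℕ) := by
  have hd : (X ^ p - C a : R[X]).natDegree = p := natDegree_X_pow_sub_C
  let pb := AdjoinRoot.powerBasis' (monic_XpowC (p := p) a)
  have hdim : pb.dim = p := by rw [AdjoinRoot.powerBasis'_dim, hd]
  refine ⟨pb.basis.reindex (finCongr hdim), fun i => ?_⟩
  simp [pb]

lemma root_pow {R : Type*} [CommRing R] (a : R) :
    (AdjoinRoot.root (X ^ p - C a : R[X])) ^ p = algebraMap R _ a := by
  have := AdjoinRoot.eval₂_root (X ^ p - C a : R[X])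
  simp only [eval₂_sub, eval₂_pow, eval₂_X, eval₂_C, sub_eq_zero] at this
  rw [this]; rfl

lemma comp_pow {R : Type*} [CommRing R] [Nontrivial R] (a : R) : (comp p a) ^ p = algebraMap R _ a := by
  obtain ⟨b, hb⟩ := exists_basis (p := p) a
  rw [comp_eq_leftMulMatrix b _ hb a (root_pow a), ← map_pow, root_pow, AlgHom.commutes]

lemma det_comp_scale {R : Type*} [CommRing R] [Nontrivial R] (a : R) (y : Rˣ) (f : R[X]) :
    (aeval (comp p (a * (y : R) ^ p)) f).det = (aeval (comp p a) (f.comp (C (y : R) * X))).det := by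
  obtain ⟨b, hb⟩ := exists_basis (p := p) a
  rw [det_aeval_comp b _ hb a (root_pow a),
    det_aeval_comp (b.unitsSMul (fun i => y ^ (i : ℕ))) ((y : R) • AdjoinRoot.root (X ^ p - C a : R[X]))]
  · rw [aeval_comp]; simp [Algebra.smul_def]
  · intro i
    rw [Module.Basis.unitsSMul_apply, hb, _root_.smul_pow, Units.smul_def]; simp
  · rw [_root_.smul_pow, root_pow, Algebra.smul_def, ← map_mul, mul_comm]

lemma det_comp_eval {R : Type*} [CommRing R] (f : R[X]) :
    ∃ q : R[X], ∀ a : R, (aeval (comp p a) f).det = q.eval a := by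
  refine ⟨(aeval (comp p (X : R[X])) (f.map C)).det, fun a => ?_⟩
  have : (evalRingHom a) (aeval (comp p (X : R[X])) (f.map C)).det = _ := RingHom.map_det _ _
  rw [coe_evalRingHom] at this
  rw [this]
  congr 1
  rw [aeval_def, aeval_def, eval₂_map, hom_eval₂]
  congr 1
  · ext r i j
    simp [Matrix.algebraMap_matrix_apply]
    split_ifs <;> simp
  · rw [RingHom.mapMatrix_apply, comp_map]; simp

open Fin.CommRing in
lemma comp_one_pow {R : Type*} [CommRing R] (i : ℕ) (k j : Fin p) :
    haveI : NeZero p := ⟨hp.out.ne_zero⟩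
    (comp p (1 : R) ^ i) k j = if k = j + (i : Fin p) then 1 else 0 := by
  haveI : NeZero p := ⟨hp.out.ne_zero⟩
  induction i generalizing k j with
  | zero => simp [Matrix.one_apply]
  | succ i ih =>
    rw [pow_succ, Matrix.mul_apply, Finset.sum_eq_single (j + 1)]
    · rw [ih]; simp only [comp, Nat.cast_add, Nat.cast_one, if_true, ite_self, mul_one]; congr 2; ring
    · intro l _ hl
      simp [comp, hl]
    · simp

open Fin.CommRing in
lemma det_comp_one {F : Type*} [Field F] [CharZero F] (b : F) :
    ∃ f : F[X], (aeval (comp p (1 : F)) f).det = b := by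
  haveI : NeZero p := ⟨hp.out.ne_zero⟩
  set c := (b - 1) / p
  refine ⟨1 + C c * ∑ i ∈ Finset.range p, X ^ i, ?_⟩
  have : aeval (comp p (1 : F)) (1 + C c * ∑ i ∈ Finset.range p, X ^ i) =
      1 + Matrix.replicateCol Unit (fun _ : Fin p => c) * Matrix.replicateRow Unit (fun _ : Fin p => (1 : F)) := by
    ext k j
    simp only [map_add, map_one, map_mul, aeval_C, map_sum, map_pow, aeval_X, Matrix.add_apply]
    congr 1
    rw [← Algebra.smul_def, Matrix.smul_apply, Matrix.sum_apply]
    simp only [comp_one_pow, Matrix.mul_apply, Matrix.replicateCol_apply, Matrix.replicateRow_apply]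
    rw [Finset.sum_range (fun i => if k = j + (i : Fin p) then (1 : F) else 0)]
    have : ∀ i : Fin p, (k = j + (((i : ℕ) : ℕ) : Fin p)) ↔ i = k - j := by
      intro i; rw [Fin.cast_val_eq_self]
      constructor
      · rintro rfl; abel
      · rintro rfl; abel
    simp only [this]; simp
  rw [this, Matrix.det_one_add_replicateCol_mul_replicateRow]
  have hp0 : (p : F) ≠ 0 := by exact_mod_cast hp.out.ne_zero
  simp [dotProduct, c]; field_simp; ring
end comp
end Cft
end

section
open IsDedekindDomain NumberField WithZero Polynomial
namespace Cft
universe u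
set_option linter.unusedSectionVars false
set_option linter.all false

/-- Kummer extension of prime degree with distinguished generator and automorphism -/
structure Kum (p : ℕ) {F K : Type*} [Field F] [Field K] [Algebra F K] (ζ a : F) (α : K)
    (σ : K ≃ₐ[F] K) : Prop where
  hζ : IsPrimitiveRoot ζ p
  ha : ∀ y : F, y ^ p ≠ a
  hα : α ^ p = algebraMap F K a
  hfin : Module.finrank F K = p
  hσ : σ α = algebraMap F K ζ * α

namespace Kum
variable {p : ℕ} [hp : Fact p.Prime] {F K : Type*} [Field F] [Field K] [Algebra F K] {ζ a : F} {α : K}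
    {σ : K ≃ₐ[F] K}

lemma fd (h : Kum p ζ a α σ) : FiniteDimensional F K :=
  FiniteDimensional.of_finrank_pos (by rw [h.hfin]; exact hp.out.pos)

lemma irr (h : Kum p ζ a α σ) : Irreducible (X ^ p - C a : F[X]) :=
  X_pow_sub_C_irreducible_of_prime hp.out h.ha

lemma minpoly_eq (h : Kum p ζ a α σ) : minpoly F α = X ^ p - C a := by
  symm
  apply minpoly.eq_of_irreducible_of_monic h.irr _ (monic_XpowC a)
  simp [h.hα]

lemma exists_basis (h : Kum p ζ a α σ) : ∃ b : Module.Basis (Fin p) F K, ∀ i, b i = α ^ (i : ℕ) := by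
  have li := linearIndependent_pow (K := F) α
  rw [h.minpoly_eq, natDegree_X_pow_sub_C] at li
  have := hp.out.pos
  haveI : Nonempty (Fin p) := ⟨⟨0, this⟩⟩
  refine ⟨basisOfLinearIndependentOfCardEqFinrank li (by simp [h.hfin]), fun i => ?_⟩
  simp

lemma exists_poly (h : Kum p ζ a α σ) (x : K) : ∃ f : F[X], x = aeval α f := by
  obtain ⟨b, hb⟩ := h.exists_basis
  refine ⟨∑ i, C (b.repr x i) * X ^ (i : ℕ), ?_⟩
  conv_lhs => rw [← b.sum_repr x]
  simp [hb, Algebra.smul_def]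

lemma σpow_α (h : Kum p ζ a α σ) (i : ℕ) : (σ ^ i) α = algebraMap F K (ζ ^ i) * α := by
  induction i with
  | zero => simp
  | succ i ih =>
    rw [pow_succ', AlgEquiv.mul_apply, ih, map_mul, AlgEquiv.commutes, h.hσ, pow_succ, map_mul]; ring

lemma ext_α (h : Kum p ζ a α σ) {τ ρ : K ≃ₐ[F] K} (e : τ α = ρ α) : τ = ρ := by
  ext x
  obtain ⟨f, rfl⟩ := h.exists_poly x
  have h1 : ∀ τ : K ≃ₐ[F] K, τ (aeval α f) = aeval (τ α) f := fun τ => by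
    exact (aeval_algHom_apply τ.toAlgHom α f).symm
  rw [h1, h1, e]

lemma α_ne (h : Kum p ζ a α σ) : α ≠ 0 := by
  rintro rfl
  have := h.hα
  rw [zero_pow hp.out.ne_zero] at this
  exact h.ha 0 (by rw [zero_pow hp.out.ne_zero]; exact ((map_eq_zero _).1 this.symm).symm)

lemma a_ne (h : Kum p ζ a α σ) : a ≠ 0 := fun h0 => h.ha 0 (by rw [zero_pow hp.out.ne_zero, h0])

lemma order (h : Kum p ζ a α σ) : orderOf σ = p := by
  apply orderOf_eq_prime
  · apply h.ext_α
    rw [h.σpow_α, h.hζ.pow_eq_one]; simp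
  · intro h1
    have := h.hσ
    rw [h1, AlgEquiv.one_apply] at this
    have h2 : algebraMap F K ζ = 1 := by
      have := mul_right_cancel₀ h.α_ne (this.symm.trans (one_mul α).symm)
      exact this
    have h3 : ζ = 1 := (algebraMap F K).injective (by rw [h2, map_one])
    exact h.hζ.ne_one hp.out.one_lt h3

lemma card (h : Kum p ζ a α σ) : Nat.card (K ≃ₐ[F] K) = p := by
  haveI := h.fd
  apply le_antisymm
  · rw [Nat.card_eq_fintype_card, ← h.hfin]; exact AlgEquiv.card_le
  · rw [← h.order]; exact Nat.le_of_dvd Nat.card_pos (orderOf_dvd_natCard σ)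

lemma gal (h : Kum p ζ a α σ) : IsGalois F K := by
  haveI := h.fd
  exact IsGalois.of_card_aut_eq_finrank _ _ (by rw [h.card, h.hfin])

lemma mem_zpowers (h : Kum p ζ a α σ) (τ : K ≃ₐ[F] K) : τ ∈ Subgroup.zpowers σ := by
  haveI := h.fd
  have : Subgroup.zpowers σ = ⊤ := by
    apply Subgroup.eq_top_of_card_eq
    rw [Nat.card_zpowers, h.order, h.card]
  rw [this]; trivial

lemma exists_pow (h : Kum p ζ a α σ) (τ : K ≃ₐ[F] K) : ∃ i < p, τ = σ ^ i := by
  haveI := h.fd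
  classical
  obtain ⟨k, e⟩ := (mem_powers_iff_mem_zpowers (x := σ)).2 (h.mem_zpowers τ)
  refine ⟨k % p, Nat.mod_lt _ hp.out.pos, ?_⟩
  rw [← h.order, pow_mod_orderOf]; exact e.symm

lemma fixed (h : Kum p ζ a α σ) {x : K} (hx : σ x = x) : ∃ y : F, algebraMap F K y = x := by
  haveI := h.fd; haveI := h.gal
  rw [← Set.mem_range, ]
  apply (IsGalois.mem_range_algebraMap_iff_fixed x).2
  intro τ
  obtain ⟨i, -, rfl⟩ := h.exists_pow τ
  induction i with
  | zero => simp
  | succ i ih => rw [pow_succ', AlgEquiv.mul_apply, ih, hx]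

lemma norm_eq (h : Kum p ζ a α σ) (x : K) :
    algebraMap F K (Algebra.norm F x) = ∏ i ∈ Finset.range p, (σ ^ i) x := by
  haveI := h.fd; haveI := h.gal
  rw [Algebra.norm_eq_prod_automorphisms]
  symm
  refine Finset.prod_bij (fun i _ => σ ^ i) (fun _ _ => Finset.mem_univ _) ?_ ?_ (fun _ _ => rfl)
  · intro i hi j hj e
    rw [Finset.mem_range] at hi hj
    exact pow_injOn_Iio_orderOf (by simpa [h.order] using hi) (by simpa [h.order] using hj) e
  · intro τ _
    obtain ⟨i, hi, e⟩ := h.exists_pow τ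
    exact ⟨i, by simpa using hi, e.symm⟩

lemma kummer (h : Kum p ζ a α σ) {c : F} (hc : c ≠ 0) {γ : K} (hγ : γ ^ p = algebraMap F K c) :
    ∃ j : ℕ, ∃ y : F, y ≠ 0 ∧ c = a ^ j * y ^ p := by
  have hζK : IsPrimitiveRoot (algebraMap F K ζ) p := h.hζ.map_of_injective (algebraMap F K).injective
  have hγ0 : γ ≠ 0 := by
    rintro rfl
    rw [zero_pow hp.out.ne_zero] at hγ; exact hc ((map_eq_zero _).1 hγ.symm)
  have h1 : (σ γ / γ) ^ p = 1 := by
    rw [div_pow, ← map_pow, hγ, AlgEquiv.commutes, div_self]; simpa using hc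
  haveI : NeZero p := ⟨hp.out.ne_zero⟩
  obtain ⟨j, hj, e⟩ := hζK.eq_pow_of_pow_eq_one h1
  have e' : σ γ = algebraMap F K ζ ^ j * γ := by rw [e]; field_simp
  have hfix : σ (γ / α ^ j) = γ / α ^ j := by
    rw [map_div₀, map_pow, h.hσ, e', mul_pow]
    have := hζK.ne_zero hp.out.ne_zero
    have := h.α_ne
    field_simp
  obtain ⟨y, hy⟩ := h.fixed hfix
  have hyp : c = a ^ j * y ^ p := by
    apply (algebraMap F K).injective
    rw [map_mul, map_pow, map_pow, hy, ← h.hα, ← hγ, div_pow, ← pow_mul, ← pow_mul, mul_comm j p]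
    have := h.α_ne
    field_simp
  refine ⟨j, y, ?_, hyp⟩
  rintro rfl
  rw [zero_pow hp.out.ne_zero, mul_zero] at hyp; exact hc hyp

lemma det_eq (h : Kum p ζ a α σ) (f : F[X]) : (aeval (comp p a) f).det = Algebra.norm F (aeval α f) := by
  obtain ⟨b, hb⟩ := h.exists_basis
  exact det_aeval_comp b α hb a h.hα f

end Kum

lemma exists_kum {p : ℕ} [hp : Fact p.Prime] {F : Type u} [Field F] {ζ a : F} (hζ : IsPrimitiveRoot ζ p)
    (ha : ∀ y : F, y ^ p ≠ a) : ∃ (K : Type u) (_ : Field K) (_ : Algebra F K) (α : K) (σ : K ≃ₐ[F] K),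
      Kum p ζ a α σ := by
  have irr : Irreducible (X ^ p - C a : F[X]) := X_pow_sub_C_irreducible_of_prime hp.out ha
  haveI : Fact (Irreducible (X ^ p - C a : F[X])) := ⟨irr⟩
  let K := AdjoinRoot (X ^ p - C a : F[X])
  let α : K := AdjoinRoot.root _
  obtain ⟨b, hb⟩ := exists_basis (p := p) a
  have hα : α ^ p = algebraMap F K a := root_pow a
  haveI : FiniteDimensional F K := b.finiteDimensional_of_finite
  let s : K →ₐ[F] K := AdjoinRoot.liftAlgHom _ (Algebra.ofId F K) (algebraMap F K ζ * α) (by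
    simp only [eval₂_sub, eval₂_pow, eval₂_X, eval₂_C]
    rw [mul_pow, hα, ← map_pow, hζ.pow_eq_one]; simp [Algebra.ofId])
  have hs : s α = algebraMap F K ζ * α := by
    simp only [s, α]; exact AdjoinRoot.liftAlgHom_root ..
  have hbij : Function.Bijective s := s.bijective
  refine ⟨K, inferInstance, inferInstance, α, AlgEquiv.ofBijective s hbij, hζ, ha, hα, ?_, hs⟩
  rw [Module.finrank_eq_card_basis b, Fintype.card_fin]

/-- the subgroup of norms from `F[X]/(X^p-a)` -/
def Nm (p : ℕ) [hp : Fact p.Prime] {F : Type*} [Field F] (a : Fˣ) : Subgroup Fˣ where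
  carrier := {b | ∃ f : F[X], (aeval (comp p (a : F)) f).det = b}
  one_mem' := ⟨1, by simp⟩
  mul_mem' := by
    rintro x y ⟨f, hf⟩ ⟨g, hg⟩
    exact ⟨f * g, by rw [map_mul, Matrix.det_mul, hf, hg]; rfl⟩
  inv_mem' := by
    rintro x ⟨f, hf⟩
    refine ⟨f ^ (p - 1) * C ((x : F)⁻¹), ?_⟩
    rw [map_mul, Matrix.det_mul, map_pow, Matrix.det_pow, hf, aeval_C, Algebra.algebraMap_eq_smul_one,
      Matrix.det_smul, Matrix.det_one, mul_one, Fintype.card_fin]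
    have : (x : F) ≠ 0 := x.ne_zero
    have hp1 : p = (p - 1) + 1 := by have := hp.out.pos; omega
    nth_rewrite 2 [hp1]
    rw [pow_succ, ← mul_assoc, ← mul_pow, mul_inv_cancel₀ this]; simp

section
variable {p : ℕ} [hp : Fact p.Prime] {F : Type u} [Field F]

lemma mem_Nm {a b : Fˣ} : b ∈ Nm p a ↔ ∃ f : F[X], (aeval (comp p (a : F)) f).det = b := Iff.rfl

lemma pow_mem_Nm (a y : Fˣ) : y ^ p ∈ Nm p a := by
  refine ⟨C (y : F), ?_⟩
  rw [aeval_C, Algebra.algebraMap_eq_smul_one, Matrix.det_smul, Matrix.det_one, mul_one, Fintype.card_fin]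
  simp

lemma Nm_scale (a y : Fˣ) : Nm p (a * y ^ p) ≤ Nm p a := by
  rintro b ⟨f, hf⟩
  refine ⟨f.comp (C (y : F) * X), ?_⟩
  rw [← hf, ← det_comp_scale]; simp

lemma Nm_one [CharZero F] : Nm p (1 : Fˣ) = ⊤ := by
  rw [eq_top_iff]
  intro b _
  obtain ⟨f, hf⟩ := det_comp_one (p := p) (b : F)
  exact ⟨f, by simpa using hf⟩

lemma Kum.mem_Nm {K : Type*} [Field K] [Algebra F K] {ζ : F} {a b : Fˣ} {α : K} {σ : K ≃ₐ[F] K}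
    (h : Kum p ζ (a : F) α σ) : b ∈ Nm p a ↔ ∃ x : K, Algebra.norm F x = b := by
  constructor
  · rintro ⟨f, hf⟩
    exact ⟨aeval α f, by rw [← hf, h.det_eq]⟩
  · rintro ⟨x, hx⟩
    obtain ⟨f, rfl⟩ := h.exists_poly x
    exact ⟨f, by rw [← hx, h.det_eq]⟩

/-- the symbol algebra `(a,b)` is split -/
def Sym (p : ℕ) {F : Type*} [Field F] (ζ a b : F) : Prop :=
  ∃ X Y : Matrix (Fin p) (Fin p) F, X ^ p = algebraMap F _ a ∧ Y ^ p = algebraMap F _ b ∧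
    Y * X = ζ • (X * Y)

lemma Sym.symm {ζ a b : F} (h : Sym p ζ a b) : Sym p ζ b a := by
  obtain ⟨X, Y, hX, hY, h⟩ := h
  refine ⟨Y.transpose, X.transpose, ?_, ?_, ?_⟩
  · rw [← Matrix.transpose_pow, hY]; simp [Algebra.algebraMap_eq_smul_one]
  · rw [← Matrix.transpose_pow, hX]; simp [Algebra.algebraMap_eq_smul_one]
  · rw [← Matrix.transpose_mul, h, Matrix.transpose_smul, Matrix.transpose_mul]

lemma Sym.scale {ζ a b : F} (y : F) (h : Sym p ζ a b) : Sym p ζ (a * y ^ p) b := by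
  obtain ⟨X, Y, hX, hY, h⟩ := h
  refine ⟨y • X, Y, ?_, hY, ?_⟩
  · rw [_root_.smul_pow, hX, Algebra.algebraMap_eq_smul_one, smul_smul, Algebra.algebraMap_eq_smul_one, mul_comm]
  · rw [mul_smul_comm, h, smul_mul_assoc, smul_comm]

lemma Sym.map {L : Type*} [Field L] (φ : F →+* L) {ζ a b : F} (h : Sym p ζ a b) :
    Sym p (φ ζ) (φ a) (φ b) := by
  obtain ⟨X, Y, hX, hY, h⟩ := h
  have hm : ∀ c : F, φ.mapMatrix (algebraMap F (Matrix (Fin p) (Fin p) F) c) = algebraMap L _ (φ c) := by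
    intro c; ext i j
    simp only [Matrix.algebraMap_matrix_apply, RingHom.mapMatrix_apply, Matrix.map_apply]
    split_ifs <;> simp
  refine ⟨φ.mapMatrix X, φ.mapMatrix Y, ?_, ?_, ?_⟩
  · rw [← map_pow, hX, hm]
  · rw [← map_pow, hY, hm]
  · rw [← map_mul, h, ← map_mul]
    ext i j
    simp only [RingHom.mapMatrix_apply, Matrix.map_apply, Matrix.smul_apply, smul_eq_mul, map_mul]
    rw [← Matrix.map_mul, Matrix.map_apply]

lemma Kum.sym_of_norm {K : Type*} [Field K] [Algebra F K] {ζ : F} {a b : F} {α : K} {σ : K ≃ₐ[F] K}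
    (h : Kum p ζ a α σ) {x : K} (hx : Algebra.norm F x = b) : Sym p ζ a b := by
  obtain ⟨e, he⟩ := h.exists_basis
  let φ : Module.End F K ≃ₐ[F] Matrix (Fin p) (Fin p) F := LinearMap.toMatrixAlgEquiv e
  let Y0 : Module.End F K := (LinearMap.mulLeft F x) ∘ₗ σ.toLinearMap
  have hY : ∀ k : ℕ, ∀ z, (Y0 ^ k) z = (∏ i ∈ Finset.range k, (σ ^ i) x) * (σ ^ k) z := by
    intro k
    induction k with
    | zero => intro z; simp
    | succ k ih =>
      intro z
      rw [pow_succ', Module.End.mul_apply, ih]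
      simp only [Y0, LinearMap.comp_apply, LinearMap.mulLeft_apply, AlgEquiv.toLinearMap_apply, map_mul, map_prod]
      rw [Finset.prod_range_succ', pow_succ' σ k]
      simp only [pow_succ', AlgEquiv.mul_apply, pow_zero, AlgEquiv.one_apply]
      ring
  refine ⟨φ (LinearMap.mulLeft F α), φ Y0, ?_, ?_, ?_⟩
  · rw [← map_pow, LinearMap.pow_mulLeft, h.hα, ← AlgEquiv.commutes φ]; congr 1
    ext z; simp [Algebra.smul_def]
  · rw [← map_pow, ← AlgEquiv.commutes φ]; congr 1
    ext z
    rw [hY, ← h.norm_eq, hx, ← h.order, pow_orderOf_eq_one]; simp [Algebra.smul_def]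
  · rw [← map_mul, ← map_mul, ← map_smul]; congr 1
    ext z
    simp [Y0, h.hσ, Algebra.smul_def]; ring

lemma Kum.norm_of_sym {K : Type*} [Field K] [Algebra F K] {ζ : F} {a b : F} {α : K} {σ : K ≃ₐ[F] K}
    (h : Kum p ζ a α σ) (hs : Sym p ζ a b) : ∃ x : K, Algebra.norm F x = b := by
  obtain ⟨A, B, hA, hB, hAB⟩ := hs
  haveI : NeZero p := ⟨hp.out.ne_zero⟩
  let V := Fin p → F
  let v0 : V := Pi.single 0 1
  have hv0 : v0 ≠ 0 := fun h0 => one_ne_zero (α := F) (by have := congrFun h0 0; simp only [v0, Pi.single_eq_same] at this; exact this)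
  -- polynomial not divisible acts invertibly
  have inv : ∀ g : F[X], (aeval A g).mulVec v0 = 0 → (X ^ p - C a : F[X]) ∣ g := by
    intro g hg
    by_contra hnd
    obtain ⟨r, s, hrs⟩ := (h.irr.coprime_iff_not_dvd.2 hnd)
    have h1 : aeval A (s * g) = 1 := by
      have : aeval A (r * (X ^ p - C a) + s * g) = 1 := by rw [hrs, map_one]
      rw [map_add, map_mul _ r] at this
      simpa [hA] using this
    apply hv0
    calc v0 = (1 : Matrix (Fin p) (Fin p) F).mulVec v0 := by simp
      _ = (aeval A s).mulVec ((aeval A g).mulVec v0) := by rw [← h1, map_mul, Matrix.mulVec_mulVec]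
      _ = 0 := by rw [hg]; simp
  -- linear independence
  have li : LinearIndependent F (fun i : Fin p => (A ^ (i : ℕ)).mulVec v0) := by
    rw [Fintype.linearIndependent_iff]
    intro c hc
    let g : F[X] := ∑ i : Fin p, C (c i) * X ^ (i : ℕ)
    have hg : (aeval A g).mulVec v0 = 0 := by
      simp only [g, map_sum, map_mul, aeval_C, map_pow, aeval_X]
      rw [Matrix.sum_mulVec, ← hc]
      refine Finset.sum_congr rfl fun i _ => ?_
      rw [Algebra.algebraMap_eq_smul_one, smul_mul_assoc, one_mul, Matrix.smul_mulVec]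
    have hd := inv g hg
    have hg0 : g = 0 := by
      by_contra hne
      have h1 := degree_le_of_dvd hd hne
      rw [degree_X_pow_sub_C hp.out.pos] at h1
      have h2 : g.degree < (p : WithBot ℕ) := by
        refine lt_of_le_of_lt (degree_sum_le _ _) ?_
        rw [Finset.sup_lt_iff (by exact_mod_cast WithBot.bot_lt_coe p)]
        intro i _
        exact lt_of_le_of_lt (degree_C_mul_X_pow_le _ _) (by exact_mod_cast i.2)
      exact absurd h1 (not_le.2 h2)
    intro i
    have : g.coeff i = c i := by
      simp only [g, finsetSum_coeff, coeff_C_mul, coeff_X_pow]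
      rw [Finset.sum_eq_single i]
      · simp
      · intro j _ hj; rw [if_neg (fun e => hj (Fin.ext e.symm))]; simp
      · simp
    rw [← this, hg0, coeff_zero]
  let bs := basisOfLinearIndependentOfCardEqFinrank li (by simp)
  obtain ⟨f, hf⟩ : ∃ f : F[X], B.mulVec v0 = (aeval A f).mulVec v0 := by
    refine ⟨∑ i, C (bs.repr (B.mulVec v0) i) * X ^ (i : ℕ), ?_⟩
    conv_lhs => rw [← bs.sum_repr (B.mulVec v0)]
    simp only [map_sum, map_mul, aeval_C, map_pow, aeval_X]
    rw [Matrix.sum_mulVec]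
    refine Finset.sum_congr rfl fun i _ => ?_
    rw [Algebra.algebraMap_eq_smul_one, smul_mul_assoc, one_mul, Matrix.smul_mulVec]
    simp [bs]
  have comm : ∀ g : F[X], B * aeval A g = aeval A (g.comp (C ζ * X)) * B := by
    intro g
    induction g using Polynomial.induction_on' with
    | add f g hf hg => simp only [map_add, mul_add, add_mul, hf, hg, add_comp]
    | monomial n c =>
      rw [← C_mul_X_pow_eq_monomial]
      simp only [map_mul, aeval_C, map_pow, aeval_X, mul_comp, C_comp, pow_comp, X_comp, mul_pow]
      have : ∀ n : ℕ, B * A ^ n = ζ ^ n • (A ^ n * B) := by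
        intro n
        induction n with
        | zero => simp
        | succ n ih =>
          rw [pow_succ', ← mul_assoc, hAB, smul_mul_assoc, mul_assoc, ih, mul_smul_comm, smul_smul, ← mul_assoc, pow_succ']
      rw [Algebra.left_comm, this]
      simp only [Algebra.algebraMap_eq_smul_one, smul_mul_assoc, one_mul, ← map_pow]
      simp [Algebra.algebraMap_eq_smul_one, mul_smul_comm, smul_smul]
      rw [_root_.smul_pow, one_pow, smul_mul_assoc, one_mul, smul_mul_assoc, smul_smul]
  have pw : ∀ k : ℕ, (B ^ k).mulVec v0 = (aeval A (∏ i ∈ Finset.range k, f.comp (C (ζ ^ i) * X))).mulVec v0 := by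
    intro k
    induction k with
    | zero => simp
    | succ k ih =>
      rw [pow_succ', ← Matrix.mulVec_mulVec, ih, Matrix.mulVec_mulVec, comm, ← Matrix.mulVec_mulVec, hf, Matrix.mulVec_mulVec,
        ← map_mul, Finset.prod_range_succ', prod_comp]
      congr 4
      · funext i
        rw [comp_assoc]; congr 1; simp [pow_succ, mul_assoc]
      · simp
  have hd := inv (∏ i ∈ Finset.range p, f.comp (C (ζ ^ i) * X) - C b) (by
    rw [map_sub, Matrix.sub_mulVec, ← pw, hB, aeval_C, sub_self])
  refine ⟨aeval α f, ?_⟩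
  apply (algebraMap F K).injective
  rw [h.norm_eq]
  obtain ⟨q, hq⟩ := hd
  have := congrArg (aeval α) hq
  rw [map_mul] at this
  simp only [map_sub, map_pow, aeval_X, aeval_C, h.hα, sub_self, zero_mul, sub_eq_zero] at this
  rw [← this, map_prod]
  refine Finset.prod_congr rfl fun i _ => ?_
  have e := aeval_algHom_apply (σ ^ i).toAlgHom α f
  rw [aeval_comp]; refine e.symm.trans ?_
  congr 1
  refine congrArg aeval ((h.σpow_α i).trans ?_)
  simp

lemma sym_iff {ζ : F} (hζ : IsPrimitiveRoot ζ p) {a b : Fˣ} (ha : ∀ y : F, y ^ p ≠ a) :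
    Sym p ζ (a : F) b ↔ b ∈ Nm p a := by
  obtain ⟨K, _, _, α, σ, h⟩ := exists_kum hζ ha
  rw [h.mem_Nm]
  exact ⟨fun hs => h.norm_of_sym hs, fun ⟨x, hx⟩ => h.sym_of_norm hx⟩

lemma sym_one {ζ : F} (hζ : IsPrimitiveRoot ζ p) (b : F) : Sym p ζ 1 b := by
  haveI : NeZero p := ⟨hp.out.ne_zero⟩
  have hz : ζ ≠ 0 := hζ.ne_zero hp.out.ne_zero
  refine ⟨Matrix.diagonal (fun i => (ζ⁻¹) ^ (i : ℕ)), comp p b, ?_, comp_pow b, ?_⟩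
  · rw [Matrix.diagonal_pow]; ext i j
    simp only [Matrix.diagonal_apply, map_one, Matrix.one_apply, Pi.pow_apply]
    split_ifs
    · rw [← pow_mul, mul_comm, pow_mul, inv_pow, hζ.pow_eq_one]; simp
    · rfl
  · ext i j
    rw [Matrix.mul_diagonal, Matrix.smul_apply, Matrix.diagonal_mul]
    simp only [comp]
    have hp2 := hp.out.two_le
    have hval : ((j + 1 : Fin p) : ℕ) = ((j : ℕ) + 1) % p := by
      rw [Fin.val_add]; congr 2; rw [Fin.val_one']; exact Nat.mod_eq_of_lt (by omega)
    have hj := j.2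
    split_ifs with h1 h2
    · have : (j : ℕ) = p - 1 := by
        rw [← h1, h2] at hval
        by_contra hne
        rw [Nat.mod_eq_of_lt (by omega)] at hval; simp at hval
      rw [h2, this]
      have : (ζ⁻¹) ^ (p - 1) = ζ := by
        rw [inv_pow]
        apply inv_eq_of_mul_eq_one_right
        rw [← pow_succ, show p - 1 + 1 = p by omega, hζ.pow_eq_one]
      rw [this]; simp; ring
    · have : (i : ℕ) = j + 1 := by
        rw [h1, hval]
        apply Nat.mod_eq_of_lt
        by_contra hne
        have : (j : ℕ) + 1 = p := by omega
        rw [this, Nat.mod_self, ← h1] at hval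
        exact h2 (Fin.ext (by simpa using hval))
      rw [this, pow_succ, smul_eq_mul]; field_simp
    · simp

lemma sym_pow {ζ : F} (hζ : IsPrimitiveRoot ζ p) (y b : F) : Sym p ζ (y ^ p) b := by
  simpa using (sym_one hζ b).scale y

end
end Cft
end

section
open IsDedekindDomain NumberField WithZero Polynomial
namespace Cft
universe u
set_option linter.unusedSectionVars false
set_option linter.all false

variable {F : Type u} [Field F] [NumberField F] {p : ℕ} [hp : Fact p.Prime] {v : HeightOneSpectrum (𝓞 F)}

/-- local norm group -/
def Nv (p : ℕ) [hp : Fact p.Prime] (v : HeightOneSpectrum (𝓞 F)) (a : Fˣ) : Subgroup Fˣ := Nm p a ⊔ Pv p v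

lemma poly_cont (w : Valuation F ℤᵐ⁰) (q : F[X]) (a : F) : ∀ t : ℤᵐ⁰, t ≠ 0 →
    ∃ δ : ℤᵐ⁰, δ ≠ 0 ∧ ∀ x, w (x - a) < δ → w (q.eval x - q.eval a) < t := by
  induction q using Polynomial.induction_on with
  | C c => intro t ht; exact ⟨1, one_ne_zero, fun x _ => by simp [zero_lt_iff, ht]⟩
  | add f g hf hg =>
    intro t ht
    obtain ⟨d, hd, h1⟩ := hf t ht
    obtain ⟨e, he, h2⟩ := hg t ht
    refine ⟨min d e, by rcases min_choice d e with h | h <;> rw [h] <;> assumption, fun x hx => ?_⟩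
    have : (f + g).eval x - (f + g).eval a = (f.eval x - f.eval a) + (g.eval x - g.eval a) := by
      simp; ring
    rw [this]
    exact Valuation.map_add_lt _ (h1 x (hx.trans_le (min_le_left _ _))) (h2 x (hx.trans_le (min_le_right _ _)))
  | monomial n c ih =>
    intro t ht
    set r := c * a ^ n with hr
    -- f(x) x - f(a) a = (f(x) - f(a)) x + f(a)(x - a)
    set B := max (w a) 1 with hB
    have hB0 : B ≠ 0 := (lt_of_lt_of_le zero_lt_one (le_max_right _ _)).ne'
    obtain ⟨d, hd, h1⟩ := ih (t / B) (div_ne_zero ht hB0)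
    set D := max (w r) 1 with hD
    have hD0 : D ≠ 0 := (lt_of_lt_of_le zero_lt_one (le_max_right _ _)).ne'
    refine ⟨min (min d (t / D)) 1, ?_, fun x hx => ?_⟩
    · rcases min_choice (min d (t / D)) 1 with h | h <;> rw [h]
      · rcases min_choice d (t / D) with h | h <;> rw [h]
        · exact hd
        · exact div_ne_zero ht hD0
      · exact one_ne_zero
    have hx1 : w (x - a) < d := hx.trans_le ((min_le_left _ _).trans (min_le_left _ _))
    have hx2 : w (x - a) < t / D := hx.trans_le ((min_le_left _ _).trans (min_le_right _ _))
    have hx3 : w (x - a) < 1 := hx.trans_le (min_le_right _ _)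
    have hxB : w x ≤ B := by
      have : x = (x - a) + a := by ring
      rw [this]
      exact Valuation.map_add_le _ (hx3.le.trans (le_max_right _ _)) (le_max_left _ _)
    have e : (C c * X ^ (n + 1)).eval x - (C c * X ^ (n+1)).eval a =
        ((C c * X ^ n).eval x - (C c * X ^ n).eval a) * x + r * (x - a) := by
      simp [hr]; ring
    rw [e]
    refine Valuation.map_add_lt _ ?_ ?_
    · rw [map_mul]
      calc _ ≤ w ((C c * X ^ n).eval x - (C c * X ^ n).eval a) * B := by gcongr
        _ < t / B * B := mul_lt_mul_of_pos_right (h1 x hx1) (zero_lt_iff.2 hB0)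
        _ = t := div_mul_cancel₀ _ hB0
    · rw [map_mul, mul_comm]
      calc _ ≤ w (x - a) * D := by gcongr; exact le_max_left _ _
        _ < t / D * D := mul_lt_mul_of_pos_right hx2 (zero_lt_iff.2 hD0)
        _ = t := div_mul_cancel₀ _ hD0

lemma Pv_le_Nv (a : Fˣ) : Pv p v ≤ Nv p v a := le_sup_right
lemma Nm_le_Nv (a : Fˣ) : Nm p a ≤ Nv p v a := le_sup_left

lemma Nv_mul_le (a : Fˣ) {u : Fˣ} (hu : u ∈ Pv p v) : Nv p v a ≤ Nv p v (a * u) := by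
  refine sup_le ?_ (Pv_le_Nv _)
  rintro b ⟨f, hf⟩
  set w := v.valuation F with hw
  obtain ⟨q, hq⟩ := det_comp_eval (p := p) f
  have hb0 : w (b : F) ≠ 0 := by rw [Valuation.ne_zero_iff]; exact b.ne_zero
  have ha0 : w (a : F) ≠ 0 := by rw [Valuation.ne_zero_iff]; exact a.ne_zero
  obtain ⟨δ, hδ, hc⟩ := poly_cont w q (a : F) ((w p) ^ p * w b) (mul_ne_zero (tv_pos p v).ne' hb0)
  obtain ⟨y, hy⟩ := Pv_improve hu (δ / w a) (div_ne_zero hδ ha0)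
  have h1 : w ((a * u * y ^ p : Fˣ) - (a : F)) < δ := by
    have : ((a * u * y ^ p : Fˣ) : F) - a = ((u : F) * (y : F) ^ p - 1) * a := by push_cast; ring
    rw [this, map_mul]
    calc _ < δ / w a * w a := mul_lt_mul_of_pos_right hy (zero_lt_iff.2 ha0)
      _ = δ := div_mul_cancel₀ _ ha0
  have h2 := hc _ h1
  rw [← hq, ← hq, hf] at h2
  set d := (aeval (comp p ((a * u * y ^ p : Fˣ) : F)) f).det with hd
  have h3 : w (d / b - 1) < (w p) ^ p := by
    have : d / b - 1 = (d - b) / b := by field_simp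
    rw [this, map_div₀]
    exact (div_lt_iff₀ (zero_lt_iff.2 hb0)).2 h2
  have hd0 : d ≠ 0 := by
    intro h0
    have := val_eq_one (h3.trans_le (tv_le p v))
    rw [h0] at this; simp at this
  have hm : Units.mk0 d hd0 ∈ Nm p (a * u) := Nm_scale _ y ⟨f, rfl⟩
  have hm2 : Units.mk0 d hd0 * b⁻¹ ∈ Pv p v := close_mem_Pv (by simpa [div_eq_mul_inv] using h3)
  have e : b = Units.mk0 d hd0 * (Units.mk0 d hd0 * b⁻¹)⁻¹ := by
    rw [mul_inv, inv_inv, mul_inv_cancel_left]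
  rw [e]
  exact mul_mem (Nm_le_Nv _ hm) (inv_mem (Pv_le_Nv _ hm2))

lemma Nv_mul_eq (a : Fˣ) {u : Fˣ} (hu : u ∈ Pv p v) : Nv p v (a * u) = Nv p v a := by
  refine le_antisymm ?_ (Nv_mul_le a hu)
  have := Nv_mul_le (a * u) (inv_mem hu)
  simpa using this

lemma Nv_top {a : Fˣ} (ha : a ∈ Pv p v) : Nv p v a = ⊤ := by
  have := Nv_mul_eq 1 ha
  rw [one_mul] at this
  rw [this, Nv, Nm_one]; simp

lemma Nv_symm {ζ : F} (hζ : IsPrimitiveRoot ζ p) {a b : Fˣ} (h : b ∈ Nv p v a) : a ∈ Nv p v b := by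
  have hpow : ∀ (x : Fˣ) (y : F), y ^ p = x → x ∈ Pv p v := by
    intro x y hy
    have hy0 : y ≠ 0 := by rintro rfl; rw [zero_pow hp.out.ne_zero] at hy; exact x.ne_zero hy.symm
    have : x = (Units.mk0 y hy0) ^ p := by ext; simp [hy]
    rw [this]; exact pow_mem_Pv _
  by_cases ha : ∃ y : F, y ^ p = a
  · obtain ⟨y, hy⟩ := ha
    exact Pv_le_Nv _ (hpow a y hy)
  push Not at ha
  obtain ⟨n, hn, u, hu, rfl⟩ := Subgroup.mem_sup.1 h
  rw [Nv_mul_eq n hu]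
  by_cases hn' : ∃ y : F, y ^ p = n
  · obtain ⟨y, hy⟩ := hn'
    rw [Nv_top (hpow n y hy)]; trivial
  push Not at hn'
  exact Nm_le_Nv _ ((sym_iff hζ hn').1 ((sym_iff hζ ha).2 hn).symm)

lemma pow_mem_Nv (a y : Fˣ) : y ^ p ∈ Nv p v a := Pv_le_Nv _ (pow_mem_Pv y)

/-- any proper overgroup has index at least `p` -/
lemma index_ge_of_ne_top {G : Type*} [CommGroup G] {H : Subgroup G} (h : ∀ y : G, y ^ p ∈ H) (hne : H ≠ ⊤)
    (hfin : H.index ≠ 0) : p ≤ H.index := by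
  obtain ⟨x, hx⟩ : ∃ x, x ∉ H := by
    by_contra hcon; push Not at hcon; exact hne (by ext; simp [hcon])
  have : orderOf (QuotientGroup.mk x : G ⧸ H) = p := by
    apply orderOf_eq_prime
    · rw [← QuotientGroup.mk_pow, QuotientGroup.eq_one_iff]; exact h x
    · rw [Ne, QuotientGroup.eq_one_iff]; exact hx
  rw [← this]
  haveI : H.FiniteIndex := ⟨hfin⟩
  haveI : Finite (G ⧸ H) := Subgroup.finite_quotient_of_finiteIndex (H := H)
  exact Nat.le_of_dvd (Nat.pos_of_ne_zero hfin) (orderOf_dvd_natCard _)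

lemma Pv_val {x : Fˣ} (hx : x ∈ Pv p v) : ∃ y : Fˣ, v.valuation F (x : F) = v.valuation F (y : F) ^ p := by
  obtain ⟨y, hy⟩ := hx
  refine ⟨y⁻¹, ?_⟩
  have h1 := val_eq_one (hy.trans_le (tv_le p v))
  rw [map_mul, map_pow] at h1
  have : v.valuation F (y : F) ≠ 0 := by rw [Valuation.ne_zero_iff]; exact y.ne_zero
  rw [Units.val_inv_eq_inv_val, map_inv₀, inv_pow]
  exact eq_inv_of_mul_eq_one_left h1

end Cft
end

section
open IsDedekindDomain NumberField WithZero Polynomial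
namespace Cft
universe u
set_option linter.unusedSectionVars false
set_option linter.all false

lemma map_det_comp {p : ℕ} [hp : Fact p.Prime] {R S : Type*} [CommRing R] [CommRing S] (φ : R →+* S) (a : R) (f : R[X]) :
    φ (aeval (comp p a) f).det = (aeval (comp p (φ a)) (f.map φ)).det := by
  have : φ (aeval (comp p a) f).det = _ := RingHom.map_det φ _
  rw [this]; congr 1
  rw [aeval_def, hom_eval₂, aeval_def, eval₂_map]
  congr 1
  · ext c i j
    simp [Matrix.algebraMap_matrix_apply, RingHom.mapMatrix_apply]
    split <;> simp
  · exact comp_map φ a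

section
variable {F : Type u} [Field F] [NumberField F] {p : ℕ} [hp : Fact p.Prime] {v : HeightOneSpectrum (𝓞 F)}

noncomputable abbrev Av (v : HeightOneSpectrum (𝓞 F)) := (v.valuation F).valuationSubring
noncomputable abbrev kv (v : HeightOneSpectrum (𝓞 F)) := IsLocalRing.ResidueField (Av v)

lemma res_zero (x : Av v) : IsLocalRing.residue _ x = 0 ↔ v.valuation F (x : F) < 1 := by
  rw [IsLocalRing.residue_eq_zero_iff, IsLocalRing.mem_maximalIdeal, mem_nonunits_iff,
    (Valuation.valuationSubring.integers (v.valuation F)).isUnit_iff_valuation_eq_one]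
  have : v.valuation F (x : F) ≤ 1 := x.2
  exact ⟨fun h => lt_of_le_of_ne this h, fun h => h.ne⟩

lemma res_ne (x : Av v) : IsLocalRing.residue _ x ≠ 0 ↔ v.valuation F (x : F) = 1 := by
  rw [Ne, res_zero, not_lt]
  have : v.valuation F (x : F) ≤ 1 := x.2
  exact ⟨fun h => le_antisymm this h, fun h => h.ge⟩

lemma res_eq (x y : Av v) : IsLocalRing.residue _ x = IsLocalRing.residue _ y ↔ v.valuation F ((x : F) - y) < 1 := by
  rw [← sub_eq_zero, ← map_sub, res_zero]; rfl

instance kv_finite : Finite (kv v) := by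
  haveI : Finite (𝓞 F ⧸ v.asIdeal) := Ideal.finiteQuotientOfFreeOfNeBot _ v.ne_bot
  let φ : 𝓞 F →+* Av v := (algebraMap (𝓞 F) F).codRestrict (Av v).toSubring (fun x => v.valuation_le_one x)
  let ψ : 𝓞 F →+* kv v := (IsLocalRing.residue _).comp φ
  have hψ : ∀ x ∈ v.asIdeal, ψ x = 0 := by
    intro x hx
    exact (res_zero _).2 ((v.valuation_lt_one_iff_mem x).2 hx)
  apply Finite.of_surjective (Ideal.Quotient.lift _ ψ hψ)
  intro y
  obtain ⟨x, rfl⟩ := IsLocalRing.residue_surjective y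
  obtain ⟨a, ha⟩ := v.exists_valuation_sub_lt_of_integer x.2 1
  exact ⟨Ideal.Quotient.mk _ a, (res_eq _ _).2 (by rw [Units.val_one] at ha; exact ha)⟩

lemma mem_Pv_of_res {x : Fˣ} (hp1 : v.valuation F (p : F) = 1) (hx : v.valuation F (x : F) = 1) :
    x ∈ Pv p v ↔ ∃ z : kv v, z ^ p = IsLocalRing.residue _ (⟨x, hx.le⟩ : Av v) := by
  rw [mem_Pv, hp1, one_pow]
  constructor
  · rintro ⟨y, hy⟩
    have h1 := val_eq_one hy
    rw [map_mul, hx, one_mul, map_pow] at h1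
    replace h1 := (pow_eq_one_iff.1 h1).resolve_right hp.out.ne_zero
    refine ⟨(IsLocalRing.residue _ (⟨y, h1.le⟩ : Av v))⁻¹, ?_⟩
    have h0 := (res_ne (⟨y, h1.le⟩ : Av v)).2 h1
    rw [inv_pow]
    refine inv_eq_of_mul_eq_one_left ?_
    rw [← map_pow, ← map_mul, ← map_one (IsLocalRing.residue (Av v)), res_eq]
    simpa using hy
  · rintro ⟨z, hz⟩
    obtain ⟨y, rfl⟩ := IsLocalRing.residue_surjective z
    have hy1 : v.valuation F (y : F) = 1 := by
      rw [← res_ne]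
      intro h0
      rw [h0, zero_pow hp.out.ne_zero] at hz
      exact (res_ne (⟨x, hx.le⟩ : Av v)).2 hx hz.symm
    have hy0 : (y : F) ≠ 0 := by intro h; rw [h] at hy1; simp at hy1
    refine ⟨(Units.mk0 (y : F) hy0)⁻¹, ?_⟩
    rw [← map_pow, eq_comm, res_eq] at hz
    have : (x : F) * (((Units.mk0 (y : F) hy0)⁻¹ : Fˣ) : F) ^ p - 1 = ((x : F) - (y : F) ^ p) / (y : F) ^ p := by
      simp; field_simp
    rw [this, map_div₀, map_pow, hy1, one_pow, div_one]
    simpa using hz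

lemma det_mod (a : F) (f : F[X]) : (aeval (comp p a) (f %ₘ (X ^ p - C a))).det = (aeval (comp p a) f).det := by
  congr 1
  conv_rhs => rw [← modByMonic_add_div f (X ^ p - C a)]
  rw [map_add, map_mul]
  have : aeval (comp p a) (X ^ p - C a : F[X]) = 0 := by
    simp [comp_pow]
  rw [this]; simp

/-- the residue of a norm is nonzero -/
lemma tame_val {a b : Fˣ} (hp1 : v.valuation F (p : F) = 1) (ha1 : v.valuation F (a : F) = 1)
    (ha : a ∉ Pv p v) (hb : b ∈ Nv p v a) : ∃ y : Fˣ, v.valuation F (b : F) = v.valuation F (y : F) ^ p := by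
  obtain ⟨b, hb', u, hu, rfl⟩ := Subgroup.mem_sup.1 hb
  clear hb
  obtain ⟨z, hz⟩ := Pv_val hu
  suffices ∃ y : Fˣ, v.valuation F (b : F) = v.valuation F (y : F) ^ p by
    obtain ⟨y, hy⟩ := this
    exact ⟨y * z, by rw [Units.val_mul, map_mul, hy, hz, Units.val_mul, map_mul, mul_pow]⟩
  obtain ⟨f, hf⟩ := hb'
  rw [← det_mod] at hf
  set g := f %ₘ (X ^ p - C (a : F)) with hg
  have hdeg : g.natDegree < p := by
    have := natDegree_modByMonic_lt f (monic_XpowC (p := p) (a : F)) (by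
      intro h
      have := congrArg natDegree h
      rw [natDegree_X_pow_sub_C, natDegree_one] at this; exact hp.out.ne_zero this)
    rwa [natDegree_X_pow_sub_C] at this
  have hg0 : g ≠ 0 := by
    intro h
    haveI : Nonempty (Fin p) := ⟨⟨0, hp.out.pos⟩⟩
    rw [h, map_zero, Matrix.det_zero] at hf
    exact b.ne_zero hf.symm
  obtain ⟨m, hm, hmax⟩ := Finset.exists_max_image g.support (fun i => v.valuation F (g.coeff i))
    (by simpa using hg0)
  have hm0 : g.coeff m ≠ 0 := by simpa using hm
  have hmax' : ∀ i, v.valuation F (g.coeff i) ≤ v.valuation F (g.coeff m) := by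
    intro i
    by_cases hi : i ∈ g.support
    · exact hmax i hi
    · rw [notMem_support_iff.1 hi]; simp
  set c := g.coeff m with hc
  have hlift : C c⁻¹ * g ∈ lifts (Av v).subtype := by
    rw [lifts_iff_coeff_lifts]
    intro i
    refine ⟨⟨c⁻¹ * g.coeff i, ?_⟩, by simp⟩
    show v.valuation F _ ≤ 1
    rw [map_mul, map_inv₀]
    exact inv_mul_le_one_of_le₀ (hmax' i) zero_le
  obtain ⟨h, hh⟩ := (mem_lifts _).1 hlift
  have hgc : g = C c * h.map (Av v).subtype := by
    rw [hh, ← mul_assoc, ← C_mul, mul_inv_cancel₀ hm0, C_1, one_mul]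
  let a' : Av v := ⟨a, ha1.le⟩
  have key := map_det_comp (p := p) (Av v).subtype a' h
  have key2 := map_det_comp (p := p) (IsLocalRing.residue (Av v)) a' h
  set d := (aeval (comp p a') h).det with hd
  have hdet : (b : F) = c ^ p * (d : F) := by
    rw [← hf, hgc, map_mul, Matrix.det_mul, aeval_C, Algebra.algebraMap_eq_smul_one, Matrix.det_smul,
      Matrix.det_one, mul_one, Fintype.card_fin]
    congr 1
    exact key.symm
  have hirr : Irreducible (X ^ p - C (IsLocalRing.residue _ a') : (kv v)[X]) :=
    X_pow_sub_C_irreducible_of_prime hp.out (fun z hz => ha ((mem_Pv_of_res hp1 ha1).2 ⟨z, hz⟩))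
  haveI := Fact.mk hirr
  have hd1 : v.valuation F (d : F) = 1 := by
    rw [← res_ne, key2]
    obtain ⟨e, he⟩ := exists_basis (p := p) (IsLocalRing.residue _ a')
    rw [det_aeval_comp e _ he _ (root_pow _)]
    haveI : FiniteDimensional (kv v) (AdjoinRoot (X ^ p - C (IsLocalRing.residue _ a') : (kv v)[X])) := e.finiteDimensional_of_finite
    rw [Algebra.norm_ne_zero_iff]
    intro h0
    rw [AdjoinRoot.aeval_eq, AdjoinRoot.mk_eq_zero] at h0
    have hne : h.map (IsLocalRing.residue (Av v)) ≠ 0 := by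
      intro h1
      have h2 := congrArg (fun q => coeff q m) h1
      simp only [coeff_map, coeff_zero] at h2
      rw [res_zero] at h2
      have h3 := congrArg (fun q => coeff q m) hh
      simp only [coeff_map, coeff_C_mul, ← hc, inv_mul_cancel₀ hm0] at h3
      have h4 : ((h.coeff m : Av v) : F) = 1 := h3
      rw [h4] at h2; simp at h2
    have h5 := natDegree_le_of_dvd h0 hne
    rw [natDegree_X_pow_sub_C] at h5
    have h6 : (h.map (IsLocalRing.residue (Av v))).natDegree ≤ h.natDegree := natDegree_map_le
    have h7 : h.natDegree = g.natDegree := by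
      rw [hgc, natDegree_C_mul hm0, natDegree_map_eq_of_injective (Subtype.val_injective)]
    omega
  exact ⟨Units.mk0 c hm0, by rw [hdet, map_mul, hd1, mul_one, map_pow]; simp⟩

lemma res_unit_pow {x : Fˣ} (hx : v.valuation F (x : F) = 1) :
    ∃ u : (kv v)ˣ, (u : kv v) = IsLocalRing.residue _ (⟨x, hx.le⟩ : Av v) :=
  ⟨Units.mk0 _ ((res_ne (⟨x, hx.le⟩ : Av v)).2 hx), rfl⟩

lemma lift_unit (u : (kv v)ˣ) : ∃ x : Fˣ, ∃ hx : v.valuation F (x : F) = 1,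
    (u : kv v) = IsLocalRing.residue _ (⟨x, hx.le⟩ : Av v) := by
  obtain ⟨y, hy⟩ := IsLocalRing.residue_surjective (u : kv v)
  have h1 : v.valuation F (y : F) = 1 := (res_ne y).1 (by rw [hy]; exact u.ne_zero)
  have hy0 : (y : F) ≠ 0 := by intro h; rw [h] at h1; simp at h1
  exact ⟨Units.mk0 (y : F) hy0, h1, hy.symm⟩

lemma mem_Pv_of_res' {x : Fˣ} (hp1 : v.valuation F (p : F) = 1) (hx : v.valuation F (x : F) = 1) (u : (kv v)ˣ)
    (hu : (u : kv v) = IsLocalRing.residue _ (⟨x, hx.le⟩ : Av v)) :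
    x ∈ Pv p v ↔ u ∈ (powMonoidHom p : (kv v)ˣ →* (kv v)ˣ).range := by
  rw [mem_Pv_of_res hp1 hx, ← hu]
  constructor
  · rintro ⟨z, hz⟩
    have hz0 : z ≠ 0 := by rintro rfl; rw [zero_pow hp.out.ne_zero] at hz; exact u.ne_zero hz.symm
    exact ⟨Units.mk0 z hz0, by ext; simpa using hz⟩
  · rintro ⟨z, rfl⟩
    exact ⟨z, by simp⟩

lemma zeta_val {ζ : F} (hζ : IsPrimitiveRoot ζ p) : v.valuation F ζ = 1 := by
  have : v.valuation F (ζ ^ p) = 1 := by rw [hζ.pow_eq_one, map_one]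
  rw [map_pow] at this
  exact (pow_eq_one_iff.1 this).resolve_right hp.out.ne_zero

lemma zeta_sub_val {ζ : F} (hζ : IsPrimitiveRoot ζ p) (hp1 : v.valuation F (p : F) = 1) :
    v.valuation F (ζ - 1) = 1 := by
  have hz := zeta_val (v := v) hζ
  have hle : v.valuation F (ζ - 1) ≤ 1 := Valuation.map_sub_le _ hz.le (by simp)
  by_contra hne
  have hlt := lt_of_le_of_ne hle hne
  have h1 : IsLocalRing.residue _ (⟨ζ, hz.le⟩ : Av v) = 1 := by
    rw [← map_one (IsLocalRing.residue (Av v)), res_eq]; simpa using hlt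
  have h2 : ∑ i ∈ Finset.range p, (⟨ζ, hz.le⟩ : Av v) ^ i = 0 := by
    apply Subtype.ext
    have := hζ.geom_sum_eq_zero hp.out.one_lt
    simpa using this
  have h3 := congrArg (IsLocalRing.residue (Av v)) h2
  rw [map_sum] at h3
  simp only [map_pow, h1, one_pow, Finset.sum_const, Finset.card_range, nsmul_eq_mul, mul_one, map_zero] at h3
  have h4 : IsLocalRing.residue (Av v) (p : Av v) = 0 := by simpa using h3
  rw [res_zero] at h4
  simp [hp1] at h4

lemma card_kv {ζ : F} (hζ : IsPrimitiveRoot ζ p) (hp1 : v.valuation F (p : F) = 1) :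
    (powMonoidHom p : (kv v)ˣ →* (kv v)ˣ).range.index = p := by
  rw [IsCyclic.index_powMonoidHom_range]
  apply Nat.gcd_eq_right
  have hz := zeta_val (v := v) hζ
  let z : Fˣ := Units.mk0 ζ (hζ.ne_zero hp.out.ne_zero)
  obtain ⟨u, hu⟩ := res_unit_pow (v := v) (x := z) hz
  have : orderOf u = p := by
    apply orderOf_eq_prime
    · ext
      rw [Units.val_pow_eq_pow_val, hu, ← map_pow, Units.val_one, ← map_one (IsLocalRing.residue (Av v))]
      congr 1
      apply Subtype.ext
      simp [z, hζ.pow_eq_one]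
    · intro h1
      rw [h1, Units.val_one, ← map_one (IsLocalRing.residue (Av v)), eq_comm, res_eq] at hu
      have := zeta_sub_val hζ hp1
      simp [z, this] at hu
  rw [← this]; exact orderOf_dvd_natCard u

lemma exists_nonres {ζ : F} (hζ : IsPrimitiveRoot ζ p) (hp1 : v.valuation F (p : F) = 1) :
    ∃ x : Fˣ, v.valuation F (x : F) = 1 ∧ x ∉ Pv p v := by
  have : (powMonoidHom p : (kv v)ˣ →* (kv v)ˣ).range ≠ ⊤ := by
    intro h
    have := card_kv (v := v) hζ hp1
    rw [h, Subgroup.index_top] at this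
    exact hp.out.one_lt.ne this
  obtain ⟨u, hu⟩ : ∃ u, u ∉ (powMonoidHom p : (kv v)ˣ →* (kv v)ˣ).range := by
    by_contra hcon; push Not at hcon; exact this (by ext; simp [hcon])
  obtain ⟨x, hx, hxu⟩ := lift_unit u
  exact ⟨x, hx, fun h => hu ((mem_Pv_of_res' hp1 hx u hxu).1 h)⟩

lemma scale_val {a y : Fˣ} (h : v.valuation F (a : F) = v.valuation F (y : F) ^ p) :
    ∃ a' : Fˣ, a = a' * y ^ p ∧ v.valuation F (a' : F) = 1 := by
  refine ⟨a * (y ^ p)⁻¹, by simp, ?_⟩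
  have : v.valuation F (y : F) ≠ 0 := by rw [Valuation.ne_zero_iff]; exact y.ne_zero
  simp only [Units.val_mul, Units.val_inv_eq_inv_val, Units.val_pow_eq_pow_val, map_mul, map_inv₀, map_pow, h]
  exact mul_inv_cancel₀ (pow_ne_zero _ this)

lemma tame_ne {ζ : F} (hζ : IsPrimitiveRoot ζ p) (hp1 : v.valuation F (p : F) = 1) {a : Fˣ} (ha : a ∉ Pv p v) :
    Nv p v a ≠ ⊤ := by
  intro htop
  by_cases hy : ∃ y : Fˣ, v.valuation F (a : F) = v.valuation F (y : F) ^ p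
  · obtain ⟨y, hy⟩ := hy
    obtain ⟨a', rfl, ha'⟩ := scale_val hy
    rw [Nv_mul_eq _ (pow_mem_Pv y)] at htop
    have ha'' : a' ∉ Pv p v := fun h => ha (mul_mem h (pow_mem_Pv y))
    obtain ⟨π, hπ⟩ := v.valuation_exists_uniformizer F
    have hπ0 : π ≠ 0 := by
      rintro rfl
      rw [map_zero] at hπ
      exact WithZero.exp_ne_zero hπ.symm
    obtain ⟨z, hz⟩ := tame_val hp1 ha' ha'' (b := Units.mk0 π hπ0) (by rw [htop]; trivial)
    rw [Units.val_mk0, hπ] at hz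
    have hz0 : v.valuation F (z : F) ≠ 0 := by rw [Valuation.ne_zero_iff]; exact z.ne_zero
    have h2 := congrArg WithZero.log hz
    rw [WithZero.log_pow, WithZero.log_exp] at h2
    have : (p : ℤ) ∣ 1 := ⟨-WithZero.log (v.valuation F (z : F)), by simp at h2 ⊢; linarith⟩
    have := Int.eq_one_of_dvd_one (by positivity) this
    exact hp.out.one_lt.ne' (by exact_mod_cast this)
  · obtain ⟨b, hb, hb'⟩ := exists_nonres (v := v) hζ hp1
    exact hy (tame_val hp1 hb hb' (Nv_symm hζ (by rw [htop]; trivial)))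

lemma exists_det_finite {k : Type*} [Field k] [Finite k] {a : k} (hirr : Irreducible (X ^ p - C a : k[X])) (b : k) :
    ∃ f : k[X], (aeval (comp p a) f).det = b := by
  haveI := Fact.mk hirr
  obtain ⟨e, he⟩ := exists_basis (p := p) a
  haveI : FiniteDimensional k (AdjoinRoot (X ^ p - C a : k[X])) := e.finiteDimensional_of_finite
  haveI : Finite (AdjoinRoot (X ^ p - C a : k[X])) := Module.finite_of_finite k
  obtain ⟨x, hx⟩ := FiniteField.norm_surjective k (AdjoinRoot (X ^ p - C a : k[X])) b
  obtain ⟨f, rfl⟩ := AdjoinRoot.mk_surjective x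
  exact ⟨f, by rw [det_aeval_comp e _ he _ (root_pow _), AdjoinRoot.aeval_eq]; exact hx⟩

lemma lemmaU {a b y z : Fˣ} (hp1 : v.valuation F (p : F) = 1)
    (hy : v.valuation F (a : F) = v.valuation F (y : F) ^ p) (hz : v.valuation F (b : F) = v.valuation F (z : F) ^ p) :
    b ∈ Nv p v a := by
  by_cases ha : a ∈ Pv p v
  · rw [Nv_top ha]; trivial
  obtain ⟨a, rfl, ha1⟩ := scale_val hy
  obtain ⟨b, rfl, hb1⟩ := scale_val hz
  rw [Nv_mul_eq _ (pow_mem_Pv y)]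
  replace ha : a ∉ Pv p v := fun h => ha (mul_mem h (pow_mem_Pv y))
  refine mul_mem ?_ (pow_mem_Nv _ _)
  let a' : Av v := ⟨a, ha1.le⟩
  let b' : Av v := ⟨b, hb1.le⟩
  have hirr : Irreducible (X ^ p - C (IsLocalRing.residue _ a') : (kv v)[X]) :=
    X_pow_sub_C_irreducible_of_prime hp.out (fun z hz => ha ((mem_Pv_of_res hp1 ha1).2 ⟨z, hz⟩))
  obtain ⟨f, hx⟩ := exists_det_finite (p := p) hirr (IsLocalRing.residue _ b')
  obtain ⟨h, rfl⟩ := Polynomial.map_surjective _ IsLocalRing.residue_surjective f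
  rw [← map_det_comp] at hx
  have key := map_det_comp (p := p) (Av v).subtype a' h
  set d := (aeval (comp p a') h).det with hd
  have hd1 : v.valuation F (d : F) = 1 := by
    rw [← res_ne, hx, res_ne]; exact hb1
  have hd0 : (d : F) ≠ 0 := by intro h; rw [h] at hd1; simp at hd1
  have hm : Units.mk0 (d : F) hd0 ∈ Nm p a := ⟨_, key.symm⟩
  have hm2 : Units.mk0 (d : F) hd0 * b⁻¹ ∈ Pv p v := by
    apply close_mem_Pv
    rw [hp1, one_pow]
    have : ((Units.mk0 (d : F) hd0 * b⁻¹ : Fˣ) : F) - 1 = ((d : F) - b) / b := by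
      simp; field_simp
    rw [this, map_div₀, hb1, div_one]
    exact (res_eq _ _).1 hx
  have e : b = Units.mk0 (d : F) hd0 * (Units.mk0 (d : F) hd0 * b⁻¹)⁻¹ := by
    rw [mul_inv, inv_inv, mul_inv_cancel_left]
  rw [e]
  exact mul_mem (Nm_le_Nv _ hm) (inv_mem (Pv_le_Nv _ hm2))

lemma tame_gen {ζ : F} (hζ : IsPrimitiveRoot ζ p) {a c y z : Fˣ} (hp1 : v.valuation F (p : F) = 1)
    (hy : v.valuation F (a : F) = v.valuation F (y : F) ^ p) (hz : v.valuation F (c : F) = v.valuation F (z : F) ^ p)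
    (ha : a ∉ Pv p v) : ∃ j : ℤ, c * a ^ j ∈ Pv p v := by
  obtain ⟨a, rfl, ha1⟩ := scale_val hy
  obtain ⟨c, rfl, hc1⟩ := scale_val hz
  replace ha : a ∉ Pv p v := fun h => ha (mul_mem h (pow_mem_Pv y))
  suffices ∃ j : ℤ, c * a ^ j ∈ Pv p v by
    obtain ⟨j, hj⟩ := this
    refine ⟨j, ?_⟩
    have : c * z ^ p * (a * y ^ p) ^ j = (c * a ^ j) * (z ^ p * (y ^ j) ^ p) := by
      rw [mul_zpow, ← zpow_natCast (y ^ j), ← zpow_mul, mul_comm j, zpow_mul, zpow_natCast]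
      exact mul_mul_mul_comm _ _ _ _
    rw [this]
    exact mul_mem hj (mul_mem (pow_mem_Pv _) (pow_mem_Pv _))
  obtain ⟨ua, hua⟩ := res_unit_pow (v := v) ha1
  obtain ⟨uc, huc⟩ := res_unit_pow (v := v) hc1
  set H := (powMonoidHom p : (kv v)ˣ →* (kv v)ˣ).range with hH
  have ha' : ua ∉ H := fun h => ha ((mem_Pv_of_res' hp1 ha1 ua hua).2 h)
  have hind := card_kv (v := v) hζ hp1
  have htop : H ⊔ Subgroup.zpowers ua = ⊤ := by
    have hle : H ≤ H ⊔ Subgroup.zpowers ua := le_sup_left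
    have hmul := Subgroup.relIndex_mul_index hle
    rw [← hH] at hind
    rw [hind] at hmul
    have hdvd : (H ⊔ Subgroup.zpowers ua).index ∣ p := ⟨_, by rw [mul_comm]; exact hmul.symm⟩
    rcases (Nat.dvd_prime hp.out).1 hdvd with h | h
    · exact Subgroup.index_eq_one.1 h
    · exfalso
      rw [h] at hmul
      have : H.relIndex (H ⊔ Subgroup.zpowers ua) = 1 := by
        have := hp.out.pos; nlinarith
      rw [Subgroup.relIndex_eq_one] at this
      exact ha' (this (Subgroup.mem_sup_right (Subgroup.mem_zpowers ua)))
  have hm : uc ∈ H ⊔ Subgroup.zpowers ua := by rw [htop]; trivial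
  obtain ⟨t, ht, s, ⟨j, rfl⟩, hts⟩ := Subgroup.mem_sup.1 hm
  refine ⟨-j, ?_⟩
  have hval : v.valuation F ((c * a ^ (-j) : Fˣ) : F) = 1 := by
    rw [Units.val_mul, Units.val_zpow_eq_zpow_val, map_mul, map_zpow₀, ha1, hc1]; simp
  have hzp : ∀ (n : ℤ) (x : Fˣ) (hx : v.valuation F (x : F) = 1) (u : (kv v)ˣ) (hu : (u : kv v) = IsLocalRing.residue _ (⟨x, hx.le⟩ : Av v))
    (hx' : v.valuation F ((x ^ n : Fˣ) : F) = 1), ((u ^ n : (kv v)ˣ) : kv v) = IsLocalRing.residue _ (⟨(x ^ n : Fˣ), hx'.le⟩ : Av v) := by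
    intro n x hx u hu hx'
    have hA : IsUnit (⟨x, hx.le⟩ : Av v) := by
      rw [(Valuation.valuationSubring.integers (v.valuation F)).isUnit_iff_valuation_eq_one]; exact hx
    obtain ⟨t, ht⟩ := hA
    have h1 : (⟨(x ^ n : Fˣ), hx'.le⟩ : Av v) = ((t ^ n : (Av v)ˣ) : Av v) := by
      apply Subtype.ext
      have h2 : Units.map (Av v).subtype.toMonoidHom t = x := by
        ext; simp [ht]
      have h3 : Units.map (Av v).subtype.toMonoidHom (t ^ n) = x ^ n := by rw [map_zpow, h2]
      exact (congrArg Units.val h3).symm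
    have h4 : Units.map (IsLocalRing.residue (Av v)).toMonoidHom t = u := by
      ext; rw [hu, ← ht]; rfl
    rw [h1, ← h4, ← map_zpow]; rfl
  have hval' : v.valuation F ((a ^ (-j) : Fˣ) : F) = 1 := by
    rw [Units.val_zpow_eq_zpow_val, map_zpow₀, ha1]; simp
  refine (mem_Pv_of_res' hp1 hval (uc * ua ^ (-j)) ?_).2 ?_
  · rw [Units.val_mul, huc, hzp (-j) a ha1 ua hua hval', ← map_mul]; rfl
  · rw [← hts]
    have : t * (fun x => ua ^ x) j * ua ^ (-j) = t := by simp
    rw [this]; exact ht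
end
end Cft
end

section
open IsDedekindDomain NumberField WithZero Polynomial
namespace Cft
universe u
set_option linter.unusedSectionVars false
set_option linter.all false

lemma root_val {K : Type*} [Field K] (w : Valuation K ℤᵐ⁰) {p : ℕ} (hp : p ≠ 0) {μ : K} (h : μ ^ p = 1) : w μ = 1 := by
  have : w (μ ^ p) = 1 := by rw [h, map_one]
  rw [map_pow] at this
  exact (pow_eq_one_iff.1 this).resolve_right hp

lemma rootsep {K : Type*} [Field K] (w : Valuation K ℤᵐ⁰) {p : ℕ} [hp : Fact p.Prime] {ζ : K}
    (hζ : IsPrimitiveRoot ζ p) (x : K) : ∃ μ, μ ^ p = 1 ∧ w (x - μ) * w (p : K) ≤ w (x ^ p - 1) := by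
  classical
  have hpos := hp.out.pos
  obtain ⟨μ, hμ, hmin⟩ := Finset.exists_min_image (nthRootsFinset p (1 : K)) (fun ν => w (x - ν))
    ⟨1, by simp [mem_nthRootsFinset hpos]⟩
  have hμ1 : μ ^ p = 1 := (mem_nthRootsFinset hpos 1).1 hμ
  refine ⟨μ, hμ1, ?_⟩
  have key := X_pow_sub_one_eq_prod hpos hζ
  rw [← Finset.mul_prod_erase _ _ hμ] at key
  have h1 := congrArg (eval x) key
  simp only [eval_sub, eval_pow, eval_X, eval_one, eval_mul, eval_C, eval_prod] at h1
  have h2 := congrArg (fun q => eval μ (derivative q)) key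
  simp only [derivative_mul, derivative_sub, derivative_X_pow, derivative_one, derivative_X, derivative_C, eval_add,
    eval_mul, eval_sub, eval_pow, eval_X, eval_C, eval_prod, sub_self, zero_mul, add_zero, sub_zero, eval_one, one_mul,
    eval_natCast, map_natCast] at h2
  have h3 : w (p : K) = ∏ ν ∈ (nthRootsFinset p (1 : K)).erase μ, w (μ - ν) := by
    rw [← map_prod, ← h2, map_mul, map_pow, root_val w hpos.ne' hμ1, one_pow, mul_one]
  rw [h1, map_mul, map_prod, h3]
  refine mul_le_mul_right (Finset.prod_le_prod (fun _ _ => zero_le) (fun ν hν => ?_)) _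
  have h4 := hmin ν (Finset.mem_of_mem_erase hν)
  have : μ - ν = (x - ν) - (x - μ) := by ring
  rw [this]
  exact Valuation.map_sub_le _ le_rfl h4

lemma index_le_of_gen {Q : Type*} [CommGroup Q] {R : Subgroup Q} {p : ℕ} (hp : 0 < p) (π : Q) (h1 : π ^ p ∈ R)
    (h2 : ∀ x, ∃ k : ℤ, x * π ^ k ∈ R) : R.index ≠ 0 ∧ R.index ≤ p := by
  have ho : orderOf (QuotientGroup.mk π : Q ⧸ R) ∣ p := by
    apply orderOf_dvd_of_pow_eq_one
    rw [← QuotientGroup.mk_pow, QuotientGroup.eq_one_iff]; exact h1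
  have htop : ∀ x : Q ⧸ R, x ∈ Subgroup.zpowers (QuotientGroup.mk π : Q ⧸ R) := by
    intro x
    obtain ⟨x, rfl⟩ := QuotientGroup.mk_surjective x
    obtain ⟨k, hk⟩ := h2 x
    refine ⟨-k, ?_⟩
    show (QuotientGroup.mk π : Q ⧸ R) ^ (-k) = _
    rw [← QuotientGroup.mk_zpow, QuotientGroup.eq]
    simpa [mul_comm] using hk
  have hc : R.index = orderOf (QuotientGroup.mk π : Q ⧸ R) := by
    rw [Subgroup.index, ← orderOf_eq_card_of_forall_mem_zpowers htop]
  rw [hc]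
  exact ⟨(Nat.pos_of_dvd_of_pos ho hp).ne', Nat.le_of_dvd hp ho⟩

section
variable {F : Type u} [Field F] [NumberField F] {p : ℕ} [hp : Fact p.Prime] {v : HeightOneSpectrum (𝓞 F)}

lemma val_le_pow_iff (x : 𝓞 F) (n : ℕ) : v.valuation F (x : F) ≤ exp (-(n : ℤ)) ↔ x ∈ v.asIdeal ^ n := by
  have := v.intValuation_le_pow_iff_mem x n
  rw [← this]
  have h2 := v.valuation_of_algebraMap (K := F) x
  rw [← h2]

lemma val_eq_one_of_unit_quot {n : ℕ} (hn : n ≠ 0) {x : 𝓞 F} (h : IsUnit (Ideal.Quotient.mk (v.asIdeal ^ n) x)) :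
    v.valuation F (x : F) = 1 := by
  have : v.valuation F (algebraMap (𝓞 F) F x) = 1 := by
    rw [v.valuation_eq_one_iff_notMem]
    intro hx
    obtain ⟨u, hu⟩ := h
    obtain ⟨y, hy⟩ := Ideal.Quotient.mk_surjective ((u⁻¹ : (𝓞 F ⧸ v.asIdeal ^ n)ˣ) : 𝓞 F ⧸ v.asIdeal ^ n)
    have h1 : Ideal.Quotient.mk (v.asIdeal ^ n) (x * y) = 1 := by
      rw [map_mul, hy, ← hu]; simp
    rw [← map_one (Ideal.Quotient.mk (v.asIdeal ^ n)), Ideal.Quotient.eq] at h1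
    have h2 := Ideal.pow_le_self hn h1
    have h3 : x * y ∈ v.asIdeal := Ideal.mul_mem_right _ _ hx
    have : (1 : 𝓞 F) ∈ v.asIdeal := by
      have := Ideal.sub_mem _ h3 h2
      simpa using this
    exact v.isPrime.ne_top ((Ideal.eq_top_iff_one _).2 this)
  exact this

lemma card_quot_pow (n : ℕ) : Nat.card (𝓞 F ⧸ v.asIdeal ^ n) = (Nat.card (𝓞 F ⧸ v.asIdeal)) ^ n := by
  have := map_pow (Ideal.absNorm (S := 𝓞 F)) v.asIdeal n
  simpa [Ideal.absNorm_apply, Submodule.cardQuot_apply] using this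

instance finite_quot (n : ℕ) : Finite (𝓞 F ⧸ v.asIdeal ^ n) :=
  Ideal.finiteQuotientOfFreeOfNeBot _ (pow_ne_zero n v.ne_bot)

lemma card_torsion_le {ζ : F} (hζ : IsPrimitiveRoot ζ p) {e : ℕ} (he : v.valuation F (p : F) = exp (-(e : ℤ))) (k : ℕ) :
    Nat.card (powMonoidHom p : (𝓞 F ⧸ v.asIdeal ^ (k + e))ˣ →* _).ker ≤ p * (Nat.card (𝓞 F ⧸ v.asIdeal)) ^ e := by
  classical
  set N := Nat.card (𝓞 F ⧸ v.asIdeal) with hN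
  haveI : Finite (𝓞 F ⧸ v.asIdeal) := Ideal.finiteQuotientOfFreeOfNeBot _ v.ne_bot
  have hNpos : 0 < N := Nat.card_pos
  let f : (𝓞 F ⧸ v.asIdeal ^ (k + e)) →+* (𝓞 F ⧸ v.asIdeal ^ k) :=
    Ideal.Quotient.factor (Ideal.pow_le_pow_right (Nat.le_add_right k e))
  have hf : ∀ x, f (Ideal.Quotient.mk _ x) = Ideal.Quotient.mk _ x := fun x => rfl
  have hcardker : Nat.card f.toAddMonoidHom.ker = N ^ e := by
    have h1 := AddSubgroup.card_mul_index f.toAddMonoidHom.ker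
    rw [AddSubgroup.index_ker] at h1
    have h2 : f.toAddMonoidHom.range = ⊤ := by
      rw [AddMonoidHom.range_eq_top]
      intro y
      obtain ⟨x, rfl⟩ := Ideal.Quotient.mk_surjective y
      exact ⟨Ideal.Quotient.mk _ x, rfl⟩
    rw [h2, AddSubgroup.card_top, card_quot_pow, card_quot_pow] at h1
    exact Nat.eq_of_mul_eq_mul_left (pow_pos hNpos k) (by rw [mul_comm]; exact h1.trans (pow_add N k e))
  set T := (powMonoidHom p : (𝓞 F ⧸ v.asIdeal ^ (k + e))ˣ →* _).ker with hT
  let r : T →* (𝓞 F ⧸ v.asIdeal ^ k)ˣ := (Units.map f.toMonoidHom).comp T.subtype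
  have h1 := Subgroup.card_mul_index r.ker
  rw [Subgroup.index_ker] at h1
  rw [← h1, mul_comm]
  have hz : IsPrimitiveRoot hζ.toInteger p := hζ.toInteger_isPrimitiveRoot
  refine Nat.mul_le_mul ?_ ?_
  · -- the range
    let S : Finset (𝓞 F ⧸ v.asIdeal ^ k) := (Finset.range p).image fun i => Ideal.Quotient.mk _ (hζ.toInteger ^ i)
    have hS : S.card ≤ p := Finset.card_image_le.trans (by simp)
    refine le_trans ?_ hS
    have : ∀ y : r.range, ((y : (𝓞 F ⧸ v.asIdeal ^ k)ˣ) : 𝓞 F ⧸ v.asIdeal ^ k) ∈ S := by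
      rintro ⟨_, ⟨g, hg⟩, rfl⟩
      obtain ⟨x, hx⟩ := Ideal.Quotient.mk_surjective (g : 𝓞 F ⧸ v.asIdeal ^ (k + e))
      have hg1 : g ^ p = 1 := hg
      have hxp : x ^ p - 1 ∈ v.asIdeal ^ (k + e) := by
        rw [← Ideal.Quotient.eq, map_pow, hx, map_one, ← Units.val_pow_eq_pow_val, hg1, Units.val_one]
      rw [← val_le_pow_iff] at hxp
      obtain ⟨μ, hμ, hle⟩ := rootsep (v.valuation F) hζ (x : F)
      obtain ⟨i, hi, rfl⟩ := hζ.eq_pow_of_pow_eq_one hμ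
      have h5 : v.valuation F (((x - hζ.toInteger ^ i : 𝓞 F)) : F) ≤ exp (-(k : ℤ)) := by
        have h6 : v.valuation F ((x : F) - ζ ^ i) * exp (-(e : ℤ)) ≤ exp (-(k : ℤ)) * exp (-(e : ℤ)) := by
          rw [he] at hle
          refine hle.trans ?_
          have h7 : -(k : ℤ) + -(e : ℤ) = -((k + e : ℕ) : ℤ) := by push_cast; ring
          rw [← WithZero.exp_add, h7]
          simpa using hxp
        have h8 := le_of_mul_le_mul_right h6 (WithZero.exp_pos)
        have e1 : ((x - hζ.toInteger ^ i : 𝓞 F) : F) = (x : F) - ζ ^ i := by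
          push_cast; rfl
        rw [e1]; exact h8
      rw [val_le_pow_iff, ← Ideal.Quotient.eq] at h5
      refine Finset.mem_image.2 ⟨i, Finset.mem_range.2 hi, ?_⟩
      rw [← h5, ← hf, hx]; rfl
    have hinj : Function.Injective (fun y : r.range => (⟨_, this y⟩ : S)) := by
      intro y z h
      apply Subtype.ext; apply Units.ext
      exact congrArg Subtype.val h
    have := Nat.card_le_card_of_injective _ hinj
    simpa using this
  · rw [← hcardker]
    have : ∀ y : r.ker, (((y : T) : (𝓞 F ⧸ v.asIdeal ^ (k + e))ˣ) : 𝓞 F ⧸ v.asIdeal ^ (k+e)) - 1 ∈ f.toAddMonoidHom.ker := by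
      rintro ⟨y, hy⟩
      rw [MonoidHom.mem_ker] at hy
      rw [AddMonoidHom.mem_ker]
      have h2 := congrArg Units.val hy
      have h3 : f ((y : (𝓞 F ⧸ v.asIdeal ^ (k + e))ˣ) : 𝓞 F ⧸ v.asIdeal ^ (k+e)) = 1 := h2
      show f _ = 0
      rw [map_sub, h3, map_one, sub_self]
    apply Nat.card_le_card_of_injective (fun y : r.ker => (⟨_, this y⟩ : f.toAddMonoidHom.ker))
    intro y z h
    have h2 := congrArg Subtype.val h
    simp only [sub_left_inj] at h2
    apply Subtype.ext; apply Subtype.ext; apply Units.ext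
    exact h2

lemma index_Pv_le {ζ : F} (hζ : IsPrimitiveRoot ζ p) {e : ℕ} (he : v.valuation F (p : F) = exp (-(e : ℤ))) :
    (Pv p v).index ≠ 0 ∧ (Pv p v).index ≤ p ^ 2 * (Nat.card (𝓞 F ⧸ v.asIdeal)) ^ e := by
  classical
  set k := (p - 1) * e + 1 with hk
  set M := k + e with hM
  have hMe : M = p * e + 1 := by
    have := hp.out.one_lt
    obtain ⟨q, rfl⟩ : ∃ q, p = q + 1 := ⟨p - 1, by omega⟩
    simp [hM, hk]; ring
  have hM0 : M ≠ 0 := by omega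
  have ht : ∀ t : ℤᵐ⁰, t ≤ exp (-(M : ℤ)) → t < (v.valuation F (p : F)) ^ p := by
    intro t ht
    refine ht.trans_lt ?_
    rw [he, ← WithZero.exp_nsmul, WithZero.exp_lt_exp, hMe]; push_cast; simp
  set G := (𝓞 F ⧸ v.asIdeal ^ M)ˣ with hG
  have hlift : ∀ g : G, ∃ x : Fˣ, ∃ y : 𝓞 F, (x : F) = y ∧ Ideal.Quotient.mk _ y = (g : 𝓞 F ⧸ v.asIdeal ^ M) := by
    intro g
    obtain ⟨y, hy⟩ := Ideal.Quotient.mk_surjective (g : 𝓞 F ⧸ v.asIdeal ^ M)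
    have hu : IsUnit (Ideal.Quotient.mk (v.asIdeal ^ M) y) := by rw [hy]; exact g.isUnit
    have h1 := val_eq_one_of_unit_quot hM0 hu
    have hy0 : (y : F) ≠ 0 := by intro h; rw [h] at h1; simp at h1
    exact ⟨Units.mk0 (y : F) hy0, y, rfl, hy⟩
  have hcong : ∀ (x x' : Fˣ) (y y' : 𝓞 F), (x : F) = y → (x' : F) = y' → v.valuation F (y' : F) = 1 →
      Ideal.Quotient.mk (v.asIdeal ^ M) y = Ideal.Quotient.mk _ y' → (QuotientGroup.mk x : Fˣ ⧸ Pv p v) = QuotientGroup.mk x' := by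
    intro x x' y y' hx hx' h1 h
    rw [eq_comm, QuotientGroup.eq]
    apply close_mem_Pv
    apply ht
    have : ((x'⁻¹ * x : Fˣ) : F) - 1 = ((y - y' : 𝓞 F) : F) / (y' : F) := by
      have : (y' : F) ≠ 0 := by rw [← hx']; exact x'.ne_zero
      push_cast
      rw [hx, hx']
      field_simp
    rw [this, map_div₀, h1, div_one, val_le_pow_iff, ← Ideal.Quotient.eq]
    exact h
  choose X Y hXY hY using hlift
  have hYu : ∀ g, v.valuation F (Y g : F) = 1 := fun g =>
    val_eq_one_of_unit_quot hM0 (by rw [hY]; exact g.isUnit)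
  let ψ : G →* Fˣ ⧸ Pv p v := MonoidHom.mk' (fun g => QuotientGroup.mk (X g)) (by
    intro g h
    show _ = QuotientGroup.mk (X g * X h)
    refine (hcong _ _ (Y g * Y h) (Y (g * h)) ?_ (hXY _) (hYu _) ?_).symm
    · push_cast; rw [hXY, hXY]
    · rw [map_mul, hY, hY, hY]; rfl)
  have hunit : ∀ x : Fˣ, v.valuation F (x : F) = 1 → (QuotientGroup.mk x : Fˣ ⧸ Pv p v) ∈ ψ.range := by
    intro x hx
    obtain ⟨y, hy⟩ := v.exists_valuation_sub_lt_of_integer hx.le (Units.mk0 (exp (-(M : ℤ))) WithZero.exp_ne_zero)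
    rw [Units.val_mk0] at hy
    have hy1 : v.valuation F (y : F) = 1 := by
      have h2 : v.valuation F ((y : F) / x - 1) < 1 := by
        have : (y : F) / x - 1 = ((y : F) - x) / x := by have := x.ne_zero; field_simp
        rw [this, map_div₀, hx, div_one]
        refine hy.trans ?_
        rw [← WithZero.exp_zero, WithZero.exp_lt_exp]; omega
      have := val_eq_one h2
      rwa [map_div₀, hx, div_one] at this
    have hyM : IsUnit (Ideal.Quotient.mk (v.asIdeal ^ M) y) := by
      have hny : y ∉ v.asIdeal := by
        rw [← v.valuation_eq_one_iff_notMem (K := F)]; exact hy1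
      haveI := v.isMaximal
      exact Ideal.Quotient.isUnit_mk_pow_of_notMem _ hny
    have hy0 : (y : F) ≠ 0 := by intro h; rw [h] at hy1; simp at hy1
    obtain ⟨g, hg⟩ := hyM
    refine ⟨g, ?_⟩
    show (QuotientGroup.mk (X g) : Fˣ ⧸ Pv p v) = QuotientGroup.mk x
    rw [hcong (X g) (Units.mk0 (y : F) hy0) (Y g) y (hXY g) rfl hy1 (by rw [hY, hg]), eq_comm, QuotientGroup.eq]
    apply close_mem_Pv
    apply ht
    have : ((x⁻¹ * Units.mk0 (y : F) hy0 : Fˣ) : F) - 1 = ((y : F) - x) / x := by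
      have := x.ne_zero
      push_cast
      rw [Units.val_mk0]
      field_simp
    rw [this, map_div₀, hx, div_one]
    exact hy.le
  have hrange : Nat.card ψ.range ≤ p * (Nat.card (𝓞 F ⧸ v.asIdeal)) ^ e := by
    refine le_trans ?_ (card_torsion_le (v := v) hζ he k)
    rw [← Subgroup.index_range, ← Subgroup.index_ker]
    have hle : (powMonoidHom p : G →* G).range ≤ ψ.ker := by
      rintro _ ⟨g, rfl⟩
      rw [MonoidHom.mem_ker, powMonoidHom_apply, map_pow]
      show QuotientGroup.mk (X g) ^ p = 1
      rw [← QuotientGroup.mk_pow, QuotientGroup.eq_one_iff]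
      exact pow_mem_Pv _
    exact Nat.le_of_dvd (Nat.pos_of_ne_zero Subgroup.index_ne_zero_of_finite) (Subgroup.index_dvd_of_le hle)
  obtain ⟨π, hπ⟩ := v.valuation_exists_uniformizer F
  have hπ0 : π ≠ 0 := by
    rintro rfl
    rw [map_zero] at hπ
    exact WithZero.exp_ne_zero hπ.symm
  have hg1 : (QuotientGroup.mk (Units.mk0 π hπ0) : Fˣ ⧸ Pv p v) ^ p ∈ ψ.range := by
    rw [← QuotientGroup.mk_pow, (QuotientGroup.eq_one_iff _).2 (pow_mem_Pv _)]; exact one_mem _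
  have hg2 : ∀ x : Fˣ ⧸ Pv p v, ∃ k : ℤ, x * (QuotientGroup.mk (Units.mk0 π hπ0) : Fˣ ⧸ Pv p v) ^ k ∈ ψ.range := by
    intro x
    obtain ⟨x, rfl⟩ := QuotientGroup.mk_surjective x
    refine ⟨WithZero.log (v.valuation F (x : F)), ?_⟩
    rw [← QuotientGroup.mk_zpow, ← QuotientGroup.mk_mul]
    apply hunit
    have hx0 : v.valuation F (x : F) ≠ 0 := by rw [Valuation.ne_zero_iff]; exact x.ne_zero
    rw [Units.val_mul, Units.val_zpow_eq_zpow_val, map_mul, map_zpow₀, Units.val_mk0, hπ, ← WithZero.exp_zsmul]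
    nth_rewrite 1 [← WithZero.exp_log hx0]
    rw [← WithZero.exp_add]; simp
  have hgen := index_le_of_gen (Q := Fˣ ⧸ Pv p v) (R := ψ.range) hp.out.pos (QuotientGroup.mk (Units.mk0 π hπ0)) hg1 hg2
  have hcard := Subgroup.card_mul_index ψ.range
  have hr0 : Nat.card ψ.range ≠ 0 := by
    haveI : Finite ψ.range := Set.finite_range ψ
    exact Nat.card_pos.ne'
  have : (Pv p v).index = Nat.card ψ.range * ψ.range.index := hcard.symm
  rw [this]
  refine ⟨mul_ne_zero hr0 hgen.1, ?_⟩
  calc _ ≤ (p * (Nat.card (𝓞 F ⧸ v.asIdeal)) ^ e) * p := Nat.mul_le_mul hrange hgen.2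
    _ = _ := by ring
end
end Cft
end

section
open IsDedekindDomain NumberField WithZero Polynomial
namespace Cft
universe u
set_option linter.unusedSectionVars false
set_option linter.all false

section
variable {F : Type*} [Field F] [NumberField F] {K : Type*} [Field K] [NumberField K] [Algebra F K]

variable (F) in
noncomputable abbrev un (w : HeightOneSpectrum (𝓞 K)) : HeightOneSpectrum (𝓞 F) := w.under (𝓞 F)

lemma val_un (w : HeightOneSpectrum (𝓞 K)) : ∃ e : ℕ, e ≠ 0 ∧ ∀ x : F,
    w.valuation K (algebraMap F K x) = (un F w).valuation F x ^ e := by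
  haveI : w.asIdeal.LiesOver (un F w).asIdeal := ⟨rfl⟩
  have h := fun x : F => HeightOneSpectrum.valuation_liesOver K (un F w) w x
  refine ⟨_, ?_, fun x => (h x).symm⟩
  intro h0
  obtain ⟨x, hx⟩ := (un F w).valuation_exists_uniformizer F
  have h1 := h 0
  rw [h0] at h1
  simp at h1

lemma val_un_le (w : HeightOneSpectrum (𝓞 K)) (x y : F) :
    w.valuation K (algebraMap F K x) ≤ w.valuation K (algebraMap F K y) ↔
      (un F w).valuation F x ≤ (un F w).valuation F y := by
  obtain ⟨e, he, h⟩ := val_un (F := F) w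
  rw [h, h]
  exact pow_le_pow_iff_left₀ zero_le zero_le he

lemma val_un_eq_one (w : HeightOneSpectrum (𝓞 K)) (x : F) :
    w.valuation K (algebraMap F K x) = 1 ↔ (un F w).valuation F x = 1 := by
  obtain ⟨e, he, h⟩ := val_un (F := F) w
  rw [h]
  exact ⟨fun h => (pow_eq_one_iff.1 h).resolve_right he, fun h => by rw [h, one_pow]⟩

lemma exists_above (v : HeightOneSpectrum (𝓞 F)) : ∃ w : HeightOneSpectrum (𝓞 K), un F w = v := by
  haveI := v.isMaximal
  obtain ⟨Q, hQ, hl⟩ := Ideal.exists_maximal_ideal_liesOver_of_isIntegral (S := 𝓞 K) v.asIdeal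
  have hb : Q ≠ ⊥ := by
    rintro rfl
    have := hl.over
    rw [Ideal.under_bot] at this
    exact v.ne_bot this
  exact ⟨⟨Q, hQ.isPrime, hb⟩, by ext1; exact hl.over.symm⟩

lemma Pv_map {p : ℕ} [hp : Fact p.Prime] (w : HeightOneSpectrum (𝓞 K)) {x : Fˣ} (hx : x ∈ Pv p (un F w)) :
    Units.map (algebraMap F K).toMonoidHom x ∈ Pv p w := by
  obtain ⟨y, hy⟩ := hx
  obtain ⟨e, he, h⟩ := val_un (F := F) w
  refine ⟨Units.map (algebraMap F K).toMonoidHom y, ?_⟩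
  have h1 : (Units.map (algebraMap F K).toMonoidHom x : K) * (Units.map (algebraMap F K).toMonoidHom y : K) ^ p - 1
     = algebraMap F K (x * y ^ p - 1) := by simp
  have h2 : (p : K) = algebraMap F K p := by simp
  rw [h1, h2, h, h, pow_right_comm]
  exact pow_lt_pow_left₀ hy zero_le he

noncomputable abbrev act (τ : K ≃ₐ[F] K) (w : HeightOneSpectrum (𝓞 K)) : HeightOneSpectrum (𝓞 K) :=
  w.comap (RingOfIntegers.mapRingEquiv τ.toRingEquiv : 𝓞 K →+* 𝓞 K) (RingOfIntegers.mapRingEquiv τ.toRingEquiv).surjective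

lemma act_mem (τ : K ≃ₐ[F] K) (w : HeightOneSpectrum (𝓞 K)) (n : ℕ) (x : 𝓞 K) :
    x ∈ (act τ w).asIdeal ^ n ↔ (RingOfIntegers.mapRingEquiv τ.toRingEquiv x) ∈ w.asIdeal ^ n := by
  have h1 : (act τ w).asIdeal = w.asIdeal.map ((RingOfIntegers.mapRingEquiv τ.toRingEquiv).symm : 𝓞 K →+* 𝓞 K) := by
    exact (Ideal.map_symm (RingOfIntegers.mapRingEquiv τ.toRingEquiv)).symm
  rw [h1, ← Ideal.map_pow]
  erw [Ideal.map_symm]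
  rfl

lemma act_int (τ : K ≃ₐ[F] K) (w : HeightOneSpectrum (𝓞 K)) (x : 𝓞 K) :
    (act τ w).valuation K (x : K) = w.valuation K (τ x) := by
  have hle : ∀ n : ℕ, (act τ w).valuation K (x : K) ≤ exp (-(n : ℤ)) ↔ w.valuation K (τ x) ≤ exp (-(n : ℤ)) := by
    intro n
    rw [val_le_pow_iff, act_mem, ← val_le_pow_iff]
    rfl
  have hex : ∀ (w : HeightOneSpectrum (𝓞 K)) (y : 𝓞 K), (y : K) ≠ 0 → ∃ n : ℕ, w.valuation K (y : K) = exp (-(n : ℤ)) := by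
    intro w y hy
    refine ⟨_, (w.valuation_of_algebraMap (K := K) y).trans (w.intValuation_eq_exp_neg_multiplicity ?_)⟩
    rintro rfl; simp at hy
  by_cases hx : (x : K) = 0
  · simp [hx]
  obtain ⟨n, hn⟩ := hex (act τ w) x hx
  obtain ⟨m, hm⟩ := hex w (RingOfIntegers.mapRingEquiv τ.toRingEquiv x) (by
    show τ x ≠ 0
    simpa using hx)
  have hm' : w.valuation K (τ x) = exp (-(m : ℤ)) := hm
  apply le_antisymm
  · rw [hm', hle, hm']
  · rw [hn, ← hle, hn]

lemma act_val (τ : K ≃ₐ[F] K) (w : HeightOneSpectrum (𝓞 K)) (x : K) :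
    (act τ w).valuation K x = w.valuation K (τ x) := by
  obtain ⟨y, z, hz, rfl⟩ := IsFractionRing.div_surjective (A := 𝓞 K) x
  rw [map_div₀, map_div₀, map_div₀]
  exact congrArg₂ _ (act_int τ w y) (act_int τ w z)

lemma val_inj {w w' : HeightOneSpectrum (𝓞 K)} (h : ∀ x : K, w.valuation K x = w'.valuation K x) : w = w' := by
  ext x
  have h1 := val_le_pow_iff (v := w) x 1
  have h2 := val_le_pow_iff (v := w') x 1
  rw [h, h2, pow_one, pow_one] at h1
  exact h1.symm

lemma un_act (τ : K ≃ₐ[F] K) (w : HeightOneSpectrum (𝓞 K)) : un F (act τ w) = un F w := by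
  ext x
  rw [HeightOneSpectrum.under_asIdeal, HeightOneSpectrum.under_asIdeal, Ideal.mem_comap, Ideal.mem_comap]
  have h1 := act_mem τ w 1 (algebraMap (𝓞 F) (𝓞 K) x)
  rw [pow_one, pow_one] at h1
  rw [h1]
  have : RingOfIntegers.mapRingEquiv τ.toRingEquiv (algebraMap (𝓞 F) (𝓞 K) x) = algebraMap (𝓞 F) (𝓞 K) x := by
    ext
    exact τ.commutes x
  rw [this]

lemma trans_act [IsGalois F K] {w w' : HeightOneSpectrum (𝓞 K)} (h : un F w = un F w') :
    ∃ τ : K ≃ₐ[F] K, act τ w = w' := by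
  haveI : FiniteDimensional F K := Module.Finite.of_restrictScalars_finite ℚ F K
  obtain ⟨τ, hτ⟩ := Ideal.exists_comap_galRestrict_eq (𝓞 F) F K (𝓞 K) (p := (un F w).asIdeal) (P₁ := w.asIdeal) (P₂ := w'.asIdeal)
    ⟨w.isPrime, ⟨rfl⟩⟩ ⟨w'.isPrime, ⟨by rw [h]; rfl⟩⟩
  refine ⟨τ, ?_⟩
  ext x
  rw [← hτ]
  have h1 := act_mem τ w 1 x
  rw [pow_one, pow_one] at h1
  rw [h1, Ideal.mem_comap]
  have : RingOfIntegers.mapRingEquiv τ.toRingEquiv x = galRestrict (𝓞 F) F K (𝓞 K) τ x := by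
    ext
    exact (algebraMap_galRestrict_apply (𝓞 F) τ x).symm
  rw [this]

variable {p : ℕ} [hp : Fact p.Prime] {ζ : F} {σ : K ≃ₐ[F] K} {α : K}

lemma val_p_le_zeta {K : Type*} [Field K] (w : Valuation K ℤᵐ⁰) {ζ : K} (hζ : IsPrimitiveRoot ζ p) {i : ℕ} (hi : ζ ^ i ≠ 1) :
    w (p : K) ≤ w (ζ ^ i - 1) := by
  have hi' : IsPrimitiveRoot (ζ ^ i) p := by
    apply hζ.pow_of_coprime
    rw [Nat.coprime_comm, hp.out.coprime_iff_not_dvd]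
    intro h
    exact hi ((hζ.pow_eq_one_iff_dvd i).2 h)
  -- use rootsep-like: evaluate the product at 1
  have h1 : (∑ j ∈ Finset.range p, (X : K[X]) ^ j).eval 1 = p := by simp [eval_finset_sum]
  have h2 : (p : K) = ∑ j ∈ Finset.range p, (1 - (ζ ^ i) ^ j) := by
    rw [Finset.sum_sub_distrib, hi'.geom_sum_eq_zero hp.out.one_lt]; simp
  rw [h2]
  apply Valuation.map_sum_le
  intro j hj
  have : 1 - (ζ ^ i) ^ j = (ζ ^ i - 1) * (-(∑ k ∈ Finset.range j, (ζ ^ i) ^ k)) := by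
    have := mul_geom_sum (ζ ^ i) j
    linear_combination this
  rw [this, map_mul]
  refine mul_le_of_le_one_right' ?_
  rw [Valuation.map_neg]
  apply Valuation.map_sum_le
  intro k hk
  rw [root_val w hp.out.ne_zero (μ := (ζ ^ i) ^ k) (by rw [← pow_mul, mul_comm, pow_mul, hi'.pow_eq_one, one_pow])]

/-- splitting -/
lemma split_primes {a : Fˣ} (h : Kum p ζ (a : F) α σ) {v : HeightOneSpectrum (𝓞 F)} (ha : a ∈ Pv p v) :
    ∃ f : Fin p → HeightOneSpectrum (𝓞 K), Function.Injective f ∧ ∀ i, un F (f i) = v := by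
  obtain ⟨y, hy⟩ := ha
  obtain ⟨w, hw⟩ := exists_above (K := K) v
  refine ⟨fun i => act (σ ^ (i : ℕ)) w, ?_, fun i => by rw [un_act, hw]⟩
  have hζK : IsPrimitiveRoot (algebraMap F K ζ) p := h.hζ.map_of_injective (algebraMap F K).injective
  set z := algebraMap F K ζ with hz
  set x : K := α * algebraMap F K y with hx
  have hxp : x ^ p - 1 = algebraMap F K (a * y ^ p - 1) := by
    rw [hx, mul_pow, h.hα]; simp
  obtain ⟨e, he, hval⟩ := val_un (F := F) w
  have hlt : w.valuation K (x ^ p - 1) < w.valuation K (p : K) ^ p := by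
    have h2 : (p : K) = algebraMap F K p := by simp
    rw [hxp, h2, hval, hval, pow_right_comm, hw]
    exact pow_lt_pow_left₀ hy zero_le he
  obtain ⟨μ, hμ, hle⟩ := rootsep (w.valuation K) hζK x
  have hwp : w.valuation K (p : K) ≤ 1 := by simpa using val_nat_le w p
  have hwp0 : w.valuation K (p : K) ≠ 0 := val_p_ne p w
  have hlt2 : w.valuation K (x - μ) < w.valuation K (p : K) := by
    have h3 : w.valuation K (x - μ) * w.valuation K (p : K) < w.valuation K (p : K) ^ 2 := by
      refine (hle.trans_lt hlt).trans_le ?_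
      exact pow_le_pow_right_of_le_one' hwp hp.out.two_le
    rw [sq] at h3
    exact lt_of_mul_lt_mul_right h3 zero_le
  have hsx : ∀ i : ℕ, (σ ^ i) x = z ^ i * x := by
    intro i
    rw [hx, map_mul, h.σpow_α, AlgEquiv.commutes, map_pow]; ring
  obtain ⟨m, hm, rfl⟩ := hζK.eq_pow_of_pow_eq_one hμ
  have hsz : ∀ i k : ℕ, (σ ^ i) (z ^ k) = z ^ k := by
    intro i k
    rw [hz, ← map_pow, AlgEquiv.commutes]
  have hz0 : z ≠ 0 := by rw [hz]; simpa using h.hζ.ne_zero hp.out.ne_zero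
  have hzv : ∀ k : ℕ, w.valuation K (z ^ k) = 1 := fun k =>
    root_val _ hp.out.ne_zero (by rw [← pow_mul, mul_comm, pow_mul, hζK.pow_eq_one, one_pow])
  have hnear : ∀ i : ℕ, (act (σ ^ i) w).valuation K (x - z ^ (i + m)) < w.valuation K (p : K) := by
    intro i
    rw [act_val, map_sub, hsx, hsz, pow_add, ← mul_sub, map_mul, hzv, one_mul]
    exact hlt2
  have key : ∀ i j : ℕ, i < j → j < p → act (σ ^ i) w ≠ act (σ ^ j) w := by
    intro i j hij hj heq
    have h1 := hnear i
    have h2 := hnear j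
    rw [← heq] at h2
    have h3 := (act (σ ^ i) w).valuation K |>.map_sub_lt h1 h2
    have h4 : x - z ^ (i + m) - (x - z ^ (j + m)) = z ^ (i + m) * (z ^ (j - i) - 1) := by
      obtain ⟨d, rfl⟩ := Nat.exists_eq_add_of_lt hij
      rw [show i + d + 1 - i = d + 1 by omega]; ring
    rw [h4, map_mul, act_val, act_val, hsz, hzv, one_mul, map_sub, hsz, map_one] at h3
    refine absurd h3 (not_lt.2 (val_p_le_zeta _ hζK ?_))
    exact hζK.pow_ne_one_of_pos_of_lt (by omega) (by omega)
  intro i j hij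
  rcases lt_trichotomy (i : ℕ) j with hlt | heq | hgt
  · exact absurd hij (key _ _ hlt j.2)
  · exact Fin.ext heq
  · exact absurd hij.symm (key _ _ hgt i.2)

lemma tame_invariant {a : F} (h : Kum p ζ a α σ) {v : HeightOneSpectrum (𝓞 F)} (hp1 : v.valuation F (p : F) = 1)
    {y : F} (hy : v.valuation F a = v.valuation F y ^ p) {x : K} (hx0 : x ≠ 0)
    (hx : ∀ w : HeightOneSpectrum (𝓞 K), un F w = v → w.valuation K (σ x) = w.valuation K x) :
    ∃ c : F, c ≠ 0 ∧ ∀ w : HeightOneSpectrum (𝓞 K), un F w = v → w.valuation K x = w.valuation K (algebraMap F K c) := by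
  have hζK : IsPrimitiveRoot (algebraMap F K ζ) p := h.hζ.map_of_injective (algebraMap F K).injective
  set z := algebraMap F K ζ with hz
  have hz0 : z ≠ 0 := hζK.ne_zero hp.out.ne_zero
  have hsz : ∀ k : ℕ, σ (z⁻¹ ^ k) = z⁻¹ ^ k := by
    intro k
    rw [hz, ← map_inv₀, ← map_pow, AlgEquiv.commutes]
  have hσp : σ ^ p = 1 := by rw [← h.order]; exact pow_orderOf_eq_one σ
  let e : ℕ → K := fun k => ∑ j ∈ Finset.range p, z⁻¹ ^ (j * k) * (σ ^ j) x
  have hsum : ∑ k ∈ Finset.range p, e k = p * x := by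
    simp only [e]
    rw [Finset.sum_comm]
    simp only [← Finset.sum_mul]
    rw [Finset.sum_eq_single 0]
    · simp
    · intro j hj hj0
      have hj' := Finset.mem_range.1 hj
      have hpr : IsPrimitiveRoot (z⁻¹ ^ j) p := by
        apply hζK.inv.pow_of_coprime
        rw [Nat.coprime_comm]
        exact (Nat.coprime_of_lt_prime (by omega) hj' hp.out)
      have := hpr.geom_sum_eq_zero hp.out.one_lt
      simp only [pow_mul]
      rw [this, zero_mul]
    · intro hn; exact absurd (Finset.mem_range.2 hp.out.pos) hn
  have hσe : ∀ k, σ (e k) = z ^ k * e k := by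
    intro k
    let f : ℕ → K := fun j => z⁻¹ ^ (j * k) * (σ ^ j) x
    have h0 : f p = f 0 := by
      simp only [f]
      rw [hσp, pow_mul, hζK.inv.pow_eq_one]; simp
    have h1 : ∑ j ∈ Finset.range p, f (j + 1) = ∑ j ∈ Finset.range p, f j := by
      have e1 := Finset.sum_range_succ f p
      have e2 := Finset.sum_range_succ' f p
      rw [e2, h0] at e1
      exact add_right_cancel e1
    show σ (∑ j ∈ Finset.range p, f j) = z ^ k * ∑ j ∈ Finset.range p, f j
    conv_rhs => rw [← h1]
    rw [map_sum, Finset.mul_sum]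
    · refine Finset.sum_congr rfl fun j _ => ?_
      simp only [f]
      rw [map_mul, hsz, pow_succ' σ, AlgEquiv.mul_apply, ← mul_assoc, add_mul, one_mul, pow_add, mul_comm (z ^ k), mul_assoc (z⁻¹ ^ (j * k)),
        ← mul_pow, inv_mul_cancel₀ hz0, one_pow, mul_one]
  have hα0 := h.α_ne
  have hc : ∀ k, ∃ c : F, e k = algebraMap F K c * α ^ k := by
    intro k
    have : σ (e k / α ^ k) = e k / α ^ k := by
      rw [map_div₀, map_pow, h.hσ, hσe, mul_pow, ← hz]
      field_simp
    obtain ⟨c, hc⟩ := h.fixed this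
    exact ⟨c, by rw [hc]; field_simp⟩
  choose c hc using hc
  have hσw : ∀ w : HeightOneSpectrum (𝓞 K), un F w = v → ∀ j, w.valuation K ((σ ^ j) x) = w.valuation K x := by
    intro w hw j
    induction j with
    | zero => simp
    | succ j ih =>
      rw [pow_succ, AlgEquiv.mul_apply, ← act_val (σ ^ j) w, hx _ ((un_act _ _).trans hw), act_val, ih]
  have hval : ∀ w : HeightOneSpectrum (𝓞 K), un F w = v → ∀ k, w.valuation K (e k) = w.valuation K (algebraMap F K (c k * y ^ k)) := by
    intro w hw k
    rw [hc, map_mul, map_mul, map_mul, map_pow, map_pow, map_pow]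
    congr 2
    obtain ⟨e, he, hval⟩ := val_un (F := F) w
    have h1 : w.valuation K α ^ p = w.valuation K (algebraMap F K y) ^ p := by
      rw [← map_pow, h.hα, hval, hval, hw, hy, ← pow_mul, ← pow_mul, mul_comm]
    exact (pow_left_inj₀ zero_le zero_le hp.out.ne_zero).1 h1
  have hle : ∀ w : HeightOneSpectrum (𝓞 K), un F w = v → ∀ k, w.valuation K (e k) ≤ w.valuation K x := by
    intro w hw k
    apply Valuation.map_sum_le
    intro j _
    rw [map_mul, hσw w hw, root_val _ hp.out.ne_zero (μ := z⁻¹ ^ (j * k)), one_mul]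
    rw [← pow_mul, mul_comm, pow_mul, hζK.inv.pow_eq_one, one_pow]
  obtain ⟨k, hk, hmax⟩ := Finset.exists_max_image (Finset.range p) (fun k => v.valuation F (c k * y ^ k)) ⟨0, Finset.mem_range.2 hp.out.pos⟩
  have hfin : ∀ w : HeightOneSpectrum (𝓞 K), un F w = v → w.valuation K x = w.valuation K (algebraMap F K (c k * y ^ k)) := by
    intro w hw
    apply le_antisymm
    · have h1 : w.valuation K (p * x) ≤ w.valuation K (algebraMap F K (c k * y ^ k)) := by
        rw [← hsum]
        apply Valuation.map_sum_le
        intro j hj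
        rw [hval w hw, val_un_le, hw]
        exact hmax j hj
      have h2 : w.valuation K (p : K) = 1 := by
        have := (val_un_eq_one w (p : F)).2 (by rw [hw]; exact hp1)
        simpa using this
      rwa [map_mul, h2, one_mul] at h1
    · rw [← hval w hw]; exact hle w hw k
  refine ⟨c k * y ^ k, ?_, hfin⟩
  intro h0
  obtain ⟨w, hw⟩ := exists_above (K := K) v
  have := hfin w hw
  rw [h0, map_zero, map_zero, Valuation.zero_iff] at this
  exact hx0 this
end
end Cft
end

section
open IsDedekindDomain NumberField WithZero Polynomial
namespace Cft
universe u
set_option linter.unusedSectionVars false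
set_option linter.all false

section
variable {F : Type*} [Field F] [NumberField F]

instance finite_real : Finite (F →+* ℝ) := inferInstance

lemma wa_nat (S : Finset (HeightOneSpectrum (𝓞 F))) (n : ℕ) :
    ∃ k : ℕ, 0 < k ∧ ∀ v ∈ S, v.valuation F (k : F) ≤ exp (-(n : ℤ)) := by
  classical
  refine ⟨(∏ v ∈ S, Ideal.absNorm v.asIdeal) ^ n, ?_, ?_⟩
  · apply pow_pos
    apply Finset.prod_pos
    intro v _
    apply Nat.pos_of_ne_zero
    rw [Ne, Ideal.absNorm_eq_zero_iff]
    exact v.ne_bot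
  · intro v hv
    have h1 : (((∏ v ∈ S, Ideal.absNorm v.asIdeal : ℕ) : 𝓞 F) ^ n) ∈ v.asIdeal ^ n := by
      apply Ideal.pow_mem_pow
      rw [← Finset.mul_prod_erase _ _ hv]
      push_cast
      exact Ideal.mul_mem_right _ _ (Ideal.absNorm_mem v.asIdeal)
    rw [← val_le_pow_iff] at h1
    simpa using h1

lemma wa (S : Finset (HeightOneSpectrum (𝓞 F))) (t : HeightOneSpectrum (𝓞 F) → F) (n : ℕ) :
    ∃ x : F, ∀ v ∈ S, v.valuation F (x - t v) ≤ exp (-(n : ℤ)) := by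
  classical
  obtain ⟨d, hd⟩ := IsLocalization.exist_integer_multiples (nonZeroDivisors (𝓞 F)) S t
  have hd0 : ((d : 𝓞 F) : F) ≠ 0 := by
    have := nonZeroDivisors.ne_zero d.2
    simpa using this
  have hex : ∃ N : ℕ, ∀ v ∈ S, exp (-(N : ℤ)) ≤ exp (-(n : ℤ)) * v.valuation F ((d : 𝓞 F) : F) := by
    choose! m hm using fun v : HeightOneSpectrum (𝓞 F) => 
      (show ∃ m : ℕ, v.valuation F ((d : 𝓞 F) : F) = exp (-(m : ℤ)) from
      ⟨_, (v.valuation_of_algebraMap (K := F) (d : 𝓞 F)).trans (v.intValuation_eq_exp_neg_multiplicity (nonZeroDivisors.ne_zero d.2))⟩)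
    refine ⟨n + ∑ v ∈ S, m v, fun v hv => ?_⟩
    rw [hm, ← WithZero.exp_add, WithZero.exp_le_exp]
    have : m v ≤ ∑ v ∈ S, m v := Finset.single_le_sum (fun _ _ => Nat.zero_le _) hv
    push_cast
    have h2 : (m v : ℤ) ≤ ∑ v ∈ S, (m v : ℤ) := by exact_mod_cast this
    linarith
  obtain ⟨N, hN⟩ := hex
  choose! y hy using hd
  obtain ⟨z, hz⟩ := IsDedekindDomain.exists_forall_sub_mem_ideal (s := S) (fun v => v.asIdeal) (fun _ => N) 
    (fun v _ => v.prime) (fun v _ v' _ hne h => hne (HeightOneSpectrum.ext h)) (fun v => y v)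
  refine ⟨(z : F) / ((d : 𝓞 F) : F), fun v hv => ?_⟩
  have h1 := hz v hv
  rw [← val_le_pow_iff] at h1
  have h2 : (z : F) / ((d : 𝓞 F) : F) - t v = ((z - y v : 𝓞 F) : F) / ((d : 𝓞 F) : F) := by
    have h3 : ((y v : 𝓞 F) : F) = ((d : 𝓞 F) : F) * t v := by
      rw [show ((y v : 𝓞 F) : F) = _ from hy v hv, Algebra.smul_def]
    have h4 : ((z - y v : 𝓞 F) : F) = (z : F) - ((y v : 𝓞 F) : F) := map_sub (algebraMap (𝓞 F) F) _ _
    rw [h4, h3]; field_simp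
  rw [h2, map_div₀]
  rw [div_le_iff₀ (by rw [zero_lt_iff, Valuation.ne_zero_iff]; exact hd0)]
  exact h1.trans (hN v hv)

lemma wa_sign (S : Finset (HeightOneSpectrum (𝓞 F))) (t : HeightOneSpectrum (𝓞 F) → F) (n : ℕ) (ε : ℤ) (hε : ε = 1 ∨ ε = -1) :
    ∃ x : Fˣ, (∀ v ∈ S, v.valuation F (x - t v) ≤ exp (-(n : ℤ))) ∧ ∀ φ : F →+* ℝ, 0 < ε * φ x := by
  classical
  obtain ⟨x, hx⟩ := wa S t n
  obtain ⟨k, hk, hkv⟩ := wa_nat S n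
  haveI := Fintype.ofFinite (F →+* ℝ)
  obtain ⟨m, hm⟩ : ∃ m : ℕ, ∀ φ : F →+* ℝ, |φ x| < m := by
    obtain ⟨m, hm⟩ := exists_nat_gt (∑ φ : F →+* ℝ, |φ x|)
    exact ⟨m, fun φ => (Finset.single_le_sum (f := fun φ : F →+* ℝ => |φ x|) (fun _ _ => abs_nonneg _) (Finset.mem_univ φ)).trans_lt hm⟩
  have hε2 : (ε : ℝ) * ε = 1 := by rcases hε with rfl | rfl <;> norm_num
  have hεa : |(ε : ℝ)| = 1 := by rcases hε with rfl | rfl <;> norm_num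
  have key : ∀ m' : ℕ, m ≤ m' → (x + ε * k * m' ≠ 0) → ∃ x : Fˣ, (∀ v ∈ S, v.valuation F (x - t v) ≤ exp (-(n : ℤ))) ∧ ∀ φ : F →+* ℝ, 0 < ε * φ x := by
    intro m' hm' h0
    refine ⟨Units.mk0 _ h0, ?_, ?_⟩
    · intro v hv
      rw [Units.val_mk0, show x + ε * k * m' - t v = (x - t v) + (k * ((ε * m' : ℤ) : F)) by push_cast; ring]
      refine Valuation.map_add_le _ (hx v hv) ?_
      rw [map_mul]
      exact (mul_le_of_le_one_right' (val_int_le v _)).trans (hkv v hv)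
    · intro φ
      rw [Units.val_mk0]
      have h1 : (ε : ℝ) * φ (x + ε * k * m') = ε * φ x + k * m' := by
        simp only [map_add, map_mul, map_intCast, map_natCast]
        linear_combination (k * m' : ℝ) * hε2
      rw [h1]
      have h2 : |(ε : ℝ) * φ x| < m := by rw [abs_mul, hεa, one_mul]; exact hm φ
      have h3 := neg_abs_le ((ε : ℝ) * φ x)
      have h4 : (1 : ℝ) ≤ k := by exact_mod_cast hk
      have h5 : (m : ℝ) ≤ m' := by exact_mod_cast hm'
      have h6 : (m' : ℝ) ≤ k * m' := by nlinarith [(Nat.cast_nonneg m' : (0:ℝ) ≤ m')]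
      linarith
  by_cases h0 : x + ε * k * m = 0
  · refine key (m + 1) (by omega) ?_
    push_cast
    intro h1
    have : (ε * k : F) = 0 := by linear_combination h1 - h0
    rcases hε with rfl | rfl <;> simp at this <;> omega
  · exact key m le_rfl h0

/-- multiplicative form -/
lemma wa_mul {p : ℕ} [hp : Fact p.Prime] (S : Finset (HeightOneSpectrum (𝓞 F))) (t : HeightOneSpectrum (𝓞 F) → Fˣ) (ε : ℤ) (hε : ε = 1 ∨ ε = -1) :
    ∃ x : Fˣ, (∀ v ∈ S, x * (t v)⁻¹ ∈ Pv p v ∧ v.valuation F (x : F) = v.valuation F (t v : F)) ∧ ∀ φ : F →+* ℝ, 0 < ε * φ x := by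
  classical
  have hex : ∀ v : HeightOneSpectrum (𝓞 F), ∃ N : ℕ, exp (-(N : ℤ)) < v.valuation F (t v : F) * (v.valuation F (p : F)) ^ p := by
    intro v
    apply WithZero.exists_exp_neg_natCast_lt
    exact mul_ne_zero (by rw [Valuation.ne_zero_iff]; exact (t v).ne_zero) (pow_ne_zero _ (val_p_ne p v))
  choose N hN using hex
  obtain ⟨x, hx, hφ⟩ := wa_sign S (fun v => (t v : F)) (∑ v ∈ S, N v) ε hε
  refine ⟨x, fun v hv => ?_, hφ⟩
  have h1 : v.valuation F ((x : F) - t v) < v.valuation F (t v : F) * (v.valuation F (p : F)) ^ p := by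
    refine (hx v hv).trans_lt (lt_of_le_of_lt ?_ (hN v))
    rw [WithZero.exp_le_exp]
    have : N v ≤ ∑ v ∈ S, N v := Finset.single_le_sum (fun _ _ => Nat.zero_le _) hv
    omega
  have ht0 : v.valuation F (t v : F) ≠ 0 := by rw [Valuation.ne_zero_iff]; exact (t v).ne_zero
  have h2 : v.valuation F (((x * (t v)⁻¹ : Fˣ) : F) - 1) < (v.valuation F (p : F)) ^ p := by
    have : ((x * (t v)⁻¹ : Fˣ) : F) - 1 = ((x : F) - t v) / t v := by
      have := (t v).ne_zero
      push_cast; field_simp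
    rw [this, map_div₀, div_lt_iff₀ (zero_lt_iff.2 ht0), mul_comm]
    exact h1
  refine ⟨close_mem_Pv h2, ?_⟩
  have h3 := val_eq_one (h2.trans_le (pow_le_one' (by simpa using val_nat_le v p) _))
  rw [Units.val_mul, map_mul, Units.val_inv_eq_inv_val, map_inv₀] at h3
  field_simp at h3
  exact h3
end
end Cft
end

section
open IsDedekindDomain NumberField WithZero Polynomial
namespace Cft
universe u
set_option linter.unusedSectionVars false
set_option linter.all false

lemma finrank_finite (T : Type*) [AddCommGroup T] [Finite T] : Module.finrank ℤ T = 0 := by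
  rw [Module.finrank_eq_zero_iff_isTorsion]
  intro x
  refine ⟨⟨(Nat.card T : ℤ), ?_⟩, ?_⟩
  · rw [mem_nonZeroDivisors_iff_ne_zero]
    exact_mod_cast Nat.card_pos.ne'
  · show (Nat.card T : ℤ) • x = 0
    rw [natCast_zsmul]
    exact card_nsmul_eq_zero'

lemma index_free (n p : ℕ) (hp : 0 < p) : (nsmulAddMonoidHom p : (Fin n → ℤ) →+ _).range.index = p ^ n := by
  haveI : NeZero p := ⟨hp.ne'⟩
  let f : (Fin n → ℤ) →+ (Fin n → ZMod p) := 
    { toFun := fun x i => (x i : ZMod p), map_zero' := by ext; simp, map_add' := by intros; ext; simp }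
  have h1 : (nsmulAddMonoidHom p : (Fin n → ℤ) →+ _).range = f.ker := by
    ext x
    constructor
    · rintro ⟨y, rfl⟩
      rw [AddMonoidHom.mem_ker]
      ext i
      simp [f]
    · intro hx
      rw [AddMonoidHom.mem_ker] at hx
      have : ∀ i, ∃ y, x i = p * y := by
        intro i
        have h2 := congrFun hx i
        exact (ZMod.intCast_zmod_eq_zero_iff_dvd _ _).1 h2
      choose y hy using this
      exact ⟨y, by ext i; simp [hy]⟩
  have h2 : f.range = ⊤ := by
    rw [AddMonoidHom.range_eq_top]
    intro y
    refine ⟨fun i => ((y i).val : ℤ), ?_⟩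
    ext i; simp [f]
  rw [h1, AddSubgroup.index_ker, h2, AddSubgroup.card_top]
  simp

lemma index_fin (T : Type*) [AddCommGroup T] [Finite T] (p : ℕ) : 
    (nsmulAddMonoidHom p : T →+ _).range.index = Nat.card (nsmulAddMonoidHom p : T →+ _).ker := by
  have h1 := AddSubgroup.card_mul_index (nsmulAddMonoidHom p : T →+ _).ker
  have h2 := AddSubgroup.card_mul_index (nsmulAddMonoidHom p : T →+ _).range
  rw [AddSubgroup.index_ker] at h1
  have h3 : 0 < Nat.card (nsmulAddMonoidHom p : T →+ _).range := Nat.card_pos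
  apply Nat.eq_of_mul_eq_mul_left h3
  rw [h2, ← h1, mul_comm]

lemma index_addfg (M : Type*) [AddCommGroup M] [Module.Finite ℤ M] (p : ℕ) (hp : 0 < p) :
    (nsmulAddMonoidHom p : M →+ _).range.index = p ^ (Module.finrank ℤ M) * Nat.card (nsmulAddMonoidHom p : M →+ _).ker := by
  classical
  haveI : AddGroup.FG M := by
    exact Module.Finite.iff_addGroup_fg.1 inferInstance
  obtain ⟨n, ι, _, q, hq, e, ⟨E⟩⟩ := AddCommGroup.equiv_free_prod_directSum_zmod M
  haveI : ∀ i, NeZero (q i ^ e i) := fun i => ⟨pow_ne_zero _ (hq i).ne_zero⟩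
  let T := DirectSum ι fun i => ZMod (q i ^ e i)
  haveI : Finite T := Finite.of_equiv _ (DirectSum.addEquivProd fun i => ZMod (q i ^ e i)).symm.toEquiv
  let E' : M ≃+ (Fin n → ℤ) × T := E.trans (AddEquiv.prodCongr (Finsupp.linearEquivFunOnFinite ℤ ℤ (Fin n)).toAddEquiv (AddEquiv.refl T))
  have hrank : Module.finrank ℤ M = n := by
    rw [LinearEquiv.finrank_eq E'.toIntLinearEquiv]
    have h1 := Submodule.finrank_quotient_add_finrank (LinearMap.ker (LinearMap.fst ℤ (Fin n → ℤ) T))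
    rw [← h1, LinearEquiv.finrank_eq (LinearMap.quotKerEquivOfSurjective (LinearMap.fst ℤ (Fin n → ℤ) T) LinearMap.fst_surjective)]
    have h2 : Finite (LinearMap.ker (LinearMap.fst ℤ (Fin n → ℤ) T)) := by
      apply Finite.of_injective (fun x : LinearMap.ker (LinearMap.fst ℤ (Fin n → ℤ) T) => (x : (Fin n → ℤ) × T).2)
      rintro ⟨⟨x, y⟩, h⟩ ⟨⟨x', y'⟩, h'⟩ hh
      simp at h h' hh
      simp [h, h', hh]
    rw [finrank_finite (LinearMap.ker (LinearMap.fst ℤ (Fin n → ℤ) T))]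
    simp
  have hrange : (nsmulAddMonoidHom p : M →+ _).range = ((nsmulAddMonoidHom p : (Fin n → ℤ) →+ _).range.prod (nsmulAddMonoidHom p : T →+ _).range).comap E'.toAddMonoidHom := by
    ext x
    constructor
    · rintro ⟨y, rfl⟩
      refine ⟨⟨(E' y).1, ?_⟩, ⟨(E' y).2, ?_⟩⟩ <;> simp
    · rintro ⟨⟨y, hy⟩, ⟨z, hz⟩⟩
      refine ⟨E'.symm (y, z), ?_⟩
      apply E'.injective
      simp at hy hz ⊢
      ext1
      · exact hy
      · exact hz
  have hker : Nat.card (nsmulAddMonoidHom p : M →+ _).ker = Nat.card (nsmulAddMonoidHom p : T →+ _).ker := by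
    refine Nat.card_congr ⟨fun x => ⟨(E' x).2, ?_⟩, fun y => ⟨E'.symm (0, y), ?_⟩, ?_, ?_⟩
    · have := congrArg (fun t => (E' t).2) x.2
      simpa using this
    · have := y.2
      rw [AddMonoidHom.mem_ker] at *
      apply E'.injective
      ext1
      · simp
      · simpa using this
    · rintro ⟨x, hx⟩
      apply Subtype.ext
      apply E'.injective
      rw [AddMonoidHom.mem_ker] at hx
      have h1 := congrArg (fun t => (E' t).1) hx
      have h1 : p • (E' x).1 = 0 := by simpa using h1
      have h1 : (E' x).1 = 0 := (_root_.smul_eq_zero.1 h1).resolve_left hp.ne'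
      simp only [AddEquiv.apply_symm_apply]
      ext1
      · exact h1.symm
      · rfl
    · intro y; simp
  rw [hrange, AddSubgroup.index_comap_of_surjective _ E'.surjective, AddSubgroup.index_prod, index_free _ _ hp, index_fin, hrank, hker]

lemma index_pow (G : Type*) [CommGroup G] [Module.Finite ℤ (Additive G)] (p : ℕ) (hp : 0 < p) :
    (powMonoidHom p : G →* _).range.index = p ^ (Module.finrank ℤ (Additive G)) * Nat.card (powMonoidHom p : G →* _).ker := by
  exact index_addfg (Additive G) p hp
end Cft
end

section
open IsDedekindDomain NumberField WithZero Polynomial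
namespace Cft
universe u
set_option linter.unusedSectionVars false
set_option linter.all false

section
variable {F : Type*} [Field F] [NumberField F]

lemma val_unit_ne (v : HeightOneSpectrum (𝓞 F)) (x : Fˣ) : v.valuation F (x : F) ≠ 0 := by
  rw [Valuation.ne_zero_iff]; exact x.ne_zero

def US (S : Set (HeightOneSpectrum (𝓞 F))) : Subgroup Fˣ where
  carrier := {x | ∀ v ∉ S, v.valuation F (x : F) = 1}
  one_mem' := by intro v _; simp
  mul_mem' := by
    intro x y hx hy v hv
    rw [Units.val_mul, map_mul, hx v hv, hy v hv, one_mul]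
  inv_mem' := by
    intro x hx v hv
    rw [Units.val_inv_eq_inv_val, map_inv₀, hx v hv, inv_one]

lemma mem_US {S : Set (HeightOneSpectrum (𝓞 F))} {x : Fˣ} : x ∈ US S ↔ ∀ v ∉ S, v.valuation F (x : F) = 1 := Iff.rfl

lemma US_mono {S T : Set (HeightOneSpectrum (𝓞 F))} (h : S ⊆ T) : US S ≤ US T := 
  fun x hx v hv => hx v (fun h' => hv (h h'))

noncomputable def ord (S : Set (HeightOneSpectrum (𝓞 F))) : Additive (US S) →+ (S → ℤ) where
  toFun x v := WithZero.log (v.1.valuation F ((x.toMul : Fˣ) : F))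
  map_zero' := by ext; simp
  map_add' x y := by
    ext v
    simp only [toMul_add, Subgroup.coe_mul, Units.val_mul, map_mul, Pi.add_apply]
    exact WithZero.log_mul (val_unit_ne _ _) (val_unit_ne _ _)

lemma val_of_ord {S : Set (HeightOneSpectrum (𝓞 F))} {x : US S} (h : ord S (Additive.ofMul x) = 0) (v : HeightOneSpectrum (𝓞 F)) :
    v.valuation F ((x : Fˣ) : F) = 1 := by
  by_cases hv : v ∈ S
  · have h1 := congrFun h ⟨v, hv⟩
    have h2 : WithZero.log (v.valuation F ((x : Fˣ) : F)) = 0 := h1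
    rw [← WithZero.exp_log (val_unit_ne v (x : Fˣ)), h2, WithZero.exp_zero]
  · exact x.2 v hv

lemma exists_unit_of_val {x : Fˣ} (h : ∀ v : HeightOneSpectrum (𝓞 F), v.valuation F (x : F) = 1) : 
    ∃ u : (𝓞 F)ˣ, ((u : 𝓞 F) : F) = x := by
  obtain ⟨y, hy⟩ := HeightOneSpectrum.mem_integers_of_valuation_le_one F (x : F) (fun v => (h v).le)
  obtain ⟨z, hz⟩ := HeightOneSpectrum.mem_integers_of_valuation_le_one F ((x⁻¹ : Fˣ) : F) (fun v => by
    rw [Units.val_inv_eq_inv_val, map_inv₀, h v, inv_one])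
  have h1 : y * z = 1 := by
    apply RingOfIntegers.coe_injective
    rw [map_mul]
    show algebraMap (𝓞 F) F y * algebraMap (𝓞 F) F z = _
    rw [hy, hz]; simp
  exact ⟨⟨y, z, h1, by rw [mul_comm]; exact h1⟩, hy⟩

lemma unit_val (u : (𝓞 F)ˣ) (v : HeightOneSpectrum (𝓞 F)) : v.valuation F ((u : 𝓞 F) : F) = 1 := by
  have := (v.valuation_eq_one_iff_notMem (K := F) (r := (u : 𝓞 F))).2 (fun h => v.isPrime.ne_top (Ideal.eq_top_of_isUnit_mem _ h u.isUnit))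
  exact this

noncomputable def unitsUS (S : Set (HeightOneSpectrum (𝓞 F))) : (𝓞 F)ˣ →* US S where
  toFun u := ⟨Units.map (algebraMap (𝓞 F) F).toMonoidHom u, fun v _ => unit_val u v⟩
  map_one' := by ext; simp
  map_mul' x y := by ext; simp

lemma unitsUS_inj (S : Set (HeightOneSpectrum (𝓞 F))) : Function.Injective (unitsUS S) := by
  intro x y h
  ext
  have := congrArg (fun t : US S => ((t : Fˣ) : F)) h
  exact this

lemma ker_ord (S : Set (HeightOneSpectrum (𝓞 F))) : LinearMap.ker (ord S).toIntLinearMap = LinearMap.range (unitsUS S).toAdditive.toIntLinearMap := by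
  ext x
  constructor
  · intro hx
    have h1 : ord S (Additive.ofMul x.toMul) = 0 := hx
    obtain ⟨u, hu⟩ := exists_unit_of_val (val_of_ord h1)
    refine ⟨Additive.ofMul u, ?_⟩
    apply Additive.toMul.injective
    ext
    exact hu
  · rintro ⟨u, rfl⟩
    show ord S (Additive.ofMul (unitsUS S u.toMul)) = 0
    ext v
    show WithZero.log (v.1.valuation F (((u.toMul : (𝓞 F)ˣ) : 𝓞 F) : F)) = 0
    rw [unit_val]; simp

lemma exists_gen (v : HeightOneSpectrum (𝓞 F)) : ∃ x : Fˣ, v.valuation F (x : F) = exp (-(Nat.card (ClassGroup (𝓞 F)) : ℤ)) ∧ 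
    ∀ v' ≠ v, v'.valuation F (x : F) = 1 := by
  classical
  set h := Nat.card (ClassGroup (𝓞 F)) with hh
  have h1 : (ClassGroup.mk0 ⟨v.asIdeal, mem_nonZeroDivisors_of_ne_zero v.ne_bot⟩) ^ h = 1 := pow_card_eq_one'
  rw [← map_pow] at h1
  have h2 := (ClassGroup.mk0_eq_one_iff (I := v.asIdeal ^ h) (mem_nonZeroDivisors_of_ne_zero (pow_ne_zero _ v.ne_bot))).1 h1
  obtain ⟨x, hx⟩ := h2
  have hx' : v.asIdeal ^ h = Ideal.span {x} := hx
  have hx0 : x ≠ 0 := by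
    rintro rfl
    rw [Set.singleton_zero, Ideal.span_zero] at hx'
    exact pow_ne_zero _ v.ne_bot hx'
  have hx0' : (x : F) ≠ 0 := by simpa using hx0
  refine ⟨Units.mk0 (x : F) hx0', ?_, ?_⟩
  · have e1 : v.valuation F (x : F) = v.intValuation x := v.valuation_of_algebraMap (K := F) x
    rw [Units.val_mk0, e1, v.intValuation_eq_exp_neg_multiplicity hx0, ← hx', multiplicity_pow_self v.ne_bot]
    intro hu
    exact v.isPrime.ne_top (Ideal.isUnit_iff.1 hu)
  · intro v' hv'
    rw [Units.val_mk0]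
    refine (v'.valuation_eq_one_iff_notMem (K := F)).2 ?_
    intro hm
    have h3 : v.asIdeal ^ h ≤ v'.asIdeal := by rw [hx', Ideal.span_singleton_le_iff_mem]; exact hm
    have h4 := v'.isPrime.le_of_pow_le h3
    exact hv' (HeightOneSpectrum.ext (v.isMaximal.eq_of_le v'.isPrime.ne_top h4).symm)

variable {S : Set (HeightOneSpectrum (𝓞 F))}

lemma US_fg (hS : S.Finite) : Module.Finite ℤ (Additive (US S)) := by
  haveI := hS.to_subtype
  rw [Module.finite_def]
  apply Submodule.fg_of_fg_map_of_fg_inf_ker (ord S).toIntLinearMap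
  · exact IsNoetherian.noetherian _
  · rw [top_inf_eq, ker_ord, LinearMap.range_eq_map]
    exact Submodule.FG.map _ (Module.finite_def.1 inferInstance)

lemma US_rank (hS : S.Finite) : Module.finrank ℤ (Additive (US S)) + 1 = S.ncard + Fintype.card (InfinitePlace F) := by
  classical
  haveI := hS.to_subtype
  haveI := Fintype.ofFinite S
  haveI := US_fg hS
  have h1 := Submodule.finrank_quotient_add_finrank (LinearMap.ker (ord S).toIntLinearMap)
  rw [LinearEquiv.finrank_eq (LinearMap.quotKerEquivRange _)] at h1
  have h2 : Module.finrank ℤ (LinearMap.ker (ord S).toIntLinearMap) = Fintype.card (InfinitePlace F) - 1 := by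
    rw [ker_ord, LinearMap.finrank_range_of_inj, NumberField.Units.finrank_eq]
    · rfl
    · intro x y h
      exact unitsUS_inj S h
  have h3 : Module.finrank ℤ (LinearMap.range (ord S).toIntLinearMap) = S.ncard := by
    have hn : S.ncard = Module.finrank ℤ (S → ℤ) := by
      rw [Module.finrank_pi, Set.ncard_eq_toFinset_card', Set.toFinset_card]
    apply le_antisymm
    · rw [hn]; exact Submodule.finrank_le _
    · rw [hn]
      set h := Nat.card (ClassGroup (𝓞 F)) with hh
      have hpos : 0 < h := Nat.card_pos
      have hm : ∀ f : S → ℤ, (h : ℤ) • f ∈ LinearMap.range (ord S).toIntLinearMap := by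
        intro f
        have : (h : ℤ) • f = ∑ v, f v • ((h : ℤ) • Pi.single v (1 : ℤ)) := by
          ext w
          simp [Finset.sum_apply, Pi.single_apply, mul_comm]
        rw [this]
        refine Submodule.sum_mem _ fun v _ => Submodule.smul_mem _ _ ?_
        obtain ⟨x, hx, hx'⟩ := exists_gen v.1
        have hxm : x⁻¹ ∈ US S := (US S).inv_mem (fun v' hv' => hx' v' (fun h => hv' (h ▸ v.2)))
        refine ⟨Additive.ofMul ⟨x⁻¹, hxm⟩, ?_⟩
        ext w
        show WithZero.log (w.1.valuation F ((x⁻¹ : Fˣ) : F)) = _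
        rw [Units.val_inv_eq_inv_val, map_inv₀]
        by_cases hw : w = v
        · subst hw
          rw [hx]; simp [hh]
        · rw [hx' w.1 (fun h => hw (Subtype.ext h))]; simp [hw]
      let g : (S → ℤ) →ₗ[ℤ] LinearMap.range (ord S).toIntLinearMap := 
        LinearMap.codRestrict _ ((h : ℤ) • LinearMap.id) (fun f => hm f)
      apply LinearMap.finrank_le_finrank_of_injective (f := g)
      intro x y hxy
      have h5 : (h : ℤ) • x = (h : ℤ) • y := congrArg Subtype.val hxy
      exact smul_right_injective _ (by exact_mod_cast hpos.ne') h5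
  have h4 : 0 < Fintype.card (InfinitePlace F) := Fintype.card_pos
  omega

lemma torsion_card {p : ℕ} [hp : Fact p.Prime] {ζ : F} (hζ : IsPrimitiveRoot ζ p) (V : Subgroup Fˣ) 
    (hV : ∀ x : Fˣ, x ^ p = 1 → x ∈ V) : Nat.card (powMonoidHom p : V →* V).ker = p := by
  haveI : NeZero p := ⟨hp.out.ne_zero⟩
  have h1 : Nat.card (rootsOfUnity p F) = p := hζ.card_rootsOfUnity
  refine (Nat.card_congr ?_).trans h1
  refine ⟨fun x => ⟨((x : V) : Fˣ), ?_⟩, fun x => ⟨⟨x, hV x x.2⟩, ?_⟩, fun x => ?_, fun x => ?_⟩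
  · have := congrArg (fun t : V => (t : Fˣ)) x.2
    simpa using this
  · rw [MonoidHom.mem_ker]; apply Subtype.ext
    show (x : Fˣ) ^ p = 1
    exact (mem_rootsOfUnity p (x:Fˣ)).1 x.2
  · rfl
  · rfl

lemma US_index {p : ℕ} [hp : Fact p.Prime] {ζ : F} (hζ : IsPrimitiveRoot ζ p) (hS : S.Finite) :
    (powMonoidHom p : US S →* US S).range.index = p ^ (S.ncard + Fintype.card (InfinitePlace F)) := by
  haveI := US_fg hS
  rw [index_pow _ _ hp.out.pos, torsion_card hζ, ← pow_succ, US_rank hS]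
  intro x hx v _
  apply root_val _ hp.out.ne_zero
  have := congrArg (fun t : Fˣ => (t : F)) hx
  simpa using this
end
end Cft
end

section
open IsDedekindDomain NumberField WithZero Polynomial
namespace Cft
universe u
set_option linter.unusedSectionVars false
set_option linter.all false

section
variable {p : ℕ} [hp : Fact p.Prime]

lemma poly_id1 : ∃ q : ℤ[X], ∑ i ∈ Finset.range p, (X : ℤ[X]) ^ i = (X - 1) * q + (p : ℤ[X]) := by
  have h : (X - C 1 : ℤ[X]) ∣ (∑ i ∈ Finset.range p, (X : ℤ[X]) ^ i) - (p : ℤ[X]) := by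
    rw [dvd_iff_isRoot]
    simp [eval_finset_sum]
  obtain ⟨q, hq⟩ := h
  exact ⟨q, by rw [← C_1, ← hq]; ring⟩

lemma poly_id2 : ∃ q : ℤ[X], (X - 1 : ℤ[X]) ^ (p - 1) = ∑ i ∈ Finset.range p, (X : ℤ[X]) ^ i + (p : ℤ[X]) * q := by
  have h : C (p : ℤ) ∣ (X - 1 : ℤ[X]) ^ (p - 1) - ∑ i ∈ Finset.range p, (X : ℤ[X]) ^ i := by
    rw [C_dvd_iff_dvd_coeff]
    intro i
    rw [← ZMod.intCast_zmod_eq_zero_iff_dvd, ← eq_intCast (Int.castRingHom (ZMod p)), ← coeff_map]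
    suffices h2 : map (Int.castRingHom (ZMod p)) ((X - 1 : ℤ[X]) ^ (p - 1) - ∑ i ∈ Finset.range p, (X : ℤ[X]) ^ i) = 0 by
      rw [h2, coeff_zero]
    have h3 : (X - 1 : (ZMod p)[X]) ≠ 0 := by
      rw [← C_1]; exact X_sub_C_ne_zero 1
    apply mul_right_cancel₀ h3
    simp only [Polynomial.map_sub, Polynomial.map_pow, map_X, Polynomial.map_one, Polynomial.map_sum]
    rw [sub_mul, ← pow_succ, Nat.sub_add_cancel hp.out.one_le, geom_sum_mul, sub_pow_char]
    simp
  obtain ⟨q, hq⟩ := h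
  exact ⟨q, by rw [sub_eq_iff_eq_add'] at hq; rw [hq]; simp⟩

lemma index_iter (G : Type*) [AddCommGroup G] (f : Module.End ℤ G) (k : ℕ) (h : f.range.toAddSubgroup.index ≠ 0) : 
    (f ^ k).range.toAddSubgroup.index ≤ f.range.toAddSubgroup.index ^ k ∧ (f ^ k).range.toAddSubgroup.index ≠ 0 := by
  induction k with
  | zero => 
    have : ((f ^ 0).range : Submodule ℤ G).toAddSubgroup = ⊤ := by
      ext x; simp
    rw [this]; simp
  | succ k ih =>
    have h1 : ((f ^ (k+1)).range : Submodule ℤ G).toAddSubgroup = f.range.toAddSubgroup.map (f ^ k).toAddMonoidHom := by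
      ext x
      simp only [pow_succ]
      constructor
      · rintro ⟨y, rfl⟩
        exact ⟨f y, ⟨y, rfl⟩, rfl⟩
      · rintro ⟨_, ⟨y, rfl⟩, rfl⟩
        exact ⟨y, rfl⟩
    have h2 : (f ^ k).toAddMonoidHom.range = (f ^ k).range.toAddSubgroup := by
      ext x; simp
    rw [h1, AddSubgroup.index_map, h2]
    have h3 : (f.range.toAddSubgroup ⊔ (f ^ k).toAddMonoidHom.ker).index ∣ f.range.toAddSubgroup.index :=
      AddSubgroup.index_dvd_of_le le_sup_left
    have h4 := Nat.le_of_dvd (Nat.pos_of_ne_zero h) h3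
    refine ⟨?_, mul_ne_zero (fun h5 => h (by rw [h5] at h3; exact zero_dvd_iff.1 h3)) ih.2⟩
    rw [pow_succ, mul_comm]
    exact Nat.mul_le_mul ih.1 h4

lemma index_sigma (G : Type*) [AddCommGroup G] [Module.Finite ℤ G] (σ : Module.End ℤ G) 
    (hN : ∑ i ∈ Finset.range p, σ ^ i = 0) : ∃ k : ℕ, (σ - 1).range.toAddSubgroup.index = p ^ k ∧ 
      p ^ Module.finrank ℤ G * Nat.card (nsmulAddMonoidHom p : G →+ G).ker ≤ p ^ (k * (p - 1)) := by
  haveI : Module.Finite ℤ G := inferInstance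
  obtain ⟨q1, hq1⟩ := poly_id1 (p := p)
  obtain ⟨q2, hq2⟩ := poly_id2 (p := p)
  have e1 := congrArg (aeval σ) hq1
  have e2 := congrArg (aeval σ) hq2
  simp only [map_sum, map_pow, aeval_X, map_add, map_mul, map_sub, map_one, map_natCast, hN, zero_add] at e1 e2
  set R := (σ - 1).range.toAddSubgroup with hR
  have hker : Nat.card (nsmulAddMonoidHom p : G →+ G).ker ≠ 0 := by
    intro h0
    have hf : Finite (nsmulAddMonoidHom p : G →+ G).ker := by
      haveI : Module.Finite ℤ (LinearMap.lsmul ℤ G (p:ℤ)).ker := inferInstance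
      have ht : Module.IsTorsion ℤ (LinearMap.lsmul ℤ G (p:ℤ)).ker := by
        intro x
        refine ⟨⟨(p:ℤ), ?_⟩, ?_⟩
        · rw [mem_nonZeroDivisors_iff_ne_zero]; exact_mod_cast hp.out.ne_zero
        · exact Subtype.ext x.2
      haveI := Module.finite_of_fg_torsion _ ht
      refine Finite.of_injective (β := (LinearMap.lsmul ℤ G (p:ℤ)).ker) (fun x => ⟨x.1, ?_⟩) ?_
      · have := x.2
        rw [AddMonoidHom.mem_ker] at this
        rw [LinearMap.mem_ker]
        simpa using this
      · intro x y hxy; simp only [Subtype.mk.injEq] at hxy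
        exact Subtype.ext hxy
    exact Nat.card_pos.ne' h0
  have hind := index_addfg G p hp.out.pos
  have hpn : (nsmulAddMonoidHom p : G →+ G).range.index ≠ 0 := by
    rw [hind]; exact mul_ne_zero (pow_ne_zero _ hp.out.ne_zero) hker
  have hle : (nsmulAddMonoidHom p : G →+ G).range ≤ R := by
    rintro _ ⟨x, rfl⟩
    refine ⟨-(aeval σ q1 x), ?_⟩
    have := LinearMap.congr_fun e1 x
    simp only [LinearMap.zero_apply, LinearMap.add_apply, Module.End.mul_apply] at this
    rw [map_neg, neg_eq_iff_add_eq_zero, this]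
    simp 
  have hR0 : R.index ≠ 0 := fun h0 => hpn (by
    have := AddSubgroup.index_dvd_of_le hle
    rw [h0] at this; exact zero_dvd_iff.1 this)
  have hpow : ∃ k, R.index = p ^ k := by
    haveI : Finite (G ⧸ R) := by
      haveI : R.FiniteIndex := ⟨hR0⟩
      exact AddSubgroup.finite_quotient_of_finiteIndex
    have hpg : IsPGroup p (Multiplicative (G ⧸ R)) := by
      intro x
      refine ⟨1, ?_⟩
      rw [pow_one]
      show p • (x.toAdd : G ⧸ R) = 0
      obtain ⟨y, hy⟩ := QuotientAddGroup.mk_surjective x.toAdd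
      rw [← hy, ← QuotientAddGroup.mk_nsmul, QuotientAddGroup.eq_zero_iff]
      exact hle ⟨y, rfl⟩
    obtain ⟨k, hk⟩ := hpg.exists_card_eq
    exact ⟨k, hk⟩
  obtain ⟨k, hk⟩ := hpow
  refine ⟨k, hk, ?_⟩
  rw [← hind, pow_mul, ← hk]
  obtain ⟨h1, h2⟩ := index_iter G (σ - 1) (p - 1) hR0
  refine le_trans ?_ h1
  have hle2 : ((σ - 1) ^ (p - 1)).range.toAddSubgroup ≤ (nsmulAddMonoidHom p : G →+ G).range := by
    rintro _ ⟨x, rfl⟩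
    refine ⟨aeval σ q2 x, ?_⟩
    rw [e2]
    simp
  exact Nat.le_of_dvd (Nat.pos_of_ne_zero h2) (AddSubgroup.index_dvd_of_le hle2)

lemma herbrand (M : Type*) [AddCommGroup M] [Module.Finite ℤ M] (σ : Module.End ℤ M) (N : Module.End ℤ M) 
    (hN : ∑ i ∈ Finset.range p, σ ^ i = N) (hσ : σ ^ p = 1)
    (V : Submodule ℤ M) (hVd : V = N.ker) (W : Submodule ℤ M) (hWd : W = (σ - 1).ker)
    (hV : ∀ x, N x = 0 → ∃ y, σ y - y = x) (r s : ℕ)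
    (hVp : Nat.card (nsmulAddMonoidHom p : V →+ V).ker = p)
    (hWp : (nsmulAddMonoidHom p : W →+ W).range.index = p ^ s)
    (hr : (p - 1) * r ≤ Module.finrank ℤ V) :
    N.range.toAddSubgroup.relIndex W.toAddSubgroup ≠ 0 ∧
    N.range.toAddSubgroup.relIndex W.toAddSubgroup * p ^ (r + 1) ≤ p ^ s := by
  have hcomm : (σ - 1) * N = N * (σ - 1) := by
    rw [← hN]
    exact (((Commute.sum_right _ _ _ (fun i _ => (Commute.refl σ).pow_right i))).sub_left (Commute.one_left _)).eq
  have hsN : (σ - 1) * N = 0 := by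
    rw [← hN, mul_geom_sum, hσ, sub_self]
  have hNs : N * (σ - 1) = 0 := by rw [← hcomm, hsN]
  have hsV : ∀ x ∈ V, σ x ∈ V := by
    intro x hx
    rw [hVd, LinearMap.mem_ker] at hx ⊢
    have := LinearMap.congr_fun hNs x
    simp only [Module.End.mul_apply, LinearMap.sub_apply, Module.End.one_apply, LinearMap.zero_apply, map_sub, hx, sub_zero] at this
    exact this
  have hNW : ∀ x ∈ W, N x = p • x := by
    intro x hx
    rw [hWd, LinearMap.mem_ker, LinearMap.sub_apply, Module.End.one_apply, sub_eq_zero] at hx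
    have : ∀ i, (σ ^ i) x = x := by
      intro i
      induction i with
      | zero => simp
      | succ i ih => rw [pow_succ, Module.End.mul_apply, hx, ih]
    rw [← hN, LinearMap.sum_apply, Finset.sum_congr rfl (fun i _ => this i)]
    simp
  have hNrW : N.range.toAddSubgroup ≤ W.toAddSubgroup := by
    rintro _ ⟨x, rfl⟩
    show N x ∈ W
    rw [hWd, LinearMap.mem_ker]
    exact LinearMap.congr_fun hsN x
  set Nh := N.toAddMonoidHom
  set lh := (σ - 1).toAddMonoidHom
  set V' := V.toAddSubgroup
  set W' := W.toAddSubgroup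
  have kN : Nh.ker = V' := by
    ext x; show N x = 0 ↔ x ∈ V; rw [hVd]; rfl
  have kl : lh.ker = W' := by
    ext x; show (σ - 1) x = 0 ↔ x ∈ W; rw [hWd]; rfl
  have rN : N.range.toAddSubgroup = (⊤ : AddSubgroup M).map Nh := by
    ext x; constructor
    · rintro ⟨y, rfl⟩; exact ⟨y, trivial, rfl⟩
    · rintro ⟨y, _, rfl⟩; exact ⟨y, rfl⟩
  have rl : V' = (⊤ : AddSubgroup M).map lh := by
    ext x; constructor
    · intro hx
      have hx : x ∈ V := hx
      rw [hVd] at hx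
      obtain ⟨y, hy⟩ := hV x hx
      exact ⟨y, trivial, hy⟩
    · rintro ⟨y, _, rfl⟩
      show (σ - 1) y ∈ V
      rw [hVd]
      exact LinearMap.congr_fun hNs y
  have c1 : (W'.map Nh).relIndex N.range.toAddSubgroup * N.range.toAddSubgroup.relIndex W' = (W'.map Nh).relIndex W' := by
    apply AddSubgroup.relIndex_mul_relIndex _ _ _ _ hNrW
    rw [rN]; exact AddSubgroup.map_mono le_top
  have c2 : (W'.map Nh).relIndex N.range.toAddSubgroup = (V'.map lh).relIndex V' := by
    rw [rN]
    have c5 : (V'.map lh).relIndex V' = (V'.map lh).relIndex ((⊤ : AddSubgroup M).map lh) := congrArg _ rl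
    rw [c5, AddSubgroup.relIndex_map_map, AddSubgroup.relIndex_map_map, kN, kl, sup_comm]
    simp
  have c3 : (W'.map Nh).relIndex W' = p ^ s := by
    rw [← hWp, AddSubgroup.relIndex]
    congr 1
    ext x
    rw [AddSubgroup.mem_addSubgroupOf]
    constructor
    · rintro ⟨y, hy, hyx⟩
      refine ⟨⟨y, hy⟩, Subtype.ext ?_⟩
      rw [← hyx]; exact (hNW y hy).symm
    · rintro ⟨y, rfl⟩
      exact ⟨y.1, y.2, hNW _ y.2⟩
  have c4 : (V'.map lh).relIndex V' = ((σ.restrict hsV) - 1).range.toAddSubgroup.index := by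
    rw [AddSubgroup.relIndex]
    congr 1
    ext x
    rw [AddSubgroup.mem_addSubgroupOf]
    constructor
    · rintro ⟨y, hy, hyx⟩
      exact ⟨⟨y, hy⟩, Subtype.ext hyx⟩
    · rintro ⟨y, rfl⟩
      exact ⟨y.1, y.2, rfl⟩
  have hVN : ∑ i ∈ Finset.range p, (σ.restrict hsV) ^ i = 0 := by
    ext x
    have hx : N x.1 = 0 := by
      have h8 : ∀ y ∈ V, N y = 0 := fun y hy => by rw [hVd] at hy; exact hy
      exact h8 _ x.2
    have : ∀ i, (((σ.restrict hsV) ^ i) x : M) = (σ ^ i) x.1 := by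
      intro i
      induction i with
      | zero => simp
      | succ i ih => rw [pow_succ', pow_succ', Module.End.mul_apply, Module.End.mul_apply, ← ih]; rfl
    rw [LinearMap.sum_apply, AddSubmonoidClass.coe_finset_sum, Finset.sum_congr rfl (fun i _ => this i), ← LinearMap.sum_apply, hN, hx]
    rfl
  obtain ⟨k, hk, hk2⟩ := index_sigma (p := p) V (σ.restrict hsV) hVN
  rw [hVp, ← pow_succ] at hk2
  have hk3 := (Nat.pow_le_pow_iff_right hp.out.one_lt).1 hk2
  have hk4 : r + 1 ≤ k := by
    by_contra hlt
    have : k ≤ r := by omega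
    have : k * (p - 1) ≤ (p - 1) * r := by rw [mul_comm]; exact Nat.mul_le_mul_left _ this
    omega
  rw [c2, c4, hk, c3] at c1
  constructor
  · intro h0
    rw [h0, mul_zero] at c1
    exact pow_ne_zero s hp.out.ne_zero c1.symm
  · rw [← c1, mul_comm]
    exact Nat.mul_le_mul_right _ (Nat.pow_le_pow_right hp.out.pos hk4)
end
end Cft
end

section
open IsDedekindDomain NumberField WithZero Polynomial
namespace Cft
universe u
set_option linter.unusedSectionVars false
set_option linter.all false

section
variable {F : Type*} [Field F] [NumberField F]

lemma supp_finite (x : Fˣ) : {v : HeightOneSpectrum (𝓞 F) | v.valuation F (x : F) ≠ 1}.Finite := by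
  apply ((HeightOneSpectrum.Support.finite (𝓞 F) (x : F)).union (HeightOneSpectrum.Support.finite (𝓞 F) (x⁻¹ : F))).subset
  intro v hv
  rcases lt_or_gt_of_ne hv with h | h
  · right
    show 1 < v.valuation F (x⁻¹ : F)
    rw [map_inv₀]
    exact (one_lt_inv₀ (zero_lt_iff.2 (val_unit_ne v x))).2 h
  · left; exact h

def ClS (S : Set (HeightOneSpectrum (𝓞 F))) : Prop := ∀ v ∉ S, ∃ γ : Fˣ, v.valuation F (γ : F) = exp (-1 : ℤ) ∧ 
  ∀ v' ∉ S, v' ≠ v → v'.valuation F (γ : F) = 1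

lemma ClS.mono {S T : Set (HeightOneSpectrum (𝓞 F))} (h : ClS S) (hT : S ⊆ T) : ClS T := by
  intro v hv
  obtain ⟨γ, h1, h2⟩ := h v (fun h' => hv (hT h'))
  exact ⟨γ, h1, fun v' hv' => h2 v' (fun h' => hv' (hT h'))⟩

lemma exists_ClS : ∃ S : Set (HeightOneSpectrum (𝓞 F)), S.Finite ∧ ClS S := by
  classical
  choose I hI using fun c : ClassGroup (𝓞 F) => ClassGroup.mk0_surjective c
  refine ⟨⋃ c, {v : HeightOneSpectrum (𝓞 F) | v.asIdeal ∣ (I c : Ideal (𝓞 F))}, ?_, ?_⟩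
  · apply Set.finite_iUnion
    intro c
    exact Ideal.finite_factors (nonZeroDivisors.coe_ne_zero _)
  · intro v hv
    have hv0 : ∀ c, ¬ v.asIdeal ∣ (I c : Ideal (𝓞 F)) := fun c h => hv (Set.mem_iUnion.2 ⟨c, h⟩)
    set V : nonZeroDivisors (Ideal (𝓞 F)) := ⟨v.asIdeal, mem_nonZeroDivisors_of_ne_zero v.ne_bot⟩
    set c := (ClassGroup.mk0 V)⁻¹
    have h1 : ClassGroup.mk0 (V * I c) = 1 := by rw [map_mul, hI]; simp [c]
    have h2 := (ClassGroup.mk0_eq_one_iff (I := v.asIdeal * (I c : Ideal (𝓞 F))) (V * I c).2).1 h1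
    obtain ⟨x, hx⟩ := h2
    have hx' : v.asIdeal * (I c : Ideal (𝓞 F)) = Ideal.span {x} := hx
    have hx0 : x ≠ 0 := by
      rintro rfl
      rw [Set.singleton_zero, Ideal.span_zero] at hx'
      exact mul_ne_zero v.ne_bot (nonZeroDivisors.coe_ne_zero (I c)) hx'
    have hx0' : (x : F) ≠ 0 := by simpa using hx0
    refine ⟨Units.mk0 (x : F) hx0', ?_, ?_⟩
    · have a1 : v.valuation F (x : F) ≤ exp (-((1:ℕ):ℤ)) := by
        rw [val_le_pow_iff, pow_one, ← Ideal.span_singleton_le_iff_mem, ← hx']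
        exact Ideal.mul_le_left (I := v.asIdeal) (J := (I c : Ideal (𝓞 F)))
      have a2 : ¬ v.valuation F (x : F) ≤ exp (-((2:ℕ):ℤ)) := by
        rw [val_le_pow_iff, ← Ideal.span_singleton_le_iff_mem, ← hx', ← Ideal.dvd_iff_le, pow_two]
        intro h
        exact hv0 c ((mul_dvd_mul_iff_left v.ne_bot).1 h)
      rw [Units.val_mk0]
      have a3 : v.valuation F (x : F) ≠ 0 := by rw [Valuation.ne_zero_iff]; exact hx0'
      obtain ⟨k, hk⟩ := (⟨WithZero.log _, WithZero.exp_log a3⟩ : ∃ k : ℤ, exp k = v.valuation F (x : F))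
      rw [← hk, WithZero.exp_le_exp] at a1 a2
      rw [← hk, WithZero.exp_inj]
      push_cast at a1 a2
      omega
    · intro v' hv' hne
      rw [Units.val_mk0]
      refine (v'.valuation_eq_one_iff_notMem (K := F)).2 ?_
      intro hm
      have h3 : v.asIdeal * (I c : Ideal (𝓞 F)) ≤ v'.asIdeal := by rw [hx', Ideal.span_singleton_le_iff_mem]; exact hm
      rcases v'.isPrime.mul_le.1 h3 with h4 | h4
      · exact hne (HeightOneSpectrum.ext (v.isMaximal.eq_of_le v'.isPrime.ne_top h4).symm)
      · exact hv' (Set.mem_iUnion.2 ⟨c, Ideal.dvd_iff_le.2 h4⟩)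

lemma exists_vals {S : Set (HeightOneSpectrum (𝓞 F))} (hS : ClS S) (n : HeightOneSpectrum (𝓞 F) → Fˣ)
    (hn : {v | v ∉ S ∧ v.valuation F (n v : F) ≠ 1}.Finite) : ∃ t : Fˣ, ∀ v ∉ S, v.valuation F (t : F) = v.valuation F (n v : F) := by
  classical
  have key : ∀ D : Finset (HeightOneSpectrum (𝓞 F)), ∃ t : Fˣ, ∀ v ∉ S, v.valuation F (t : F) = if v ∈ D then v.valuation F (n v : F) else 1 := by
    intro D
    induction D using Finset.induction_on with
    | empty => exact ⟨1, by simp⟩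
    | insert v D hv ih =>
      obtain ⟨t, ht⟩ := ih
      by_cases hvS : v ∈ S
      · refine ⟨t, fun v' hv' => ?_⟩
        rw [ht v' hv']
        have : v' ≠ v := by rintro rfl; exact hv' hvS
        simp [this]
      · obtain ⟨γ, h1, h2⟩ := hS v hvS
        obtain ⟨k, hk⟩ := (⟨WithZero.log _, WithZero.exp_log (val_unit_ne v (n v))⟩ : ∃ k : ℤ, exp k = v.valuation F (n v : F))
        refine ⟨t * γ ^ (-k), fun v' hv' => ?_⟩
        rw [Units.val_mul, map_mul, ht v' hv', Units.val_zpow_eq_zpow_val, map_zpow₀]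
        by_cases e : v' = v
        · subst e
          rw [if_neg hv, h1, one_mul, ← hk, ← WithZero.exp_zsmul]; simp
        · rw [h2 v' hv' e]; simp [e]
  obtain ⟨t, ht⟩ := key hn.toFinset
  refine ⟨t, fun v hv => ?_⟩
  rw [ht v hv]
  by_cases h : v.valuation F (n v : F) = 1
  · simp [h]
  · simp [h, hv]

end
section
variable {F : Type*} [Field F] [NumberField F] {K : Type*} [Field K] [NumberField K] [Algebra F K]
variable {p : ℕ} [hp : Fact p.Prime] {ζ : F} {σ : K ≃ₐ[F] K} {α : K}

lemma real_odd (hζ : IsPrimitiveRoot ζ p) (ψ : F →+* ℝ) : p = 2 := by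
  by_contra h2
  have hodd := hp.out.odd_of_ne_two h2
  have h1 : (ψ ζ) ^ p = 1 := by rw [← map_pow, hζ.pow_eq_one, map_one]
  have h3 : ψ ζ = 1 := by
    have : (ψ ζ) ^ p = 1 ^ p := by rw [h1, one_pow]
    exact hodd.strictMono_pow.injective this
  have h4 : ζ = 1 := ψ.injective (by rw [h3, map_one])
  exact hζ.ne_one hp.out.one_lt h4

lemma inf_card {a : F} (h : Kum p ζ a α σ) (ha : ∀ φ : F →+* ℝ, 0 < φ a) : 
    Fintype.card (InfinitePlace K) = Fintype.card (InfinitePlace F) * p := by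
  haveI := h.fd
  haveI := h.gal
  rw [← h.hfin]
  haveI : IsUnramifiedAtInfinitePlaces F K := by
    constructor
    intro w
    rw [InfinitePlace.isUnramified_iff]
    by_contra hc
    push Not at hc
    obtain ⟨h1, h2⟩ := hc
    rw [InfinitePlace.not_isComplex_iff_isReal] at h2
    apply h1
    have h3 : ComplexEmbedding.IsReal (w.embedding.comp (algebraMap F K)) := by
      rw [← InfinitePlace.isReal_mk_iff]
      convert h2
      rw [← InfinitePlace.comap_mk, InfinitePlace.mk_embedding]
    set φ := w.embedding
    let ψ := h3.embedding
    have hψ : ∀ x : F, ((ψ x : ℝ) : ℂ) = φ (algebraMap F K x) := fun x => ComplexEmbedding.IsReal.coe_embedding_apply h3 x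
    have p2 := real_odd h.hζ ψ
    have e1 : (φ α) ^ 2 = ((ψ a : ℝ) : ℂ) := by rw [hψ, ← h.hα, map_pow, p2]
    have e2 : star (φ α) = φ α := by
      have e3 : (φ α) ^ 2 = ((Real.sqrt (ψ a) : ℝ) : ℂ) ^ 2 := by
        rw [e1, ← Complex.ofReal_pow, Real.sq_sqrt (ha ψ).le]
      rcases sq_eq_sq_iff_eq_or_eq_neg.1 e3 with e | e <;> rw [e] <;> simp
    rw [InfinitePlace.isReal_iff, ComplexEmbedding.isReal_iff]
    ext x
    obtain ⟨f, rfl⟩ := h.exists_poly x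
    rw [aeval_eq_sum_range]
    simp only [map_sum, Algebra.smul_def, map_mul, map_pow]
    refine Finset.sum_congr rfl fun i _ => ?_
    congr 1
    · rw [ComplexEmbedding.conjugate_coe_eq, ← hψ]; simp
    · rw [ComplexEmbedding.conjugate_coe_eq]
      exact congrArg (· ^ i) e2
  exact IsUnramifiedAtInfinitePlaces.card_infinitePlace F K

def above (K : Type*) [Field K] [NumberField K] [Algebra F K] (S : Set (HeightOneSpectrum (𝓞 F))) : Set (HeightOneSpectrum (𝓞 K)) := {w | un F w ∈ S}

lemma fiber_finite [IsGalois F K] (v : HeightOneSpectrum (𝓞 F)) : {w : HeightOneSpectrum (𝓞 K) | un F w = v}.Finite := by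
  haveI : FiniteDimensional F K := Module.Finite.of_restrictScalars_finite ℚ F K
  obtain ⟨w, hw⟩ := exists_above (K := K) v
  apply (Set.finite_range (fun τ : K ≃ₐ[F] K => act τ w)).subset
  intro w' hw'
  exact trans_act (hw.trans hw'.symm)

lemma above_finite [IsGalois F K] {S : Set (HeightOneSpectrum (𝓞 F))} (hS : S.Finite) : (above K S).Finite := by
  have : above K S = ⋃ v ∈ S, {w : HeightOneSpectrum (𝓞 K) | un F w = v} := by
    ext w; simp [above]
  rw [this]
  exact hS.biUnion (fun v _ => fiber_finite v)

lemma above_card {a : Fˣ} (h : Kum p ζ (a : F) α σ) {S : Set (HeightOneSpectrum (𝓞 F))} (hS : S.Finite) : 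
    S.ncard + (p - 1) * {v ∈ S | a ∈ Pv p v}.ncard ≤ (above K S).ncard := by
  classical
  haveI := h.gal
  have hK := above_finite (K := K) hS
  rw [Set.ncard_eq_toFinset_card _ hS, Set.ncard_eq_toFinset_card _ hK]
  have e1 : hK.toFinset.card = ∑ v ∈ hS.toFinset, (hK.toFinset.filter (fun w => un F w = v)).card := by
    apply Finset.card_eq_sum_card_fiberwise
    intro w hw
    simpa [above] using hw
  have e2 : {v ∈ S | a ∈ Pv p v}.ncard = (hS.toFinset.filter (fun v => a ∈ Pv p v)).card := by
    rw [← Set.ncard_coe_finset]; congr 1; ext v; simp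
  rw [e1, e2, Finset.card_eq_sum_ones, Finset.card_filter, Finset.mul_sum, ← Finset.sum_add_distrib]
  apply Finset.sum_le_sum
  intro v hv
  have hv : v ∈ S := by simpa using hv
  split_ifs with hav
  · obtain ⟨f, hf, hf2⟩ := split_primes h hav
    have := Finset.card_le_card (s := Finset.univ.image f) (t := hK.toFinset.filter (fun w => un F w = v)) (by
      intro w hw
      simp only [Finset.mem_image, Finset.mem_univ, true_and] at hw
      obtain ⟨i, rfl⟩ := hw
      simp [above, hf2, hv])
    rw [Finset.card_image_of_injective _ hf, Finset.card_univ, Fintype.card_fin] at this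
    have := hp.out.one_le
    omega
  · simp only [mul_zero, add_zero]
    rw [Nat.one_le_iff_ne_zero, Finset.card_ne_zero]
    obtain ⟨w, hw⟩ := exists_above (K := K) v
    exact ⟨w, by simp [above, hw, hv]⟩
end
end Cft
end

section
open IsDedekindDomain NumberField WithZero Polynomial
namespace Cft
universe u
set_option linter.unusedSectionVars false
set_option linter.all false

section
variable {F : Type*} [Field F] [NumberField F] {K : Type*} [Field K] [NumberField K] [Algebra F K]
variable {p : ℕ} [hp : Fact p.Prime] {ζ : F} {σ : K ≃ₐ[F] K} {α : K}

variable (F K) in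
noncomputable abbrev jj : Fˣ →* Kˣ := Units.map (algebraMap F K).toMonoidHom

variable (F K) in
noncomputable abbrev nrm : Kˣ →* Fˣ := Units.map (Algebra.norm F : K →* F)

lemma jj_inj : Function.Injective (jj F K) := Units.map_injective (algebraMap F K).injective

lemma jj_mem_US {S : Set (HeightOneSpectrum (𝓞 F))} {x : Fˣ} : jj F K x ∈ US (above K S) ↔ x ∈ US S := by
  constructor
  · intro h v hv
    obtain ⟨w, rfl⟩ := exists_above (K := K) v
    exact (val_un_eq_one w _).1 (h w hv)
  · intro h w hw
    exact (val_un_eq_one w _).2 (h _ hw)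

lemma sig_mem_US {S : Set (HeightOneSpectrum (𝓞 F))} (τ : K ≃ₐ[F] K) {x : Kˣ} (hx : x ∈ US (above K S)) : 
    Units.map (τ : K →* K) x ∈ US (above K S) := by
  intro w hw
  have := act_val τ w (x : K)
  have h2 := hx (act τ w) (by show un F (act τ w) ∉ S; rw [un_act]; exact hw)
  rw [h2] at this
  exact this.symm

lemma hilbert90 {a : F} (h : Kum p ζ a α σ) {x : K} (hx : Algebra.norm F x = 1) : ∃ y : Kˣ, x * σ (y : K) = y := by
  classical
  have hx0 : x ≠ 0 := by
    rintro rfl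
    haveI := h.fd
    rw [Algebra.norm_zero] at hx; exact zero_ne_one hx
  let c : ℕ → K := fun i => ∏ j ∈ Finset.range i, (σ ^ j) x
  have hc1 : ∀ i, x * σ (c i) = c (i + 1) := by
    intro i
    simp only [c]
    rw [Finset.prod_range_succ', map_prod, mul_comm]
    congr 1
    refine Finset.prod_congr rfl fun j _ => ?_
    rw [pow_succ', AlgEquiv.mul_apply]
  have hcp : c p = 1 := by
    simp only [c]; rw [← h.norm_eq, hx, map_one]
  have hc0 : c 0 = 1 := by simp [c]
  obtain ⟨z, hz⟩ : ∃ z : K, ∑ i : Fin p, c i * (σ ^ (i : ℕ)) z ≠ 0 := by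
    by_contra hcon
    push Not at hcon
    have li : LinearIndependent K (fun i : Fin p => (((σ ^ (i : ℕ) : K ≃ₐ[F] K) : K →* K) : K → K)) := by
      apply (linearIndependent_monoidHom K K).comp (fun i : Fin p => ((σ ^ (i : ℕ) : K ≃ₐ[F] K) : K →* K))
      intro i j hij
      have h1 : (σ ^ (i : ℕ)) = σ ^ (j : ℕ) := by
        ext t; exact DFunLike.congr_fun hij t
      have h2 := pow_injOn_Iio_orderOf (x := σ) (by rw [h.order]; exact i.2) (by rw [h.order]; exact j.2) h1
      exact Fin.ext h2
    have := Fintype.linearIndependent_iff.1 li (fun i => c i) (by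
      ext z
      rw [Finset.sum_apply]
      exact hcon z) ⟨0, hp.out.pos⟩
    rw [hc0] at this
    exact one_ne_zero this
  refine ⟨Units.mk0 _ hz, ?_⟩
  rw [Units.val_mk0, Finset.sum_range (f := fun i => c i * (σ ^ i) z) |>.symm]
  have hd : ∀ i, x * σ (c i * (σ ^ i) z) = c (i + 1) * (σ ^ (i + 1)) z := by
    intro i
    rw [map_mul, ← mul_assoc, hc1, pow_succ', AlgEquiv.mul_apply]
  have hσp : σ ^ p = 1 := by rw [← h.order]; exact pow_orderOf_eq_one σ
  rw [map_sum, Finset.mul_sum, Finset.sum_congr rfl (fun i _ => hd i)]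
  have e1 := Finset.sum_range_succ (fun i => c i * (σ ^ i) z) p
  have e2 := Finset.sum_range_succ' (fun i => c i * (σ ^ i) z) p
  rw [e1, hcp, hσp, hc0, pow_zero] at e2
  exact (add_right_cancel e2).symm

lemma h90 {a : Fˣ} (h : Kum p ζ (a : F) α σ) {S : Set (HeightOneSpectrum (𝓞 F))} 
    (hp1 : ∀ v ∉ S, v.valuation F (p : F) = 1) (ha : a ∈ US S) (hcl : ClS S) {x : Kˣ} (hx : x ∈ US (above K S))
    (hN : Algebra.norm F (x : K) = 1) : ∃ y ∈ US (above K S), (Units.map (σ : K →* K) y) / y = x := by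
  haveI := h.fd
  haveI := h.gal
  obtain ⟨y0, hy0⟩ := hilbert90 h hN
  set y := y0⁻¹ with hy
  have hyx : (Units.map (σ : K →* K) y) / y = x := by
    ext
    have h0 : σ (y0 : K) ≠ 0 := by simp
    rw [hy]
    simp only [Units.val_div_eq_div_val, Units.coe_map, map_inv, Units.val_inv_eq_inv_val, MonoidHom.coe_coe, RingHom.coe_coe]
    have h1 : (x : K) = y0 / σ y0 := by rw [eq_div_iff h0]; exact hy0
    rw [h1]
    simp [div_eq_mul_inv, mul_comm]
  have hinv : ∀ v ∉ S, ∀ w : HeightOneSpectrum (𝓞 K), un F w = v → w.valuation K (σ (y : K)) = w.valuation K (y : K) := by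
    intro v hv w hw
    have h1 : σ (y : K) = (x : K) * y := by
      rw [← hyx]; simp
    rw [h1, map_mul, hx w (by show un F w ∉ S; rwa [hw]), one_mul]
  have hc : ∀ v : HeightOneSpectrum (𝓞 F), ∃ c : Fˣ, v ∉ S → ∀ w : HeightOneSpectrum (𝓞 K), un F w = v → w.valuation K (y : K) = w.valuation K (algebraMap F K c) := by
    intro v
    by_cases hv : v ∈ S
    · exact ⟨1, fun h => absurd hv h⟩
    · obtain ⟨c, hc0, hc⟩ := tame_invariant h (hp1 v hv) (y := 1) (by rw [map_one, one_pow]; exact ha v hv) y.ne_zero (hinv v hv)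
      exact ⟨Units.mk0 c hc0, fun _ => hc⟩
  choose c hc using hc
  obtain ⟨t, ht⟩ := exists_vals hcl c (by
    apply ((supp_finite y).image (un F)).subset
    rintro v ⟨hv, hv1⟩
    obtain ⟨w, rfl⟩ := exists_above (K := K) v
    refine ⟨w, ?_, rfl⟩
    intro h1
    have := hc _ hv w rfl
    rw [h1] at this
    exact hv1 ((val_un_eq_one w _).1 this.symm))
  refine ⟨y / jj F K t, ?_, ?_⟩
  · intro w hw
    obtain ⟨e, he, hwe⟩ := val_un (F := F) w
    rw [Units.val_div_eq_div_val, map_div₀, hc _ hw w rfl, hwe]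
    have : w.valuation K ((jj F K t : Kˣ) : K) = (un F w).valuation F (t : F) ^ e := hwe _
    rw [this, ht _ hw]
    exact div_self (pow_ne_zero _ (val_unit_ne _ _))
  · rw [_root_.map_div, ← hyx]
    have : Units.map (σ : K →* K) (jj F K t) = jj F K t := by
      ext; exact σ.commutes _
    rw [this]
    exact div_div_div_cancel_right _ _ _

lemma index_nsmul_equiv {A B : Type*} [AddCommGroup A] [AddCommGroup B] (e : A ≃+ B) (n : ℕ) : 
    (nsmulAddMonoidHom n : A →+ A).range.index = (nsmulAddMonoidHom n : B →+ B).range.index := by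
  rw [← AddSubgroup.index_map_equiv _ e]
  congr 1
  ext x
  constructor
  · rintro ⟨_, ⟨y, rfl⟩, rfl⟩
    exact ⟨e y, (map_nsmul e n y).symm⟩
  · rintro ⟨y, rfl⟩
    refine ⟨n • e.symm y, ⟨e.symm y, rfl⟩, ?_⟩
    show e (n • e.symm y) = n • y
    rw [map_nsmul, e.apply_symm_apply]

lemma herbrand2 (M A : Type*) [AddCommGroup M] [Module.Finite ℤ M] [AddCommGroup A] [Module.Finite ℤ A] (s N : Module.End ℤ M) (hN : ∑ i ∈ Finset.range p, s ^ i = N)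
    (hs : s ^ p = 1) (ι : A →+ M) (hι : Function.Injective ι) (hr : ∀ x, s x = x ↔ x ∈ ι.range)
    (hV : ∀ x, N x = 0 → ∃ y, s y - y = x) (r t : ℕ)
    (hVp : Nat.card {x : M // p • x = 0 ∧ N x = 0} = p)
    (hWp : (nsmulAddMonoidHom p : A →+ A).range.index = p ^ t)
    (hrk : Module.finrank ℤ A + (p - 1) * r ≤ Module.finrank ℤ M) :
    (N.range.toAddSubgroup.comap ι).index ≠ 0 ∧
    (N.range.toAddSubgroup.comap ι).index * p ^ (r + 1) ≤ p ^ t := by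
  have hWr : (s - 1).ker.toAddSubgroup = ι.range := by
    ext x
    rw [← hr, ← sub_eq_zero]
    rfl
  have hmem : ∀ x, ι x ∈ (s - 1).ker := by
    intro x
    rw [LinearMap.mem_ker, LinearMap.sub_apply, Module.End.one_apply, sub_eq_zero]
    exact (hr _).2 ⟨x, rfl⟩
  obtain ⟨eW⟩ : Nonempty (A ≃+ (s - 1).ker) := by
    refine ⟨AddEquiv.ofBijective (AddMonoidHom.mk' (fun x => (⟨ι x, hmem x⟩ : (s - 1).ker)) (fun x y => Subtype.ext (map_add ι x y))) ⟨?_, ?_⟩⟩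
    · intro x y hxy
      exact hι (congrArg (fun t : (s - 1).ker => (t : M)) hxy)
    · rintro ⟨x, hx⟩
      rw [LinearMap.mem_ker, LinearMap.sub_apply, Module.End.one_apply, sub_eq_zero] at hx
      obtain ⟨y, hy⟩ := (hr _).1 hx
      exact ⟨y, Subtype.ext hy⟩
  have hrW : Module.finrank ℤ (s - 1).ker = Module.finrank ℤ A := by
    have h1 : (s - 1).ker = LinearMap.range ι.toIntLinearMap := by
      ext x
      rw [LinearMap.mem_ker, LinearMap.sub_apply, Module.End.one_apply, sub_eq_zero, hr]
      rfl
    rw [h1]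
    exact LinearMap.finrank_range_of_inj hι
  have hrNW : Module.finrank ℤ N.range ≤ Module.finrank ℤ (s - 1).ker := by
    apply Submodule.finrank_mono
    rintro _ ⟨x, rfl⟩
    show (s - 1) (N x) = 0
    have : (s - 1) * N = 0 := by rw [← hN, mul_geom_sum, hs, sub_self]
    exact LinearMap.congr_fun this x
  have hrn : Module.finrank ℤ N.range + Module.finrank ℤ N.ker = Module.finrank ℤ M := by
    have h1 := Submodule.finrank_quotient_add_finrank N.ker
    rw [LinearEquiv.finrank_eq (LinearMap.quotKerEquivRange N)] at h1
    exact h1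
  have hle : (p - 1) * r ≤ Module.finrank ℤ N.ker := by
    have h1 := hrk
    rw [← hrn, ← hrW] at h1
    exact Nat.le_of_add_le_add_left (h1.trans (Nat.add_le_add_right hrNW _))
  have := herbrand M s N hN hs N.ker rfl (s - 1).ker rfl hV r t ?_ ?_ hle
  · rw [hWr, ← AddSubgroup.index_comap] at this
    exact this
  · refine (Nat.card_congr ?_).trans hVp
    refine ⟨fun x => ⟨x.1.1, ?_, x.1.2⟩, fun x => ⟨⟨x.1, x.2.2⟩, Subtype.ext x.2.1⟩, fun x => rfl, fun x => rfl⟩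
    exact congrArg (fun t : N.ker => (t : M)) x.2
  · rw [← index_nsmul_equiv eW, hWp]

set_option maxHeartbeats 400000 in
theorem lemmaA {a : Fˣ} (h : Kum p ζ (a : F) α σ) {S : Set (HeightOneSpectrum (𝓞 F))} (hS : S.Finite)
    (hp1 : ∀ v ∉ S, v.valuation F (p : F) = 1) (ha : a ∈ US S) (hcl : ClS S) (hpos : ∀ φ : F →+* ℝ, 0 < φ a) :
    ((US (above K S)).map (nrm F K)).relIndex (US S) ≠ 0 ∧
    ((US (above K S)).map (nrm F K)).relIndex (US S) * p ^ ({v ∈ S | a ∈ Pv p v}.ncard + 1) ≤ p ^ S.ncard := by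
  classical
  haveI := h.fd
  haveI := h.gal
  have hζK : IsPrimitiveRoot (algebraMap F K ζ) p := h.hζ.map_of_injective (algebraMap F K).injective
  have hSK := above_finite (K := K) hS
  set M := Additive (US (above K S)) with hM
  haveI : Module.Finite ℤ M := US_fg hSK
  haveI := US_fg hS
  let σ0 : M →+ M := MonoidHom.toAdditive (((Units.map (σ : K →* K)).comp (US (above K S)).subtype).codRestrict (US (above K S)) (fun x => 
    sig_mem_US σ x.2) : US (above K S) →* US (above K S))
  let s : Module.End ℤ M := σ0.toIntLinearMap
  have hs : ∀ (i : ℕ) (x : M), (((s ^ i) x).toMul : Kˣ).val = (σ ^ i) ((x.toMul : Kˣ) : K) := by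
    intro i
    induction i with
    | zero => intro x; rfl
    | succ i ih => intro x; rw [pow_succ', pow_succ', Module.End.mul_apply, AlgEquiv.mul_apply, ← ih]; rfl
  set N : Module.End ℤ M := ∑ i ∈ Finset.range p, s ^ i with hN
  have hNv : ∀ x : M, ((N x).toMul : Kˣ).val = algebraMap F K (Algebra.norm F ((x.toMul : Kˣ) : K)) := by
    intro x
    rw [h.norm_eq, hN, LinearMap.sum_apply]
    rw [toMul_sum, SubmonoidClass.coe_finset_prod, Units.coe_prod]
    exact Finset.prod_congr rfl fun i _ => hs i x
  have hext : ∀ x y : M, ((x.toMul : Kˣ) : K) = ((y.toMul : Kˣ) : K) → x = y := by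
    intro x y hxy
    apply Additive.toMul.injective
    exact Subtype.ext (Units.ext hxy)
  have hsp : s ^ p = 1 := by
    apply LinearMap.ext
    intro x
    apply hext
    rw [hs]
    have hσp : σ ^ p = 1 := by rw [← h.order]; exact pow_orderOf_eq_one σ
    rw [hσp]; rfl
  let ι0 : US S →* US (above K S) := ((jj F K).comp (US S).subtype).codRestrict _ (fun x => jj_mem_US.2 x.2)
  let ι : Additive (US S) →+ M := MonoidHom.toAdditive ι0
  have hιv : ∀ x, (((ι x).toMul : Kˣ) : K) = algebraMap F K ((x.toMul : Fˣ) : F) := fun x => rfl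
  have hι : Function.Injective ι := by
    intro x y hxy
    apply Additive.toMul.injective
    have := congrArg (fun t : M => ((t.toMul : Kˣ) : K)) hxy
    simp only [hιv] at this
    exact Subtype.ext (Units.ext ((algebraMap F K).injective this))
  have hfix : ∀ x : M, s x = x ↔ x ∈ ι.range := by
    intro x
    constructor
    · intro hx
      have h1 := hs 1 x
      rw [pow_one, pow_one, hx] at h1
      obtain ⟨y, hy⟩ := h.fixed h1.symm
      have hy0 : y ≠ 0 := by rintro rfl; rw [map_zero] at hy; exact (x.toMul : Kˣ).ne_zero hy.symm
      have hj : jj F K (Units.mk0 y hy0) = (x.toMul : Kˣ) := Units.ext hy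
      refine ⟨Additive.ofMul ⟨Units.mk0 y hy0, (jj_mem_US (K := K)).1 (by rw [hj]; exact x.toMul.2)⟩, ?_⟩
      apply hext
      exact hy
    · rintro ⟨y, rfl⟩
      apply hext
      have h1 := hs 1 (ι y)
      rw [pow_one, pow_one] at h1
      rw [h1, hιv, AlgEquiv.commutes]
  have hrM : Module.finrank ℤ M + 1 = (above K S).ncard + Fintype.card (InfinitePlace F) * p := by
    rw [US_rank hSK, inf_card h hpos]
  have hrA := US_rank hS
  have hac := above_card h hS
  set sp := {v ∈ S | a ∈ Pv p v}.ncard with hsp'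
  set r := Fintype.card (InfinitePlace F) with hr
  have hrV : Module.finrank ℤ (Additive (US S)) + (p - 1) * (r + sp) ≤ Module.finrank ℤ M := by
    obtain ⟨q, hq⟩ : ∃ q, p = q + 1 := ⟨p - 1, by have := hp.out.one_le; omega⟩
    have : p - 1 = q := by omega
    rw [this] at hac ⊢
    rw [hq] at hrM
    rw [mul_add]
    have e1 : r * (q + 1) = q * r + r := by ring
    omega
  have hVp : Nat.card {x : M // p • x = 0 ∧ N x = 0} = p := by
    haveI : NeZero p := ⟨hp.out.ne_zero⟩
    refine Eq.trans (Nat.card_congr ?_) (hζK.card_rootsOfUnity)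
    have hroot : ∀ x : Kˣ, x ^ p = 1 → ∃ y : Fˣ, jj F K y = x ∧ y ^ p = 1 := by
      intro x hx
      have hx' : (x : K) ^ p = 1 := by rw [← Units.val_pow_eq_pow_val, hx]; rfl
      obtain ⟨i, -, hi⟩ := hζK.eq_pow_of_pow_eq_one hx'
      have hz : ζ ≠ 0 := h.hζ.ne_zero hp.out.ne_zero
      refine ⟨(Units.mk0 ζ hz) ^ i, ?_, ?_⟩
      · ext
        simp [← hi]
      · ext
        simp [← pow_mul, mul_comm i p]
        rw [pow_mul, h.hζ.pow_eq_one, one_pow]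
    have hmem : ∀ x : Kˣ, x ^ p = 1 → x ∈ US (above K S) := by
      intro x hx w _
      apply root_val _ hp.out.ne_zero
      rw [← Units.val_pow_eq_pow_val, hx]; rfl
    have hmV : ∀ (x : Kˣ) (hx : x ^ p = 1), N (Additive.ofMul ⟨x, hmem x hx⟩ : M) = 0 := by
      intro x hx
      apply hext
      rw [hNv]
      obtain ⟨y, hy, hyp⟩ := hroot x hx
      show algebraMap F K (Algebra.norm F (x : K)) = 1
      rw [← hy]
      show algebraMap F K (Algebra.norm F (algebraMap F K (y : F))) = 1
      rw [Algebra.norm_algebraMap, h.hfin, ← Units.val_pow_eq_pow_val, hyp]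
      simp
    refine ⟨fun x => ⟨((x : M).toMul : Kˣ), ?_⟩, fun x => ⟨Additive.ofMul ⟨(x : Kˣ), hmem x ((mem_rootsOfUnity p _).1 x.2)⟩, ?_, hmV _ ((mem_rootsOfUnity p _).1 x.2)⟩, fun x => ?_, fun x => ?_⟩
    · rw [mem_rootsOfUnity]
      exact congrArg (fun t : M => (t.toMul : Kˣ)) x.2.1
    · apply hext
      have h1 := (mem_rootsOfUnity p _).1 x.2
      exact congrArg Units.val h1
    · rfl
    · rfl
  have hWp : (nsmulAddMonoidHom p : Additive (US S) →+ _).range.index = p ^ (S.ncard + r) := US_index h.hζ hS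
  obtain ⟨m1, m2⟩ := herbrand2 M (Additive (US S)) s N rfl hsp ι hι hfix (by
    intro x hx
    have h1 : Algebra.norm F ((x.toMul : Kˣ) : K) = 1 := by
      apply (algebraMap F K).injective
      rw [← hNv, hx, map_one]; rfl
    obtain ⟨y, hy, hyx⟩ := h90 h hp1 ha hcl x.toMul.2 h1
    refine ⟨Additive.ofMul ⟨y, hy⟩, ?_⟩
    apply Additive.toMul.injective
    apply Subtype.ext
    exact hyx) (r + sp) (S.ncard + r) hVp hWp (by omega)
  have hrel : ((US (above K S)).map (nrm F K)).relIndex (US S) = (N.range.toAddSubgroup.comap ι).index := by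
    rw [Subgroup.relIndex]
    have : (AddSubgroup.comap ι N.range.toAddSubgroup) = (((US (above K S)).map (nrm F K)).subgroupOf (US S)).toAddSubgroup := by
      ext x
      constructor
      · rintro ⟨y, hy⟩
        refine ⟨(y.toMul : Kˣ), y.toMul.2, ?_⟩
        have h1 := hNv y
        rw [hy, hιv] at h1
        exact Units.ext ((algebraMap F K).injective h1.symm)
      · rintro ⟨y, hy, hyx⟩
        refine ⟨Additive.ofMul ⟨y, hy⟩, ?_⟩
        apply hext
        rw [hNv, hιv]
        exact congrArg (fun t : Fˣ => algebraMap F K (t : F)) hyx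
    rw [this]
    rfl
  rw [hrel]
  refine ⟨m1, ?_⟩
  have hpr : 0 < p ^ r := pow_pos hp.out.pos _
  apply Nat.le_of_mul_le_mul_right _ hpr
  calc _ = (N.range.toAddSubgroup.comap ι).index * p ^ (r + sp + 1) := by ring
    _ ≤ _ := m2
    _ = _ := by ring
end
end Cft
end

section
open IsDedekindDomain NumberField WithZero Polynomial
namespace Cft
universe u
set_option linter.unusedSectionVars false
set_option linter.all false

section
variable {F : Type*} [Field F] [NumberField F]
variable {p : ℕ} [hp : Fact p.Prime] {ζ : F}

def Pos (φ : F →+* ℝ) : Subgroup Fˣ where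
  carrier := {x | 0 < φ x}
  mul_mem' := by
    intro a b ha hb
    simp only [Set.mem_setOf_eq, Units.val_mul, map_mul] at *
    positivity
  one_mem' := by simp
  inv_mem' := by
    intro a ha
    simp only [Set.mem_setOf_eq, Units.val_inv_eq_inv_val, map_inv₀] at *
    positivity

lemma Pos_index (φ : F →+* ℝ) : (Pos φ).index ≠ 0 ∧ (Pos φ).index ≤ 2 := by
  apply index_le_of_gen two_pos (-1 : Fˣ)
  · simp
  · intro x
    rcases lt_or_gt_of_ne (a := φ x) (b := 0) (by simp) with h | h
    · refine ⟨1, ?_⟩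
      change 0 < φ _
      simpa using h
    · exact ⟨0, by change 0 < φ _; simpa using h⟩

lemma real_inj : Function.Injective (fun φ : F →+* ℝ => InfinitePlace.mk (Complex.ofRealHom.comp φ)) := by
  intro φ ψ h
  have h2 : Complex.ofRealHom.comp φ = Complex.ofRealHom.comp ψ := by
    rcases InfinitePlace.mk_eq_iff.1 h with h | h
    · exact h
    · rw [← h]
      ext x
      simp [ComplexEmbedding.conjugate]
  ext x
  have := DFunLike.congr_fun h2 x
  simpa using this

instance real_finite : Finite (F →+* ℝ) := Finite.of_injective _ real_inj

lemma real_card : Nat.card (F →+* ℝ) ≤ InfinitePlace.nrRealPlaces F := by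
  classical
  have hr : ∀ φ : F →+* ℝ, (InfinitePlace.mk (Complex.ofRealHom.comp φ)).IsReal := fun φ =>
    ⟨_, by ext x; simp [ComplexEmbedding.conjugate], rfl⟩
  have := Nat.card_le_card_of_injective (β := {w : InfinitePlace F // w.IsReal}) (fun φ : F →+* ℝ => ⟨_, hr φ⟩)
    (by
      intro φ ψ h
      exact real_inj (Subtype.ext_iff.1 h))
  rwa [Nat.card_eq_fintype_card (α := {w : InfinitePlace F // w.IsReal})] at this

variable (p) in
def PS (S : Set (HeightOneSpectrum (𝓞 F))) : Subgroup Fˣ := (⨅ v : S, Pv p v.1) ⊓ ⨅ φ : F →+* ℝ, Pos φ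

lemma mem_PS {S : Set (HeightOneSpectrum (𝓞 F))} {x : Fˣ} :
    x ∈ PS p S ↔ (∀ v ∈ S, x ∈ Pv p v) ∧ ∀ φ : F →+* ℝ, 0 < φ x := by
  simp only [PS, Subgroup.mem_inf, Subgroup.mem_iInf, Subtype.forall]
  rfl

lemma exists_e (v : HeightOneSpectrum (𝓞 F)) : ∃ e : ℕ, v.valuation F (p : F) = exp (-(e : ℤ)) := by
  have h0 := val_p_ne (F := F) p v
  have h1 := val_nat_le (F := F) v p
  rw [← WithZero.exp_log h0] at h1 ⊢
  rw [← WithZero.exp_zero, WithZero.exp_le_exp] at h1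
  exact ⟨(-WithZero.log (v.valuation F (p : F))).toNat, by rw [Int.toNat_of_nonneg (by omega), neg_neg]⟩

lemma prod_norm_le {S : Finset (HeightOneSpectrum (𝓞 F))} (e : HeightOneSpectrum (𝓞 F) → ℕ)
    (he : ∀ v, v.valuation F (p : F) = exp (-(e v : ℤ))) :
    ∏ v ∈ S, (Nat.card (𝓞 F ⧸ v.asIdeal)) ^ e v ≤ p ^ Module.finrank ℚ F := by
  have h1 : ∏ v ∈ S, v.asIdeal ^ e v ∣ Ideal.span {((p : ℕ) : 𝓞 F)} := by
    apply Finset.prod_dvd_of_coprime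
    · intro v hv v' hv' hne
      haveI := v.isMaximal
      haveI := v'.isMaximal
      exact (Ideal.isCoprime_of_isMaximal (fun h => hne (HeightOneSpectrum.ext h))).pow
    · intro v hv
      rw [Ideal.dvd_span_singleton, ← val_le_pow_iff, ← he v]
      simp
  have h2 := Ideal.absNorm_dvd_absNorm_of_le (Ideal.dvd_iff_le.1 h1)
  rw [Ideal.absNorm_span_natCast, map_prod, RingOfIntegers.rank] at h2
  have h3 := Nat.le_of_dvd (pow_pos hp.out.pos _) h2
  simpa only [map_pow, Ideal.absNorm_apply, Submodule.cardQuot_apply] using h3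

theorem PS_index (hζ : IsPrimitiveRoot ζ p) {S : Set (HeightOneSpectrum (𝓞 F))} (hS : S.Finite) :
    (PS p S).index ≠ 0 ∧ (PS p S).index ≤ p ^ (2 * (S.ncard + Fintype.card (InfinitePlace F))) := by
  classical
  haveI := hS.fintype
  haveI := Fintype.ofFinite (F →+* ℝ)
  choose e he using exists_e (p := p) (F := F)
  refine ⟨Subgroup.index_inf_ne_zero (Subgroup.index_iInf_ne_zero fun v => (index_Pv_le hζ (he v.1)).1)
    (Subgroup.index_iInf_ne_zero fun φ => (Pos_index φ).1), ?_⟩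
  have h1 : (⨅ v : S, Pv (F := F) p v.1).index ≤ (p ^ 2) ^ S.ncard * p ^ Module.finrank ℚ F := by
    refine (Subgroup.index_iInf_le _).trans ?_
    refine (Finset.prod_le_prod' fun v _ => (index_Pv_le hζ (he v.1)).2).trans ?_
    rw [Finset.prod_mul_distrib]
    refine Nat.mul_le_mul ?_ ?_
    · simp
    · have := prod_norm_le (S := S.toFinset) e he
      refine le_trans (le_of_eq ?_) this
      exact Finset.prod_subtype (p := (· ∈ S)) S.toFinset (by simp) (fun v => Nat.card (𝓞 F ⧸ v.asIdeal) ^ e v) |>.symm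
  have h2 : (⨅ φ : F →+* ℝ, Pos φ).index ≤ p ^ InfinitePlace.nrRealPlaces F := by
    refine (Subgroup.index_iInf_le _).trans ?_
    have : ∀ φ : F →+* ℝ, (Pos φ).index ≤ p := fun φ => (Pos_index φ).2.trans hp.out.two_le
    refine (Finset.prod_le_prod' fun φ _ => this φ).trans ?_
    rw [Finset.prod_const, Finset.card_univ, ← Nat.card_eq_fintype_card]
    exact Nat.pow_le_pow_right hp.out.pos real_card
  refine (Subgroup.index_inf_le).trans ((Nat.mul_le_mul h1 h2).trans (le_of_eq ?_))
  rw [InfinitePlace.card_eq_nrRealPlaces_add_nrComplexPlaces, ← InfinitePlace.card_add_two_mul_card_eq_rank F,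
    ← pow_mul, ← pow_add, ← pow_add]
  congr 1
  ring

end
end Cft
end

section
open IsDedekindDomain NumberField WithZero Polynomial
namespace Cft
universe u
set_option linter.unusedSectionVars false
set_option linter.all false

section
open ENNReal Filter Topology

noncomputable def ZZ {X : Type*} (f : X → ℝ≥0∞) : ℝ≥0∞ := ∑' m : Multiset X, (m.map f).prod

lemma ZZ_inj {X Y : Type*} {f : X → ℝ≥0∞} {g : Y → ℝ≥0∞} (i : X → Y) (hi : Function.Injective i)
    (h : ∀ x, f x ≤ g (i x)) : ZZ f ≤ ZZ g := by
  unfold ZZ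
  refine le_trans ?_ (ENNReal.tsum_comp_le_tsum_of_injective (Multiset.map_injective hi) _)
  refine ENNReal.tsum_le_tsum fun m => ?_
  rw [Multiset.map_map]
  exact Multiset.prod_map_le_prod_map₀ _ _ (fun _ _ => zero_le) (fun x _ => h x)

lemma ZZ_sum {X Y : Type*} (f : X → ℝ≥0∞) (g : Y → ℝ≥0∞) : ZZ (Sum.elim f g) = ZZ f * ZZ g := by
  have hb : Function.Bijective (fun q : Multiset X × Multiset Y => q.1.map Sum.inl + q.2.map (Sum.inr : Y → X ⊕ Y)) := by
    classical
    constructor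
    · rintro ⟨a, b⟩ ⟨c, d⟩ h
      simp only at h
      refine Prod.ext ?_ ?_
      · ext x
        have := congrArg (Multiset.count (Sum.inl x)) h
        simpa [Multiset.count_map_eq_count' _ _ Sum.inl_injective, Multiset.count_eq_zero_of_notMem] using this
      · ext x
        have := congrArg (Multiset.count (Sum.inr x)) h
        simpa [Multiset.count_map_eq_count' _ _ Sum.inr_injective, Multiset.count_eq_zero_of_notMem] using this
    · intro m
      induction m using Multiset.induction_on with
      | empty => exact ⟨(0, 0), by simp⟩
      | cons x m ih =>
        obtain ⟨⟨a, b⟩, rfl⟩ := ih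
        rcases x with x | x
        · exact ⟨(x ::ₘ a, b), by simp⟩
        · exact ⟨(a, x ::ₘ b), by simp⟩
  unfold ZZ
  rw [← (Equiv.ofBijective _ hb).tsum_eq]
  simp only [Equiv.ofBijective_apply, Multiset.map_add, Multiset.prod_add, Multiset.map_map, Function.comp_def,
    Sum.elim_inl, Sum.elim_inr]
  rw [ENNReal.tsum_prod (f := fun a b => (Multiset.map f a).prod * (Multiset.map g b).prod)]
  simp_rw [ENNReal.tsum_mul_left, ENNReal.tsum_mul_right]

lemma ZZ_unit : ZZ (fun _ : Unit => (2⁻¹ : ℝ≥0∞)) ≤ 2 := by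
  unfold ZZ
  have hi : Function.Injective (Multiset.card : Multiset Unit → ℕ) := by
    intro a b h
    rw [Multiset.eq_replicate_of_mem (fun b _ => Subsingleton.elim b ()) (s := a),
      Multiset.eq_replicate_of_mem (fun b _ => Subsingleton.elim b ()) (s := b), h]
  have := ENNReal.tsum_comp_le_tsum_of_injective hi (fun n => (2⁻¹ : ℝ≥0∞) ^ n)
  simp only [Multiset.map_const', Multiset.prod_replicate]
  refine this.trans ?_
  rw [ENNReal.tsum_geometric, ENNReal.one_sub_inv_two, inv_inv]

lemma ZZ_fin (X : Type*) [Fintype X] : ∀ f : X → ℝ≥0∞, (∀ x, f x ≤ 2⁻¹) → ZZ f ≤ 2 ^ Fintype.card X := by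
  refine Fintype.induction_empty_option (P := fun X _ => ∀ f : X → ℝ≥0∞, (∀ x, f x ≤ 2⁻¹) → ZZ f ≤ 2 ^ Fintype.card X)
    ?_ ?_ ?_ X
  · intro α β _ e h f hf
    letI := Fintype.ofEquiv β e.symm
    rw [← Fintype.card_congr e]
    refine (ZZ_inj (g := f ∘ e) e.symm e.symm.injective (by simp)).trans ?_
    convert h (f ∘ e) (fun x => hf _)
  · intro f hf
    unfold ZZ
    rw [tsum_eq_single 0 (by intro m hm; exact absurd (Subsingleton.elim m 0) hm)]
    simp
  · intro α _ h f hf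
    have e := Equiv.optionEquivSumPUnit.{0} α
    refine (ZZ_inj (g := Sum.elim (fun x => f (some x)) (fun _ : Unit => 2⁻¹))
      (fun o => o.elim (Sum.inr ()) Sum.inl) ?_ ?_).trans ?_
    · rintro (_ | a) (_ | b) hab <;> simp_all
    · rintro (_ | a)
      · exact hf _
      · exact le_rfl
    · rw [ZZ_sum, Fintype.card_option, pow_succ]
      exact mul_le_mul' (h _ fun x => hf _) ZZ_unit

variable (K : Type*) [Field K] [NumberField K]

noncomputable abbrev NP (w : HeightOneSpectrum (𝓞 K)) : ℕ := Ideal.absNorm w.asIdeal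

noncomputable def wt (s : ℝ) (w : HeightOneSpectrum (𝓞 K)) : ℝ≥0∞ := ENNReal.ofReal ((NP K w : ℝ) ^ (-s))

noncomputable def mi (m : Multiset (HeightOneSpectrum (𝓞 K))) : Ideal (𝓞 K) := (m.map (fun w => w.asIdeal)).prod

lemma mi_inj : Function.Injective (mi K) := by
  intro m n h
  have key : ∀ m : Multiset (HeightOneSpectrum (𝓞 K)), UniqueFactorizationMonoid.normalizedFactors (mi K m) = m.map (fun w => w.asIdeal) := by
    intro m
    apply UniqueFactorizationMonoid.normalizedFactors_prod_of_prime
    intro p hp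
    obtain ⟨w, -, rfl⟩ := Multiset.mem_map.1 hp
    exact w.prime
  have h2 := key m
  rw [h, key n] at h2
  exact (Multiset.map_injective (fun a b h => HeightOneSpectrum.ext h) h2).symm

lemma mi_surj (I : Ideal (𝓞 K)) (hI : I ≠ 0) : ∃ m, mi K m = I := by
  have h1 := UniqueFactorizationMonoid.prod_normalizedFactors_eq hI
  rw [normalize_eq] at h1
  have h2 : ∀ J ∈ UniqueFactorizationMonoid.normalizedFactors I, ∃ w : HeightOneSpectrum (𝓞 K), w.asIdeal = J := by
    intro J hJ
    have := UniqueFactorizationMonoid.prime_of_normalized_factor J hJ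
    exact ⟨⟨J, Ideal.isPrime_of_prime this, this.ne_zero⟩, rfl⟩
  have h3 : ∀ t : Multiset (Ideal (𝓞 K)), (∀ J ∈ t, ∃ w : HeightOneSpectrum (𝓞 K), w.asIdeal = J) →
      ∃ m : Multiset (HeightOneSpectrum (𝓞 K)), m.map (fun w => w.asIdeal) = t := by
    intro t
    induction t using Multiset.induction_on with
    | empty => exact fun _ => ⟨0, by simp⟩
    | cons x t ih =>
      intro h
      obtain ⟨m, rfl⟩ := ih (fun J hJ => h J (Multiset.mem_cons_of_mem hJ))
      obtain ⟨w, rfl⟩ := h x (Multiset.mem_cons_self _ _)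
      exact ⟨w ::ₘ m, by simp⟩
  obtain ⟨m, hm⟩ := h3 _ h2
  exact ⟨m, by rw [mi, hm, h1]⟩

lemma mi_norm (m) : Ideal.absNorm (mi K m) ≠ 0 := by
  rw [Ne, Ideal.absNorm_eq_zero_iff]
  intro h
  have : (0 : Ideal (𝓞 K)) ∈ m.map (fun w => w.asIdeal) := Multiset.prod_eq_zero_iff.1 h
  obtain ⟨w, -, hw⟩ := Multiset.mem_map.1 this
  exact w.ne_bot hw

lemma wt_prod (s : ℝ) (m) : (m.map (wt K s)).prod = ENNReal.ofReal ((Ideal.absNorm (mi K m) : ℝ) ^ (-s)) := by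
  induction m using Multiset.induction_on with
  | empty => simp [mi]
  | cons x m ih =>
    have : mi K (x ::ₘ m) = x.asIdeal * mi K m := by simp [mi]
    rw [Multiset.map_cons, Multiset.prod_cons, ih, this, map_mul, wt, ← ENNReal.ofReal_mul (by positivity), Nat.cast_mul,
      Real.mul_rpow (by positivity) (by positivity)]

noncomputable def rr (s : ℝ) (n : ℕ) : ℝ := if n = 0 then 0 else (Nat.card {I : Ideal (𝓞 K) // Ideal.absNorm I = n} : ℝ) * (n : ℝ) ^ (-s)

lemma rr_nonneg (s n) : 0 ≤ rr K s n := by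
  unfold rr; split_ifs <;> positivity

lemma ZZ_wt (s : ℝ) : ZZ (wt K s) = ∑' n, ENNReal.ofReal (rr K s n) := by
  unfold ZZ
  simp_rw [wt_prod]
  rw [← (Equiv.sigmaFiberEquiv (fun m => Ideal.absNorm (mi K m))).tsum_eq]
  refine (ENNReal.tsum_sigma (fun n (m : {m // Ideal.absNorm (mi K m) = n}) => ENNReal.ofReal ((Ideal.absNorm (mi K m.1) : ℝ) ^ (-s)))).trans ?_
  congr 1
  ext n
  have : ∀ m : {m // Ideal.absNorm (mi K m) = n}, ENNReal.ofReal ((Ideal.absNorm (mi K m.1) : ℝ) ^ (-s)) = ENNReal.ofReal ((n : ℝ) ^ (-s)) := by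
    rintro ⟨m, rfl⟩; rfl
  simp_rw [this]
  unfold rr
  split_ifs with hn
  · subst hn
    haveI : IsEmpty {m // Ideal.absNorm (mi K m) = 0} := ⟨fun m => mi_norm K m.1 m.2⟩
    simp
  · rw [ENNReal.tsum_const]
    have e : {m // Ideal.absNorm (mi K m) = n} ≃ {I : Ideal (𝓞 K) // Ideal.absNorm I = n} := by
      refine Equiv.ofBijective (fun m => ⟨mi K m.1, m.2⟩) ⟨?_, ?_⟩
      · intro a b h
        exact Subtype.ext (mi_inj K (Subtype.ext_iff.1 h))
      · rintro ⟨I, rfl⟩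
        obtain ⟨m, hm⟩ := mi_surj K I (by rintro rfl; simp at hn)
        exact ⟨⟨m, by rw [hm]⟩, Subtype.ext hm⟩
    haveI : Finite {I : Ideal (𝓞 K) // Ideal.absNorm I = n} := Ideal.finite_setOfPred_absNorm_eq n
    rw [ENat.card_congr e, ENNReal.ofReal_mul (by positivity), ENNReal.ofReal_natCast]
    congr 1
    rw [ENat.card_eq_coe_natCard]
    rfl

lemma zeta_eq (s : ℝ) : dedekindZeta K s = ((∑' n, rr K s n : ℝ) : ℂ) := by
  rw [Complex.ofReal_tsum]
  unfold dedekindZeta LSeries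
  congr 1
  ext n
  rw [LSeries.term_def]
  unfold rr
  split_ifs with h
  · simp
  · rw [Complex.ofReal_mul, Complex.ofReal_cpow (by positivity), Complex.ofReal_neg, Complex.cpow_neg]
    simp [div_eq_mul_inv]

lemma zeta_lim : Tendsto (fun s : ℝ => (s - 1) * ∑' n, rr K s n) (𝓝[>] 1) (𝓝 (dedekindZeta_residue K)) := by
  have := tendsto_sub_one_mul_dedekindZeta_nhdsGT K
  simp_rw [zeta_eq] at this
  have h2 := (Complex.continuous_re.tendsto _).comp this
  refine (h2.congr fun s => ?_)
  simp only [Function.comp_apply]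
  rw [← Complex.ofReal_one, ← Complex.ofReal_sub, ← Complex.ofReal_mul, Complex.ofReal_re]

lemma ZZ_lim : Tendsto (fun s : ℝ => ENNReal.ofReal (s - 1) * ZZ (wt K s)) (𝓝[>] 1) (𝓝 (ENNReal.ofReal (dedekindZeta_residue K))) := by
  have h := zeta_lim K
  have h1 := (ENNReal.continuous_ofReal.tendsto _).comp h
  refine h1.congr' ?_
  filter_upwards [h.eventually (lt_mem_nhds (dedekindZeta_residue_pos K)), self_mem_nhdsWithin] with s hs hs1
  have hsum : Summable (rr K s) := by
    by_contra hc
    rw [tsum_eq_zero_of_not_summable hc, mul_zero] at hs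
    exact lt_irrefl _ hs
  simp only [Function.comp_apply]
  rw [ENNReal.ofReal_mul (by simp at hs1; linarith), ENNReal.ofReal_tsum_of_nonneg (rr_nonneg K s) hsum, ZZ_wt]

end
end Cft
end

section
open IsDedekindDomain NumberField WithZero Polynomial
namespace Cft
universe u
set_option linter.unusedSectionVars false
set_option linter.all false

section
open ENNReal Filter Topology

lemma norm_split {K M : Type*} [Field K] [NumberField K] [Field M] [NumberField M] [Algebra K M] {p : ℕ}
    (hfin : Module.finrank K M = p) (v : HeightOneSpectrum (𝓞 K)) (f : Fin p → HeightOneSpectrum (𝓞 M))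
    (hf : Function.Injective f) (hu : ∀ i, un K (f i) = v) (i : Fin p) : NP M (f i) = NP K v := by
  classical
  haveI := v.isMaximal
  have hs := Ideal.sum_ramification_inertia (𝓞 M) K M (p := v.asIdeal) v.ne_bot
  have hl : ∀ i, (f i).asIdeal.LiesOver v.asIdeal := fun i => ⟨by rw [← hu i]; rfl⟩
  have hmem : ∀ i, (f i).asIdeal ∈ IsDedekindDomain.primesOverFinset v.asIdeal (𝓞 M) := fun i =>
    (IsDedekindDomain.mem_primesOverFinset_iff v.ne_bot _).mpr ⟨(f i).isPrime, hl i⟩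
  set g : Fin p ↪ Ideal (𝓞 M) := ⟨fun i => (f i).asIdeal, fun a b h => hf (HeightOneSpectrum.ext h)⟩ with hg
  set T := IsDedekindDomain.primesOverFinset v.asIdeal (𝓞 M)
  set t : Ideal (𝓞 M) → ℕ := fun P => v.asIdeal.ramificationIdx' P * v.asIdeal.inertiaDeg' P with ht
  have hsub : Finset.univ.map g ⊆ T := by
    intro P hP
    obtain ⟨i, -, rfl⟩ := Finset.mem_map.1 hP
    exact hmem i
  have hpos : ∀ i, 1 ≤ t (f i).asIdeal := by
    intro i
    haveI := hl i
    haveI := (f i).isPrime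
    refine Nat.one_le_iff_ne_zero.2 (mul_ne_zero ?_ ?_)
    · exact Ideal.IsDedekindDomain.ramificationIdx'_ne_zero_of_liesOver _ v.ne_bot
    · exact Ideal.inertiaDeg'_ne_zero _ _
  have h1 : ∑ i, t (f i).asIdeal ≤ p := by
    refine le_trans ?_ (hs.trans hfin).le
    exact (Finset.sum_map Finset.univ g t).symm.le.trans (Finset.sum_le_sum_of_subset hsub)
  have h2 : t (f i).asIdeal = 1 := by
    by_contra hne
    have : ∑ i : Fin p, 1 < ∑ i, t (f i).asIdeal :=
      Finset.sum_lt_sum (fun i _ => hpos i) ⟨i, Finset.mem_univ _, lt_of_le_of_ne (hpos i) (Ne.symm hne)⟩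
    simp at this
    omega
  haveI := hl i
  have h3 := Ideal.absNorm_eq_pow_inertiaDeg'_of_liesOver (f i).asIdeal v.asIdeal v.isPrime v.ne_bot
  rw [NP, h3, Nat.eq_one_of_mul_eq_one_left h2, pow_one]

lemma wt_le_half {K : Type*} [Field K] [NumberField K] {s : ℝ} (hs : 1 < s) (w : HeightOneSpectrum (𝓞 K)) : wt K s w ≤ 2⁻¹ := by
  have h2 : 2 ≤ NP K w := by
    have h0 : NP K w ≠ 0 := by rw [NP, Ne, Ideal.absNorm_eq_zero_iff]; exact w.ne_bot
    have h1 : NP K w ≠ 1 := by rw [NP, Ne, Ideal.absNorm_eq_one_iff]; exact w.isPrime.ne_top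
    omega
  have h3 : (2 : ℝ) ≤ NP K w := by exact_mod_cast h2
  have : ((NP K w : ℝ) ^ (-s)) ≤ 2⁻¹ := by
    rw [Real.rpow_neg (by positivity)]
    apply inv_anti₀ (by norm_num)
    calc (2 : ℝ) ≤ NP K w := h3
      _ = (NP K w : ℝ) ^ (1 : ℝ) := by simp
      _ ≤ _ := Real.rpow_le_rpow_of_exponent_le (by linarith) hs.le
  unfold wt
  refine (ENNReal.ofReal_le_ofReal this).trans ?_
  rw [ENNReal.ofReal_inv_of_pos (by norm_num)]
  simp

theorem nonsplit {K : Type u} [Field K] [NumberField K] {p : ℕ} [hp : Fact p.Prime] {ζ : K} (hζ : IsPrimitiveRoot ζ p) {c : Kˣ}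
    (hc : ∀ y : K, y ^ p ≠ c) {B : Set (HeightOneSpectrum (𝓞 K))} (hB : B.Finite) : ∃ w ∉ B, c ∉ Pv p w := by
  by_contra! hcon
  obtain ⟨M, _, _, β, σ, hk⟩ := exists_kum hζ hc
  haveI := hk.fd
  haveI : NumberField M := NumberField.of_module_finite K M
  classical
  haveI := hB.fintype
  have hex : ∀ w : {w // w ∉ B}, ∃ q : HeightOneSpectrum (𝓞 M) × HeightOneSpectrum (𝓞 M), q.1 ≠ q.2 ∧ un K q.1 = w.1 ∧ un K q.2 = w.1
      ∧ NP M q.1 = NP K w.1 ∧ NP M q.2 = NP K w.1 := by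
    intro w
    obtain ⟨f, hf, hu⟩ := split_primes hk (hcon w.1 w.2)
    have h2 := hp.out.two_le
    have hn := norm_split hk.hfin w.1 f hf hu
    refine ⟨(f ⟨0, by omega⟩, f ⟨1, by omega⟩), ?_, hu _, hu _, hn _, hn _⟩
    intro h
    have := hf h
    simp at this
  choose q hq using hex
  have hgood : ∀ s : ℝ, ZZ (fun w : {w // w ∉ B} => wt K s w.1) * ZZ (fun w : {w // w ∉ B} => wt K s w.1) ≤ ZZ (wt M s) := by
    intro s
    rw [← ZZ_sum]
    refine ZZ_inj (Sum.elim (fun w => (q w).1) (fun w => (q w).2)) ?_ ?_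
    · rintro (a | a) (b | b) h
      · simp only [Sum.elim_inl] at h
        have : a = b := Subtype.ext (by rw [← (hq a).2.1, h, (hq b).2.1])
        rw [this]
      · simp only [Sum.elim_inl, Sum.elim_inr] at h
        have : a = b := Subtype.ext (by rw [← (hq a).2.1, h, (hq b).2.2.1])
        subst this
        exact absurd h (hq a).1
      · simp only [Sum.elim_inl, Sum.elim_inr] at h
        have : a = b := Subtype.ext (by rw [← (hq a).2.2.1, h, (hq b).2.1])
        subst this
        exact absurd h.symm (hq a).1
      · simp only [Sum.elim_inr] at h
        have : a = b := Subtype.ext (by rw [← (hq a).2.2.1, h, (hq b).2.2.1])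
        rw [this]
    · rintro (a | a)
      · simp only [Sum.elim_inl, wt]
        rw [(hq a).2.2.2.1]
      · simp only [Sum.elim_inr, wt]
        rw [(hq a).2.2.2.2]
  have hall : ∀ s : ℝ, 1 < s → ZZ (wt K s) ≤ 2 ^ Fintype.card {w // w ∈ B} * ZZ (fun w : {w // w ∉ B} => wt K s w.1) := by
    intro s hs
    refine le_trans ?_ (mul_le_mul' (ZZ_fin {w // w ∈ B} (fun w => wt K s w.1) (fun w => wt_le_half hs w.1)) le_rfl)
    rw [← ZZ_sum]
    refine ZZ_inj (fun w => if h : w ∈ B then Sum.inl ⟨w, h⟩ else Sum.inr ⟨w, h⟩) ?_ ?_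
    · intro a b h
      simp only at h
      split_ifs at h <;> simp_all
    · intro w
      split_ifs <;> simp
  set n := Fintype.card {w // w ∈ B}
  have hle : ∀ᶠ s : ℝ in 𝓝[>] 1, (ENNReal.ofReal (s - 1) * ZZ (wt K s)) * (ENNReal.ofReal (s - 1) * ZZ (wt K s)) ≤
      (2 ^ n * 2 ^ n * ENNReal.ofReal (s - 1)) * (ENNReal.ofReal (s - 1) * ZZ (wt M s)) := by
    filter_upwards [self_mem_nhdsWithin] with s hs
    have h1 := hall s hs
    have h2 := hgood s
    set G := ZZ (fun w : {w // w ∉ B} => wt K s w.1)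
    set t := ENNReal.ofReal (s - 1)
    calc (t * ZZ (wt K s)) * (t * ZZ (wt K s)) ≤ (t * (2 ^ n * G)) * (t * (2 ^ n * G)) := by gcongr
      _ = (2 ^ n * 2 ^ n * t) * (t * (G * G)) := by ring
      _ ≤ _ := by gcongr
  have ht : Tendsto (fun s : ℝ => ENNReal.ofReal (s - 1)) (𝓝[>] 1) (𝓝 0) := by
    have : Tendsto (fun s : ℝ => s - 1) (𝓝[>] 1) (𝓝 (1 - 1)) :=
      ((continuous_id.sub continuous_const).tendsto 1).mono_left nhdsWithin_le_nhds
    rw [sub_self] at this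
    have h := (ENNReal.continuous_ofReal.tendsto _).comp this
    rwa [ENNReal.ofReal_zero] at h
  have hK := ZZ_lim K
  have hM := ZZ_lim M
  have hl := ENNReal.Tendsto.mul hK (Or.inr ENNReal.ofReal_ne_top) hK (Or.inr ENNReal.ofReal_ne_top)
  have hc' : (2 ^ n * 2 ^ n : ℝ≥0∞) ≠ ⊤ := ENNReal.mul_ne_top (by simp) (by simp)
  have hr0 := ENNReal.Tendsto.const_mul ht (a := 2 ^ n * 2 ^ n) (Or.inr hc')
  rw [mul_zero] at hr0
  have hr := ENNReal.Tendsto.mul hr0 (Or.inr ENNReal.ofReal_ne_top) hM (Or.inr (by simp))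
  rw [zero_mul] at hr
  have := le_of_tendsto_of_tendsto hl hr hle
  have h3 : ENNReal.ofReal (dedekindZeta_residue K) ≠ 0 := by
    simp [dedekindZeta_residue_pos K]
  simp [h3] at this
end
end Cft
end

section
open IsDedekindDomain NumberField WithZero Polynomial
namespace Cft
universe u
set_option linter.unusedSectionVars false
set_option linter.all false

section
variable {F : Type u} [Field F] [NumberField F] {p : ℕ} [hp : Fact p.Prime] {ζ : F}

lemma pick (hζ : IsPrimitiveRoot ζ p) {S : Set (HeightOneSpectrum (𝓞 F))} (hS : S.Finite)
    (hp1 : ∀ v ∉ S, v.valuation F (p : F) = 1) {a c : Fˣ} (ha : ∀ y : F, y ^ p ≠ a) (haS : a ∈ US S) (hcS : c ∈ US S)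
    (hc : ∀ j : ℕ, ∀ y : F, y ≠ 0 → (c : F) ≠ a ^ j * y ^ p) {B : Set (HeightOneSpectrum (𝓞 F))} (hB : B.Finite) :
    ∃ v, v ∉ S ∧ v ∉ B ∧ a ∈ Pv p v ∧ c ∉ Pv p v := by
  obtain ⟨K, _, _, α, σ, hk⟩ := exists_kum hζ ha
  haveI := hk.fd
  haveI := hk.gal
  haveI : NumberField K := NumberField.of_module_finite F K
  have hζK : IsPrimitiveRoot (algebraMap F K ζ) p := hζ.map_of_injective (algebraMap F K).injective
  have hcK : ∀ y : K, y ^ p ≠ (jj F K c : Kˣ) := by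
    intro y hy
    obtain ⟨j, z, hz, h⟩ := hk.kummer (c := c) c.ne_zero (γ := y) hy
    exact hc j z hz h
  obtain ⟨w, hw, hcw⟩ := nonsplit hζK hcK (above_finite (F := F) (K := K) (hS.union hB))
  have hw' : un F w ∉ S ∪ B := hw
  rw [Set.mem_union, not_or] at hw'
  have hcv : c ∉ Pv p (un F w) := fun h => hcw (Pv_map w h)
  refine ⟨un F w, hw'.1, hw'.2, ?_, hcv⟩
  by_contra hav
  obtain ⟨j, hj⟩ := tame_gen hζ (y := 1) (z := 1) (hp1 _ hw'.1) (by simpa using haS _ hw'.1) (by simpa using hcS _ hw'.1) hav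
  have h1 := Pv_map (K := K) w hj
  rw [map_mul, map_zpow] at h1
  have h2 : Units.map (algebraMap F K).toMonoidHom a ∈ Pv p w := by
    have : Units.map (algebraMap F K).toMonoidHom a = (Units.mk0 α hk.α_ne) ^ p := by
      ext; simp [hk.hα]
    rw [this]; exact pow_mem_Pv _
  have h3 := mul_mem h1 (inv_mem (zpow_mem h2 j))
  rw [mul_inv_cancel_right] at h3
  exact hcw h3

noncomputable abbrev HT (p : ℕ) [Fact p.Prime] (S : Set (HeightOneSpectrum (𝓞 F))) (T : Finset (HeightOneSpectrum (𝓞 F))) : Subgroup (US S) :=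
  ⨅ v ∈ T, (Pv p v).comap (US S).subtype

lemma mem_HT {S : Set (HeightOneSpectrum (𝓞 F))} {T : Finset (HeightOneSpectrum (𝓞 F))} {x : US S} :
    x ∈ HT p S T ↔ ∀ v ∈ T, (x : Fˣ) ∈ Pv p v := by
  simp [HT, Subgroup.mem_iInf, Subgroup.mem_subgroupOf]

lemma Q_index (hζ : IsPrimitiveRoot ζ p) {S : Set (HeightOneSpectrum (𝓞 F))} (hS : S.Finite) (a : US S) :
    p ^ (S.ncard + Fintype.card (InfinitePlace F)) ≤ p * (Subgroup.zpowers a ⊔ (powMonoidHom p : US S →* US S).range).index := by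
  set R := (powMonoidHom p : US S →* US S).range with hR
  set Q := Subgroup.zpowers a ⊔ R with hQ
  have hle : R ≤ Q := le_sup_right
  have haQ : a ∈ Q := Subgroup.mem_sup_left (Subgroup.mem_zpowers a)
  have h1 := Subgroup.relIndex_mul_index hle
  rw [US_index hζ hS] at h1
  rw [← h1]
  refine Nat.mul_le_mul_right _ ?_
  refine (index_le_of_gen (Q := Q) (R := R.subgroupOf Q) hp.out.pos ⟨a, haQ⟩ ?_ ?_).2
  · rw [Subgroup.mem_subgroupOf]
    exact ⟨a, rfl⟩
  · rintro ⟨x, hx⟩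
    obtain ⟨y, hy, z, hz, rfl⟩ := Subgroup.mem_sup.1 hx
    obtain ⟨k, rfl⟩ := Subgroup.mem_zpowers_iff.1 hy
    refine ⟨-k, ?_⟩
    rw [Subgroup.mem_subgroupOf]
    simp only [Subgroup.coe_mul, SubgroupClass.coe_zpow]
    rw [mul_comm (a ^ k), mul_assoc, ← zpow_add, add_neg_cancel, zpow_zero, mul_one]
    exact hz

theorem exists_T (hζ : IsPrimitiveRoot ζ p) {S : Set (HeightOneSpectrum (𝓞 F))} (hS : S.Finite)
    (hp1 : ∀ v ∉ S, v.valuation F (p : F) = 1) {a : Fˣ} (ha : ∀ y : F, y ^ p ≠ a) (haS : a ∈ US S) :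
    ∀ k : ℕ, k + 1 ≤ S.ncard + Fintype.card (InfinitePlace F) → ∃ T : Finset (HeightOneSpectrum (𝓞 F)),
      T.card = k ∧ (∀ v ∈ T, v ∉ S) ∧ (∀ v ∈ T, a ∈ Pv p v) ∧
      (∀ t : HeightOneSpectrum (𝓞 F) → Fˣ, (∀ v ∈ T, v.valuation F (t v : F) = 1) → ∃ u ∈ US S, ∀ v ∈ T, u * t v ∈ Pv p v) ∧
      (HT p S T).index ≠ 0 ∧ (HT p S T).index ≤ p ^ k := by
  classical
  intro k
  induction k with
  | zero =>
    intro _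
    refine ⟨∅, rfl, by simp, by simp, fun t _ => ⟨1, one_mem _, by simp⟩, ?_⟩
    have : HT p S ∅ = ⊤ := by
      rw [eq_top_iff]; intro x _; rw [mem_HT]; simp
    rw [this]; simp
  | succ k ih =>
    intro hk
    obtain ⟨T, hT, hTS, hTa, hTs, hT0, hTi⟩ := ih (by omega)
    have hex : ∃ c : US S, c ∈ HT p S T ∧ c ∉ Subgroup.zpowers (⟨a, haS⟩ : US S) ⊔ (powMonoidHom p : US S →* US S).range := by
      by_contra! hcon
      have h1 := Nat.le_of_dvd (Nat.pos_of_ne_zero hT0) (Subgroup.index_dvd_of_le (H := HT p S T) (fun c hc => hcon c hc))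
      have h2 := Q_index hζ hS (⟨a, haS⟩ : US S)
      have h3 : p ^ (k + 1 + 1) ≤ p * p ^ k := (Nat.pow_le_pow_right hp.out.pos hk).trans (h2.trans (Nat.mul_le_mul_left _ (h1.trans hTi)))
      rw [← pow_succ'] at h3
      have := (Nat.pow_le_pow_iff_right hp.out.one_lt).1 h3
      omega
    obtain ⟨⟨c, hcS⟩, hcT, hcQ⟩ := hex
    rw [mem_HT] at hcT
    have hc : ∀ j : ℕ, ∀ y : F, y ≠ 0 → (c : F) ≠ a ^ j * y ^ p := by
      intro j y hy h
      apply hcQ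
      have hyS : Units.mk0 y hy ∈ US S := by
        intro v hv
        have h1 := hcS v hv
        have h2 := haS v hv
        rw [h, map_mul, map_pow, h2, one_pow, one_mul, map_pow] at h1
        exact (pow_eq_one_iff.1 h1).resolve_right hp.out.ne_zero
      have : (⟨c, hcS⟩ : US S) = ⟨a, haS⟩ ^ j * ⟨Units.mk0 y hy, hyS⟩ ^ p := by
        ext; simp [h]
      rw [this]
      exact mul_mem (Subgroup.mem_sup_left (Subgroup.npow_mem_zpowers _ _)) (Subgroup.mem_sup_right ⟨_, rfl⟩)
    obtain ⟨v, hvS, hvT, hav, hcv⟩ := pick hζ hS hp1 ha haS hcS hc T.finite_toSet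
    have hvT' : v ∉ T := by simpa using hvT
    have hgen : ∀ x : Fˣ, v.valuation F (x : F) = 1 → ∃ j : ℤ, x * c ^ j ∈ Pv p v := fun x hx =>
      tame_gen hζ (y := 1) (z := 1) (hp1 _ hvS) (by simpa using hcS _ hvS) (by simpa using hx) hcv
    refine ⟨insert v T, by rw [Finset.card_insert_of_notMem hvT', hT], ?_, ?_, ?_, ?_⟩
    · intro v' hv'
      rcases Finset.mem_insert.1 hv' with rfl | h
      · exact hvS
      · exact hTS _ h
    · intro v' hv'
      rcases Finset.mem_insert.1 hv' with rfl | h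
      · exact hav
      · exact hTa _ h
    · intro t ht
      obtain ⟨u, huS, hu⟩ := hTs t (fun v' hv' => ht v' (Finset.mem_insert_of_mem hv'))
      obtain ⟨j, hj⟩ := hgen (u * t v) (by
        rw [Units.val_mul, map_mul, huS v hvS, ht v (Finset.mem_insert_self _ _), one_mul])
      refine ⟨u * c ^ j, mul_mem huS (zpow_mem hcS j), ?_⟩
      intro v' hv'
      rw [mul_right_comm]
      rcases Finset.mem_insert.1 hv' with rfl | h
      · exact hj
      · exact mul_mem (hu _ h) (zpow_mem (hcT _ h) j)
    · have hle : HT p S (insert v T) ≤ HT p S T := by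
        intro x hx
        rw [mem_HT] at hx ⊢
        exact fun v' hv' => hx v' (Finset.mem_insert_of_mem hv')
      have hc' : (⟨c, hcS⟩ : US S) ∈ HT p S T := mem_HT.2 hcT
      have hmem : ∀ x : US S, x ∈ HT p S T → (x : Fˣ) ∈ Pv p v → x ∈ HT p S (insert v T) := by
        intro x hx hxv
        rw [mem_HT] at hx ⊢
        intro v' hv'
        rcases Finset.mem_insert.1 hv' with rfl | h
        · exact hxv
        · exact hx _ h
      have h1 := Subgroup.relIndex_mul_index hle
      have h2 : (HT p S (insert v T)).relIndex (HT p S T) ≠ 0 ∧ (HT p S (insert v T)).relIndex (HT p S T) ≤ p := by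
        refine index_le_of_gen (Q := HT p S T) (R := (HT p S (insert v T)).subgroupOf (HT p S T)) hp.out.pos ⟨⟨c, hcS⟩, hc'⟩ ?_ ?_
        · rw [Subgroup.mem_subgroupOf]
          exact hmem _ (pow_mem hc' p) (pow_mem_Pv c)
        · rintro ⟨⟨x, hxS⟩, hx⟩
          obtain ⟨j, hj⟩ := hgen x (hxS v hvS)
          refine ⟨j, ?_⟩
          rw [Subgroup.mem_subgroupOf]
          exact hmem _ (mul_mem hx (zpow_mem hc' j)) (by simpa using hj)
      rw [← h1, pow_succ']
      exact ⟨mul_ne_zero h2.1 hT0, Nat.mul_le_mul h2.2 hTi⟩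
end
end Cft
end

section
open IsDedekindDomain NumberField WithZero Polynomial
namespace Cft
universe u
set_option linter.unusedSectionVars false
set_option linter.all false

section
lemma relIndex_surj {G : Type*} [CommGroup G] {ι : Type*} (U : Subgroup G) (T : Finset ι) (N : ι → Subgroup G)
    (h : ∀ t : ι → G, ∃ x ∈ U, ∀ i ∈ T, x * t i ∈ N i) : (⨅ i ∈ T, N i).relIndex U = ∏ i ∈ T, (N i).index := by
  classical
  let f : U →* (∀ i : T, G ⧸ N i.1) := Pi.monoidHom fun i => (QuotientGroup.mk' (N i.1)).comp U.subtype
  have hker : f.ker = (⨅ i ∈ T, N i).subgroupOf U := by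
    ext x
    rw [MonoidHom.mem_ker, Subgroup.mem_subgroupOf]
    simp only [Subgroup.mem_iInf]
    constructor
    · intro hx i hi
      have := congrFun hx ⟨i, hi⟩
      exact (QuotientGroup.eq_one_iff _).1 this
    · intro hx
      funext i
      exact (QuotientGroup.eq_one_iff _).2 (hx i.1 i.2)
  have hsurj : Function.Surjective f := by
    intro q
    have : ∀ i : T, ∃ g : G, QuotientGroup.mk g = q i := fun i => QuotientGroup.mk_surjective (q i)
    choose g hg using this
    obtain ⟨x, hx, hxi⟩ := h (fun i => if hi : i ∈ T then (g ⟨i, hi⟩)⁻¹ else 1)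
    refine ⟨⟨x, hx⟩, ?_⟩
    funext i
    have h1 := hxi i.1 i.2
    rw [dif_pos i.2] at h1
    rw [← hg i]
    change (QuotientGroup.mk x : G ⧸ N i.1) = QuotientGroup.mk (g i)
    rw [eq_comm, QuotientGroup.eq, mul_comm]
    exact h1
  rw [Subgroup.relIndex, ← hker, Subgroup.index_ker, MonoidHom.range_eq_top.2 hsurj, Nat.card_congr Subgroup.topEquiv.toEquiv,
    Nat.card_pi]
  exact Finset.prod_coe_sort T (fun i => (N i).index)

variable {F : Type u} [Field F] [NumberField F] {p : ℕ} [hp : Fact p.Prime] {ζ : F}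

lemma Pv_index_ne (hζ : IsPrimitiveRoot ζ p) (v : HeightOneSpectrum (𝓞 F)) : (Pv p v).index ≠ 0 := by
  obtain ⟨e, he⟩ := exists_e (p := p) v
  exact (index_Pv_le hζ he).1

lemma Nv_index_ne (hζ : IsPrimitiveRoot ζ p) (v : HeightOneSpectrum (𝓞 F)) (a : Fˣ) : (Nv p v a).index ≠ 0 := by
  have h := Subgroup.index_dvd_of_le (Pv_le_Nv (p := p) (v := v) a)
  intro h0
  rw [h0, zero_dvd_iff] at h
  exact Pv_index_ne hζ v h

lemma Nv_index_ge (hζ : IsPrimitiveRoot ζ p) (v : HeightOneSpectrum (𝓞 F)) {a : Fˣ} (h : Nv p v a ≠ ⊤) : p ≤ (Nv p v a).index :=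
  index_ge_of_ne_top (fun y => pow_mem_Nv a y) h (Nv_index_ne hζ v a)

lemma lemmaA' (hζ : IsPrimitiveRoot ζ p) {V : Set (HeightOneSpectrum (𝓞 F))} (hV : V.Finite)
    (hp1 : ∀ v ∉ V, v.valuation F (p : F) = 1) (hcl : ClS V) {b : Fˣ} (hb : ∀ y : F, y ^ p ≠ b) (hbV : b ∈ US V)
    (hpos : ∀ φ : F →+* ℝ, 0 < φ b) : ∃ R : Subgroup Fˣ, R ≤ Nm p b ∧ R ≤ US V ∧ R.relIndex (US V) ≠ 0 ∧
      R.relIndex (US V) * p ≤ p ^ {v ∈ V | b ∉ Pv p v}.ncard := by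
  obtain ⟨K, _, _, α, σ, hk⟩ := exists_kum hζ hb
  haveI := hk.fd
  haveI : NumberField K := NumberField.of_module_finite F K
  obtain ⟨h1, h2⟩ := lemmaA hk hV hp1 hbV hcl hpos
  refine ⟨(US (above K V)).map (nrm F K) ⊓ US V, ?_, inf_le_right, ?_, ?_⟩
  · rintro x ⟨⟨y, hy, rfl⟩, -⟩
    exact hk.mem_Nm.2 ⟨y, rfl⟩
  · rwa [Subgroup.inf_relIndex_right]
  · rw [Subgroup.inf_relIndex_right]
    have h3 : V.ncard = {v ∈ V | b ∈ Pv p v}.ncard + {v ∈ V | b ∉ Pv p v}.ncard := by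
      rw [← Set.ncard_union_eq ?_ (hV.subset (Set.sep_subset _ _)) (hV.subset (Set.sep_subset _ _))]
      · congr 1
        ext v
        simp only [Set.mem_union, Set.mem_sep_iff]
        tauto
      · rw [Set.disjoint_left]
        rintro v ⟨_, h⟩ ⟨_, h'⟩
        exact h' h
    rw [h3, pow_add, pow_add, pow_one] at h2
    have h4 : 0 < p ^ {v ∈ V | b ∈ Pv p v}.ncard := pow_pos hp.out.pos _
    refine Nat.le_of_mul_le_mul_left ?_ h4
    calc _ = _ := by ring
      _ ≤ _ := h2

/-- every element of `U_V` that is locally a power on `S` and positive is a power -/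
lemma claimIII (hζ : IsPrimitiveRoot ζ p) {S : Set (HeightOneSpectrum (𝓞 F))} (hS : S.Finite)
    (hp1 : ∀ v ∉ S, v.valuation F (p : F) = 1) (hcl : ClS S) {T : Finset (HeightOneSpectrum (𝓞 F))}
    (hsurj : ∀ t : HeightOneSpectrum (𝓞 F) → Fˣ, ∃ u ∈ US (S ∪ T), ∀ v ∈ T, u * t v ∈ Pv p v)
    (hTS : ∀ v ∈ T, v ∉ S) {b : Fˣ} (hbU : b ∈ US (S ∪ T)) (hb : b ∈ PS p S) : ∃ y : F, y ^ p = b := by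
  classical
  by_contra! hcon
  obtain ⟨hb1, hb2⟩ := mem_PS.1 hb
  obtain ⟨R, hRN, hRU, hR0, hR⟩ := lemmaA' hζ (hS.union T.finite_toSet) (fun v hv => hp1 v (fun h => hv (Or.inl h)))
    (hcl.mono Set.subset_union_left) hcon hbU hb2
  have hset : {v ∈ S ∪ T | b ∉ Pv p v} = ((T.filter (fun v => b ∉ Pv p v) : Finset _) : Set (HeightOneSpectrum (𝓞 F))) := by
    ext v
    simp only [Set.mem_sep_iff, Set.mem_union, Finset.coe_filter, Finset.mem_coe, Set.mem_setOf_eq]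
    constructor
    · rintro ⟨h | h, h2⟩
      · exact absurd (hb1 v h) h2
      · exact ⟨h, h2⟩
    · rintro ⟨h, h2⟩
      exact ⟨Or.inr h, h2⟩
  rw [hset, Set.ncard_coe_finset] at hR
  set T' := T.filter (fun v => b ∉ Pv p v) with hT'
  have h1 := relIndex_surj (US (S ∪ T)) T' (fun v => Nv p v b) (by
    intro t
    obtain ⟨u, hu, h⟩ := hsurj t
    exact ⟨u, hu, fun v hv => Pv_le_Nv _ (h v (Finset.mem_filter.1 hv).1)⟩)
  have h2 : p ^ T'.card ≤ ∏ v ∈ T', (Nv p v b).index := by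
    rw [← Finset.prod_const]
    refine Finset.prod_le_prod' fun v hv => ?_
    obtain ⟨hv1, hv2⟩ := Finset.mem_filter.1 hv
    exact Nv_index_ge hζ v (tame_ne hζ (hp1 v (hTS v hv1)) hv2)
  rw [← h1] at h2
  have h3 : R ≤ ⨅ v ∈ T', Nv p v b := by
    refine le_iInf₂ fun v _ => hRN.trans (Nm_le_Nv _)
  have h4 := Nat.le_of_dvd (Nat.pos_of_ne_zero hR0) (Subgroup.relIndex_dvd_of_le_left (US (S ∪ T)) h3)
  have h5 := h2.trans h4
  have h6 : R.relIndex (US (S ∪ T)) * p ≤ R.relIndex (US (S ∪ T)) * 1 := by rw [mul_one]; exact hR.trans h5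
  have := Nat.le_of_mul_le_mul_left h6 (Nat.pos_of_ne_zero hR0)
  exact absurd hp.out.one_lt (not_lt.2 this)

lemma pow_mem_PS (hζ : IsPrimitiveRoot ζ p) (S : Set (HeightOneSpectrum (𝓞 F))) (y : Fˣ) : y ^ p ∈ PS p S := by
  refine mem_PS.2 ⟨fun v _ => pow_mem_Pv y, fun φ => ?_⟩
  have h2 := real_odd hζ φ
  rw [Units.val_pow_eq_pow_val, map_pow, h2]
  have : φ y ≠ 0 := by simp
  positivity

theorem counting (hζ : IsPrimitiveRoot ζ p) {S : Set (HeightOneSpectrum (𝓞 F))} (hS : S.Finite)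
    (hp1 : ∀ v ∉ S, v.valuation F (p : F) = 1) (hcl : ClS S) {a : Fˣ} (ha : ∀ y : F, y ^ p ≠ a) (haS : a ∈ US S)
    (hpos : ∀ φ : F →+* ℝ, 0 < φ a) (S' : Finset (HeightOneSpectrum (𝓞 F))) (hS' : ∀ v, v ∈ S' ↔ v ∈ S ∧ a ∉ Pv p v) :
    ∏ v ∈ S', (Nv p v a).index ≤ p ^ S'.card ∧
    ((∀ v ∈ S', Nv p v a ≠ ⊤) → ∀ b ∈ US S, (∀ v ∈ S', b ∈ Nv p v a) → b ∈ Nm p a) := by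
  classical
  set s := S.ncard + Fintype.card (InfinitePlace F) with hs
  have hs1 : 1 ≤ s := by
    have : 0 < Fintype.card (InfinitePlace F) := Fintype.card_pos
    omega
  obtain ⟨T, hTc, hTS, hTa, hTs, -, -⟩ := exists_T hζ hS hp1 ha haS (s - 1) (by omega)
  have hsurj : ∀ t : HeightOneSpectrum (𝓞 F) → Fˣ, ∃ u ∈ US (S ∪ T), ∀ v ∈ T, u * t v ∈ Pv p v := by
    intro t
    obtain ⟨y, hy⟩ := exists_vals hcl (fun v => if v ∈ T then (t v)⁻¹ else 1) (T.finite_toSet.subset (by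
      rintro v ⟨-, h⟩
      by_contra hc
      apply h
      rw [if_neg (by simpa using hc)]; simp))
    obtain ⟨u, hu, hu2⟩ := hTs (fun v => y * t v) (by
      intro v hv
      have := hy v (hTS v hv)
      rw [if_pos hv] at this
      rw [Units.val_mul, map_mul, this, ← map_mul, ← Units.val_mul, inv_mul_cancel]
      simp)
    refine ⟨u * y, mul_mem (US_mono Set.subset_union_left hu) ?_, ?_⟩
    · intro v hv
      rw [Set.mem_union, not_or] at hv
      rw [hy v hv.1, if_neg (by simpa using hv.2)]; simp
    · intro v hv
      rw [mul_assoc]; exact hu2 v hv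
  set U := US (S ∪ (T : Set (HeightOneSpectrum (𝓞 F)))) with hU
  have hSTfin : (S ∪ (T : Set (HeightOneSpectrum (𝓞 F)))).Finite := hS.union T.finite_toSet
  have hcard : (S ∪ (T : Set (HeightOneSpectrum (𝓞 F)))).ncard + Fintype.card (InfinitePlace F) = 2 * s - 1 := by
    rw [Set.ncard_union_eq ?_ hS T.finite_toSet, Set.ncard_coe_finset, hTc]
    · omega
    · rw [Set.disjoint_left]
      intro v hv hvT
      exact hTS v hvT hv
  -- relative index of PS
  have hPSU : (PS p S).subgroupOf U = (powMonoidHom p : U →* U).range := by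
    ext ⟨x, hx⟩
    rw [Subgroup.mem_subgroupOf]
    constructor
    · intro h
      obtain ⟨y, hy⟩ := claimIII hζ hS hp1 hcl hsurj hTS hx h
      have hy0 : y ≠ 0 := by rintro rfl; rw [zero_pow hp.out.ne_zero] at hy; exact x.ne_zero hy.symm
      refine ⟨⟨Units.mk0 y hy0, ?_⟩, ?_⟩
      · intro v hv
        have h1 := hx v hv
        rw [← hy, map_pow] at h1
        exact (pow_eq_one_iff.1 h1).resolve_right hp.out.ne_zero
      · ext; simp [hy]
    · rintro ⟨y, hy⟩
      rw [← hy]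
      exact pow_mem_PS hζ S _
  have hrel : (PS p S).relIndex U = p ^ (2 * s - 1) := by
    rw [Subgroup.relIndex, hPSU, US_index hζ hSTfin, hcard]
  obtain ⟨hPS0, hPSle⟩ := PS_index hζ hS
  have hsup : (PS p S ⊔ U).index ≤ p ∧ (PS p S ⊔ U).index ≠ 0 := by
    have h1 := Subgroup.relIndex_mul_index (le_sup_left : PS p S ≤ PS p S ⊔ U)
    rw [Subgroup.relIndex_sup_left, hrel] at h1
    constructor
    · rw [← h1, ← hs, show 2 * s = (2 * s - 1) + 1 by omega, pow_succ] at hPSle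
      exact Nat.le_of_mul_le_mul_left (by simpa using hPSle) (pow_pos hp.out.pos (2 * s - 1))
    · intro h0
      rw [h0, mul_zero] at h1
      exact hPS0 h1.symm
  set N := ⨅ v ∈ S', Nv p v a with hN
  have hPSN : PS p S ≤ N := by
    refine le_iInf₂ fun v hv => ?_
    intro x hx
    exact Pv_le_Nv _ ((mem_PS.1 hx).1 v ((hS' v).1 hv).1)
  have hNi : N.index = ∏ v ∈ S', (Nv p v a).index := by
    rw [← Subgroup.relIndex_top_right]
    apply relIndex_surj
    intro t
    obtain ⟨x, hx, -⟩ := wa_mul (p := p) S' (fun v => (t v)⁻¹) 1 (Or.inl rfl)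
    refine ⟨x, Subgroup.mem_top _, fun v hv => Pv_le_Nv _ ?_⟩
    have := (hx v hv).1
    rwa [inv_inv] at this
  have hNle : N.index ≤ p * N.relIndex U := by
    have h1 := Subgroup.relIndex_mul_index (le_sup_left : N ≤ N ⊔ U)
    rw [Subgroup.relIndex_sup_left] at h1
    rw [← h1, mul_comm]
    refine Nat.mul_le_mul_right _ ((Nat.le_of_dvd (Nat.pos_of_ne_zero hsup.2) ?_).trans hsup.1)
    exact Subgroup.index_dvd_of_le (sup_le_sup_right hPSN U)
  obtain ⟨R, hRN, hRU, hR0, hR⟩ := lemmaA' hζ hSTfin (fun v hv => hp1 v (fun h => hv (Or.inl h)))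
    (hcl.mono Set.subset_union_left) ha (US_mono Set.subset_union_left haS) hpos
  have hset : {v ∈ S ∪ (T : Set (HeightOneSpectrum (𝓞 F))) | a ∉ Pv p v} = (S' : Set (HeightOneSpectrum (𝓞 F))) := by
    ext v
    simp only [Set.mem_sep_iff, Set.mem_union, Finset.mem_coe, hS' v]
    constructor
    · rintro ⟨h | h, h2⟩
      · exact ⟨h, h2⟩
      · exact absurd (hTa v h) h2
    · rintro ⟨h, h2⟩
      exact ⟨Or.inl h, h2⟩
  rw [hset, Set.ncard_coe_finset] at hR
  have hRN' : R ≤ N := le_iInf₂ fun v _ => hRN.trans (Nm_le_Nv _)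
  have h4 := Nat.le_of_dvd (Nat.pos_of_ne_zero hR0) (Subgroup.relIndex_dvd_of_le_left U hRN')
  have hmain : p * N.relIndex U ≤ p ^ S'.card := by
    refine le_trans ?_ hR
    rw [mul_comm]
    exact Nat.mul_le_mul_right _ h4
  constructor
  · rw [← hNi]
    exact hNle.trans hmain
  · intro hne b hb hbN
    have h5 : p ^ S'.card ≤ N.index := by
      rw [hNi, ← Finset.prod_const]
      exact Finset.prod_le_prod' fun v hv => Nv_index_ge hζ v (hne v hv)
    have h6 : R.relIndex U ≤ N.relIndex U := by
      have : R.relIndex U * p ≤ N.relIndex U * p := by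
        rw [mul_comm (N.relIndex U)]; exact hR.trans (h5.trans hNle)
      exact Nat.le_of_mul_le_mul_right this hp.out.pos
    have h7 := Subgroup.relIndex_mul_relIndex R (N ⊓ U) U (le_inf hRN' hRU) inf_le_right
    rw [Subgroup.inf_relIndex_right] at h7
    have h8 : N.relIndex U ≠ 0 := by
      intro h0; rw [h0, mul_zero] at h7; exact hR0 h7.symm
    have h9 : R.relIndex (N ⊓ U) = 1 := by
      have h10 : R.relIndex U = N.relIndex U := le_antisymm h6 h4
      rw [h10] at h7
      exact Nat.eq_of_mul_eq_mul_right (Nat.pos_of_ne_zero h8) (by rw [h7, one_mul])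
    have h11 := Subgroup.relIndex_eq_one.1 h9
    refine hRN (h11 ⟨?_, US_mono Set.subset_union_left hb⟩)
    simpa [hN, Subgroup.mem_iInf] using hbN
end
end Cft
end

section
open IsDedekindDomain NumberField WithZero Polynomial
namespace Cft
universe u
set_option linter.unusedSectionVars false
set_option linter.all false

section
variable {F : Type u} [Field F] [NumberField F] {p : ℕ} [hp : Fact p.Prime] {ζ : F}

lemma p_finite : {v : HeightOneSpectrum (𝓞 F) | v.valuation F (p : F) ≠ 1}.Finite := by
  have h0 : (p : F) ≠ 0 := by exact_mod_cast hp.out.ne_zero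
  exact supp_finite (Units.mk0 (p : F) h0)

lemma mem_Pv_of_pow {v : HeightOneSpectrum (𝓞 F)} (x : Fˣ) (y : F) (hy : y ^ p = x) : x ∈ Pv p v := by
  have hy0 : y ≠ 0 := by rintro rfl; rw [zero_pow hp.out.ne_zero] at hy; exact x.ne_zero hy.symm
  have : x = (Units.mk0 y hy0) ^ p := by ext; simp [hy]
  rw [this]; exact pow_mem_Pv _

theorem Nv_index_le (hζ : IsPrimitiveRoot ζ p) (v : HeightOneSpectrum (𝓞 F)) (a : Fˣ) : (Nv p v a).index ≤ p := by
  classical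
  by_cases ha : a ∈ Pv p v
  · rw [Nv_top ha, Subgroup.index_top]; exact hp.out.one_lt.le
  have hDf := (p_finite (F := F) (p := p)).union (Set.finite_singleton v)
  set D := hDf.toFinset with hD
  have hvD : v ∈ D := by simp [hD]
  obtain ⟨a', h1, h2⟩ := wa_mul (p := p) D (fun v' => if v' = v then a else 1) 1 (Or.inl rfl)
  have h3 : Nv p v a' = Nv p v a := by
    have := (h1 v hvD).1
    rw [if_pos rfl] at this
    rw [← Nv_mul_eq a this, mul_comm, inv_mul_cancel_right]
  have h4 : a' ∉ Pv p v := by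
    intro h
    have := (h1 v hvD).1
    rw [if_pos rfl] at this
    have h5 := mul_mem (inv_mem this) h
    rw [mul_inv, inv_inv, mul_comm, mul_inv_cancel_left] at h5
    exact ha h5
  have h5 : ∀ v' ∈ D, v' ≠ v → a' ∈ Pv p v' := by
    intro v' hv' hne
    have := (h1 v' hv').1
    rwa [if_neg hne, inv_one, mul_one] at this
  obtain ⟨S0, hS0, hcl⟩ := exists_ClS (F := F)
  set S : Set (HeightOneSpectrum (𝓞 F)) := S0 ∪ (D ∪ {v | v.valuation F (a' : F) ≠ 1}) with hS
  have hSf : S.Finite := hS0.union (D.finite_toSet.union (supp_finite a'))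
  obtain ⟨h6, -⟩ := counting hζ hSf (fun v' hv' => by
      by_contra hc
      apply hv'
      right; left
      simp [hD, hc]) (hcl.mono Set.subset_union_left) (a := a') (fun y hy => h4 (mem_Pv_of_pow a' y hy))
      (mem_US.2 fun v' hv' => by
        by_contra hc
        exact hv' (Or.inr (Or.inr hc))) (fun φ => by simpa using h2 φ)
      (hSf.toFinset.filter fun v => a' ∉ Pv p v) (by simp)
  set S' := hSf.toFinset.filter fun v => a' ∉ Pv p v with hS'
  have hvS : v ∈ S' := by
    simp only [hS', Finset.mem_filter, Set.Finite.mem_toFinset]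
    exact ⟨Or.inr (Or.inl hvD), h4⟩
  rw [← Finset.mul_prod_erase _ _ hvS, h3, ← Finset.card_erase_add_one hvS, pow_succ, mul_comm] at h6
  have h7 : p ^ (S'.erase v).card ≤ ∏ x ∈ S'.erase v, (Nv p x a').index := by
    rw [← Finset.prod_const]
    refine Finset.prod_le_prod' fun x hx => Nv_index_ge hζ x ?_
    rw [Finset.mem_erase] at hx
    have hx2 := (Finset.mem_filter.1 hx.2).2
    refine tame_ne hζ ?_ hx2
    by_contra hc
    exact hx2 (h5 x (by simp [hD, hc]) hx.1)
  exact Nat.le_of_mul_le_mul_left ((Nat.mul_le_mul_right _ h7).trans h6) (pow_pos hp.out.pos _)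

/-- polynomial interpolation of determinants -/
lemma det_line {n : ℕ} (M N : Matrix (Fin n) (Fin n) F) : ∃ q : F[X], ∀ x, q.eval x = (M + x • N).det := by
  refine ⟨(M.map C + (X : F[X]) • N.map C).det, fun x => ?_⟩
  rw [← Polynomial.coe_evalRingHom, RingHom.map_det]
  congr 1
  ext i j
  simp
  ring

lemma ratio_mem {v : HeightOneSpectrum (𝓞 F)} {d : F} {b : Fˣ}
    (h2 : v.valuation F (d - b) < (v.valuation F (p : F)) ^ p * v.valuation F (b : F)) :
    ∃ hd0 : d ≠ 0, Units.mk0 d hd0 * b⁻¹ ∈ Pv p v := by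
  have hb0 : v.valuation F (b : F) ≠ 0 := by rw [Valuation.ne_zero_iff]; exact b.ne_zero
  have h3 : v.valuation F (d / b - 1) < (v.valuation F (p : F)) ^ p := by
    have : d / b - 1 = (d - b) / b := by field_simp
    rw [this, map_div₀]
    exact (div_lt_iff₀ (zero_lt_iff.2 hb0)).2 h2
  have hd0 : d ≠ 0 := by
    intro h0
    have := val_eq_one (h3.trans_le (tv_le p v))
    rw [h0] at this; simp at this
  exact ⟨hd0, close_mem_Pv (by simpa [div_eq_mul_inv] using h3)⟩

lemma exists_nat_lt {ι : Type*} (D : Finset ι) (δ : ι → ℤᵐ⁰) (h : ∀ i, δ i ≠ 0) : ∃ n : ℕ, ∀ i ∈ D, exp (-(n:ℤ)) < δ i := by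
  classical
  induction D using Finset.induction_on with
  | empty => exact ⟨0, by simp⟩
  | insert i D hi ih =>
    obtain ⟨n, hn⟩ := ih
    obtain ⟨m, hm⟩ := WithZero.exists_exp_neg_natCast_lt (h i)
    refine ⟨max n m, fun j hj => ?_⟩
    rcases Finset.mem_insert.1 hj with rfl | hj
    · refine lt_of_le_of_lt ?_ hm
      rw [WithZero.exp_le_exp]; simp
    · refine lt_of_le_of_lt ?_ (hn j hj)
      rw [WithZero.exp_le_exp]; simp

theorem approx_Nm (a : Fˣ) (D : Finset (HeightOneSpectrum (𝓞 F))) (t : HeightOneSpectrum (𝓞 F) → Fˣ)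
    (ht : ∀ v, t v ∈ Nm p a) : ∃ n ∈ Nm p a, ∀ v ∈ D, n * (t v)⁻¹ ∈ Pv p v := by
  classical
  induction D using Finset.induction_on with
  | empty => exact ⟨1, one_mem _, by simp⟩
  | insert v D hv ih =>
    obtain ⟨n, ⟨f, hf⟩, hn⟩ := ih
    obtain ⟨g, hg⟩ := ht v
    obtain ⟨q, hq⟩ := det_line (aeval (comp p (a:F)) f) (aeval (comp p (a:F)) (g - f))
    have hq0 : q.eval 0 = n := by rw [hq, zero_smul, add_zero, hf]
    have hq1 : q.eval 1 = t v := by rw [hq, one_smul, map_sub, add_sub_cancel, hg]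
    have hne : ∀ (w : HeightOneSpectrum (𝓞 F)) (x : Fˣ), (w.valuation F (p : F)) ^ p * w.valuation F (x : F) ≠ 0 := 
      fun w x => mul_ne_zero (tv_pos p w).ne' (by rw [Valuation.ne_zero_iff]; exact x.ne_zero)
    choose δ hδ h1 using fun w : HeightOneSpectrum (𝓞 F) => poly_cont (w.valuation F) q 0 _ (hne w n)
    obtain ⟨ε, hε, h2⟩ := poly_cont (v.valuation F) q 1 _ (hne v (t v))
    obtain ⟨k, hk⟩ := exists_nat_lt (insert v D) (fun w => if w = v then ε else δ w) (fun w => by 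
      split_ifs; exacts [hε, hδ w])
    obtain ⟨x, hx⟩ := wa (insert v D) (fun w => if w = v then (1:F) else 0) k
    have hxv : ∃ hd0 : q.eval x ≠ 0, Units.mk0 _ hd0 * (t v)⁻¹ ∈ Pv p v := by
      apply ratio_mem
      rw [← hq1]
      rw [hq1]
      have := h2 x (by
        have h3 := (hx v (Finset.mem_insert_self _ _)).trans_lt (hk v (Finset.mem_insert_self _ _))
        simpa using h3)
      rwa [hq1] at this
    obtain ⟨hd0, h3⟩ := hxv
    refine ⟨Units.mk0 _ hd0, ⟨f + C x * (g - f), ?_⟩, ?_⟩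
    · rw [Units.val_mk0, hq, map_add, map_mul, aeval_C, Algebra.smul_def]
    · intro w hw
      rcases Finset.mem_insert.1 hw with rfl | hw'
      · exact h3
      · have hwv : w ≠ v := by rintro rfl; exact hv hw'
        have h4 := h1 w x (by
          have h3 := (hx w hw).trans_lt (hk w hw)
          simpa [hwv] using h3)
        rw [hq0] at h4
        obtain ⟨_, h5⟩ := ratio_mem h4
        have := mul_mem h5 (hn w hw')
        rwa [mul_assoc, inv_mul_cancel_left] at this

theorem HN (hζ : IsPrimitiveRoot ζ p) [hr : IsEmpty (F →+* ℝ)] (a b : Fˣ)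
    (h : ∀ v : HeightOneSpectrum (𝓞 F), b ∈ Nv p v a) : b ∈ Nm p a := by
  classical
  set D := (p_finite (F := F) (p := p)).toFinset with hD
  choose n hn u hu hnu using fun v => Subgroup.mem_sup.1 (h v)
  obtain ⟨m, hm, hmD⟩ := approx_Nm a D n hn
  set a' := b * m⁻¹ with ha'
  have hb : b = a' * m := by rw [ha', inv_mul_cancel_right]
  have h1 : ∀ v ∈ D, a' ∈ Pv p v := by
    intro v hv
    have := mul_mem (hu v) (inv_mem (hmD v hv))
    rw [ha', ← hnu v]
    rwa [mul_inv, inv_inv, mul_comm m⁻¹, ← mul_assoc, mul_comm (u v)] at this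
  have h2 : ∀ v, a ∈ Nv p v a' := fun v => Nv_symm hζ (mul_mem (h v) (inv_mem (Nm_le_Nv _ hm)))
  rw [hb]
  refine mul_mem ?_ hm
  by_cases hpow : ∃ y : F, y ^ p = a'
  · obtain ⟨y, hy⟩ := hpow
    have hy0 : y ≠ 0 := by rintro rfl; rw [zero_pow hp.out.ne_zero] at hy; exact a'.ne_zero hy.symm
    have : a' = (Units.mk0 y hy0) ^ p := by ext; simp [hy]
    rw [this]; exact pow_mem_Nm _ _
  push Not at hpow
  by_cases hpa : ∃ y : F, y ^ p = a
  · obtain ⟨y, hy⟩ := hpa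
    have hy0 : y ≠ 0 := by rintro rfl; rw [zero_pow hp.out.ne_zero] at hy; exact a.ne_zero hy.symm
    have : a = 1 * (Units.mk0 y hy0) ^ p := by ext; simp [hy]
    have h3 := Nm_scale (p := p) a (Units.mk0 y hy0)⁻¹
    have h4 : a * (Units.mk0 y hy0)⁻¹ ^ p = 1 := by
      rw [this, one_mul, ← mul_pow, mul_inv_cancel, one_pow]
    rw [h4, Nm_one] at h3
    exact h3 trivial
  push Not at hpa
  obtain ⟨S0, hS0, hcl⟩ := exists_ClS (F := F)
  set S : Set (HeightOneSpectrum (𝓞 F)) := S0 ∪ (D ∪ ({v | v.valuation F (a' : F) ≠ 1} ∪ {v | v.valuation F (a : F) ≠ 1})) with hS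
  have hSf : S.Finite := hS0.union (D.finite_toSet.union ((supp_finite a').union (supp_finite a)))
  obtain ⟨-, h6⟩ := counting hζ hSf (fun v' hv' => by
      by_contra hc
      apply hv'
      right; left
      simp [hD, hc]) (hcl.mono Set.subset_union_left) (a := a') hpow
      (mem_US.2 fun v' hv' => by
        by_contra hc
        exact hv' (Or.inr (Or.inr (Or.inl hc)))) (fun φ => hr.elim φ)
      (hSf.toFinset.filter fun v => a' ∉ Pv p v) (by simp)
  have h7 := h6 (fun v hv => by
    have hx2 := (Finset.mem_filter.1 hv).2
    refine tame_ne hζ ?_ hx2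
    by_contra hc
    exact hx2 (h1 v (by simp [hD, hc]))) a (mem_US.2 fun v' hv' => by
        by_contra hc
        exact hv' (Or.inr (Or.inr (Or.inr hc)))) (fun v _ => h2 v)
  exact (sym_iff hζ hpa).1 ((sym_iff hζ hpow).2 h7).symm

theorem HN_sym (hζ : IsPrimitiveRoot ζ p) [hr : IsEmpty (F →+* ℝ)] (a b : Fˣ)
    (h : ∀ v : HeightOneSpectrum (𝓞 F), b ∈ Nv p v a) : Sym p ζ (a:F) (b:F) := by
  by_cases hpa : ∃ y : F, y ^ p = a
  · obtain ⟨y, hy⟩ := hpa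
    rw [← hy]
    exact sym_pow hζ y b
  push Not at hpa
  exact (sym_iff hζ hpa).2 (HN hζ a b h)
end
end Cft
end

section
open IsDedekindDomain NumberField WithZero Polynomial
namespace Cft
universe u
set_option linter.unusedSectionVars false
set_option linter.all false

section
variable {F : Type u} [Field F] [NumberField F] {p : ℕ} [hp : Fact p.Prime] {ζ : F}

lemma two_proper {G : Type*} [Group G] (H K : Subgroup G) : ∃ x, (H ≠ ⊤ → x ∉ H) ∧ (K ≠ ⊤ → x ∉ K) := by
  by_cases hH : H = ⊤
  · by_cases hK : K = ⊤
    · exact ⟨1, by simp [hH], by simp [hK]⟩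
    · obtain ⟨x, hx⟩ : ∃ x, x ∉ K := by
        by_contra hc; push Not at hc; exact hK (by ext; simp [hc])
      exact ⟨x, by simp [hH], fun _ => hx⟩
  obtain ⟨x, hx⟩ : ∃ x, x ∉ H := by
    by_contra hc; push Not at hc; exact hH (by ext; simp [hc])
  by_cases hK : K = ⊤
  · exact ⟨x, fun _ => hx, by simp [hK]⟩
  obtain ⟨y, hy⟩ : ∃ x, x ∉ K := by
    by_contra hc; push Not at hc; exact hK (by ext; simp [hc])
  by_cases hxK : x ∈ K
  · by_cases hyH : y ∈ H
    · refine ⟨x * y, fun _ h => hx ?_, fun _ h => hy ?_⟩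
      · have := mul_mem h (inv_mem hyH); simpa using this
      · have := mul_mem (inv_mem hxK) h; simpa using this
    · exact ⟨y, fun _ => hyH, fun _ => hy⟩
  · exact ⟨x, fun _ => hx, fun _ => hxK⟩

lemma gen_of_notMem (hζ : IsPrimitiveRoot ζ p) (v : HeightOneSpectrum (𝓞 F)) (a b x : Fˣ)
    (hx : Nv p v a ≠ ⊤ → x ∉ Nv p v a) : ∃ i : ℤ, b * x ^ i ∈ Nv p v a := by
  by_cases h : Nv p v a = ⊤
  · exact ⟨0, by rw [h]; trivial⟩
  have hx := hx h
  have hi : (Nv p v a).index = p := le_antisymm (Nv_index_le hζ v a) (Nv_index_ge hζ v h)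
  have hc : Nat.card (Fˣ ⧸ Nv p v a) = p := hi
  have hne : (QuotientGroup.mk x : Fˣ ⧸ Nv p v a) ≠ 1 := by rwa [Ne, QuotientGroup.eq_one_iff]
  have := mem_zpowers_of_prime_card hc (g := (QuotientGroup.mk x : Fˣ ⧸ Nv p v a)) (g' := QuotientGroup.mk b⁻¹) hne
  obtain ⟨i, hi⟩ := Subgroup.mem_zpowers_iff.1 this
  refine ⟨i, ?_⟩
  rw [← QuotientGroup.mk_zpow, eq_comm, QuotientGroup.eq, inv_inv] at hi
  exact hi

lemma exists_root (x : F) (hζ : IsPrimitiveRoot ζ p) : ∃ (L : Type u) (_ : Field L) (_ : Algebra F L) (α : L),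
    Module.finrank F L ∣ p ∧ α ^ p = algebraMap F L x := by
  by_cases hx : ∃ y, y ^ p = x
  · obtain ⟨y, hy⟩ := hx
    exact ⟨F, inferInstance, inferInstance, y, by simp, by simpa using hy⟩
  push Not at hx
  obtain ⟨K, _, _, α, σ, h⟩ := exists_kum hζ hx
  exact ⟨K, inferInstance, inferInstance, α, by rw [h.hfin], h.hα⟩

theorem main1 (hζ : IsPrimitiveRoot ζ p) (a b c d : Fˣ) : ∃ (L : Type u) (_ : Field L) (_ : Algebra F L),
    Module.finrank F L ∣ p ∧ Sym p (algebraMap F L ζ) (algebraMap F L a) (algebraMap F L b) ∧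
      Sym p (algebraMap F L ζ) (algebraMap F L c) (algebraMap F L d) := by
  classical
  set D := (p_finite (F := F) (p := p)).toFinset with hD
  have hfin := ((supp_finite a).union (supp_finite b)).union ((supp_finite c).union (supp_finite d))
  set D' := D ∪ hfin.toFinset with hD'
  have ht : ∀ v : HeightOneSpectrum (𝓞 F), ∃ t : Fˣ, if v ∈ D then
      ((Nv p v a ≠ ⊤ → t ∉ Nv p v a) ∧ (Nv p v c ≠ ⊤ → t ∉ Nv p v c)) else v.valuation F (t : F) = exp (-1 : ℤ) := by
    intro v
    by_cases hv : v ∈ D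
    · simp only [if_pos hv]
      exact two_proper _ _
    · simp only [if_neg hv]
      obtain ⟨π, hπ⟩ := v.valuation_exists_uniformizer F
      refine ⟨Units.mk0 π ?_, hπ⟩
      rintro rfl
      rw [map_zero] at hπ
      exact WithZero.exp_ne_zero hπ.symm
  choose t ht using ht
  obtain ⟨x, hx, hneg⟩ := wa_mul (p := p) D' t (-1) (Or.inr rfl)
  obtain ⟨L, _, _, α, hdeg, hα⟩ := exists_root (x : F) hζ
  haveI : FiniteDimensional F L := Module.finite_of_finrank_pos (Nat.pos_of_dvd_of_pos hdeg hp.out.pos)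
  haveI : NumberField L := NumberField.of_module_finite F L
  have hα0 : α ≠ 0 := by
    rintro rfl
    rw [zero_pow hp.out.ne_zero, eq_comm, map_eq_zero] at hα
    exact x.ne_zero hα
  have hζL : IsPrimitiveRoot (algebraMap F L ζ) p := hζ.map_of_injective (algebraMap F L).injective
  haveI : IsEmpty (L →+* ℝ) := by
    refine ⟨fun ψ => ?_⟩
    have h2 := real_odd hζL ψ
    have h3 := hneg (ψ.comp (algebraMap F L))
    rw [RingHom.comp_apply, ← hα, map_pow, h2] at h3
    have := sq_nonneg (ψ α)
    push_cast at h3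
    linarith
  let U : Fˣ →* Lˣ := Units.map (algebraMap F L).toMonoidHom
  have hUx : U x = (Units.mk0 α hα0) ^ p := by
    ext; simp [U, hα]
  have hNv : ∀ (w : HeightOneSpectrum (𝓞 L)) (a b : Fˣ), b ∈ Nv p (un F w) a → U b ∈ Nv p w (U a) := by
    intro w a b hb
    obtain ⟨n, ⟨f, hf⟩, u, hu, rfl⟩ := Subgroup.mem_sup.1 hb
    rw [map_mul]
    refine mul_mem (Nm_le_Nv _ ⟨f.map (algebraMap F L), ?_⟩) (Pv_le_Nv _ (Pv_map w hu))
    have := map_det_comp (p := p) (algebraMap F L) (a:F) f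
    rw [hf] at this
    exact this.symm
  have hval : ∀ (v : HeightOneSpectrum (𝓞 F)) (a : Fˣ), v ∉ D → (v.valuation F (a:F) ≠ 1 → v ∈ D') → 
      ∃ k : ℤ, v.valuation F (a : F) = v.valuation F (x : F) ^ k := by
    intro v a hv h1
    by_cases h2 : v.valuation F (a : F) = 1
    · exact ⟨0, by simp [h2]⟩
    have h3 := (hx v (h1 h2)).2
    have h4 := ht v
    rw [if_neg hv] at h4
    rw [h4] at h3
    have h5 : v.valuation F (a : F) ≠ 0 := by rw [Valuation.ne_zero_iff]; exact a.ne_zero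
    refine ⟨-WithZero.log (v.valuation F (a:F)), ?_⟩
    rw [h3, ← WithZero.exp_zsmul]
    simp [WithZero.exp_log h5]
  have hvalL : ∀ (w : HeightOneSpectrum (𝓞 L)) (a : Fˣ), un F w ∉ D → ((un F w).valuation F (a:F) ≠ 1 → un F w ∈ D') → 
      ∃ y : Lˣ, w.valuation L (U a : L) = w.valuation L (y : L) ^ p := by
    intro w a hv h1
    obtain ⟨k, hk⟩ := hval _ a hv h1
    obtain ⟨e, he, h⟩ := val_un (F := F) w
    refine ⟨(Units.mk0 α hα0) ^ k, ?_⟩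
    have h3 := h x
    rw [← hα, map_pow] at h3
    have h4 := h a
    rw [hk] at h4
    show w.valuation L (algebraMap F L a) = _
    rw [h4, ← zpow_natCast, zpow_comm, zpow_natCast, ← h3]
    rw [Units.val_zpow_eq_zpow_val, map_zpow₀, Units.val_mk0, ← zpow_natCast, zpow_comm, zpow_natCast]
  have key : ∀ (a b : Fˣ), (∀ v ∈ D, Nv p v a ≠ ⊤ → t v ∉ Nv p v a) → 
      (∀ v ∉ D, v.valuation F (a:F) ≠ 1 → v ∈ D') → (∀ v ∉ D, v.valuation F (b:F) ≠ 1 → v ∈ D') → 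
      Sym p (algebraMap F L ζ) (algebraMap F L a) (algebraMap F L b) := by
    intro a b h1 h2 h3
    refine HN_sym hζL (U a) (U b) fun w => ?_
    by_cases hw : un F w ∈ D
    · obtain ⟨i, hi⟩ := gen_of_notMem hζ (un F w) a b x (fun h4 h5 => h1 _ hw h4 (by
        have := mul_mem (inv_mem (Pv_le_Nv a (hx _ (Finset.mem_union_left _ hw)).1)) h5
        rwa [mul_inv, inv_inv, mul_comm, mul_inv_cancel_left] at this))
      have h4 := hNv w a _ hi
      rw [map_mul, map_zpow, hUx] at h4
      have h5 := mul_mem h4 (inv_mem (zpow_mem (pow_mem_Nv (p := p) (v := w) (U a) (Units.mk0 α hα0)) i))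
      rwa [mul_inv_cancel_right] at h5
    · obtain ⟨y, hy⟩ := hvalL w a hw (h2 _ hw)
      obtain ⟨z, hz⟩ := hvalL w b hw (h3 _ hw)
      refine lemmaU ?_ hy hz
      have : (un F w).valuation F (p : F) = 1 := by
        by_contra hc
        exact hw (by simp [hD, hc])
      have h5 := (val_un_eq_one w (p : F)).2 this
      rwa [map_natCast] at h5
  refine ⟨L, inferInstance, inferInstance, hdeg, key a b ?_ ?_ ?_, key c d ?_ ?_ ?_⟩
  · intro v hv
    have := ht v
    rw [if_pos hv] at this
    exact this.1
  · intro v _ h; simp [hD', h]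
  · intro v _ h; simp [hD', h]
  · intro v hv
    have := ht v
    rw [if_pos hv] at this
    exact this.2
  · intro v _ h; simp [hD', h]
  · intro v _ h; simp [hD', h]
end
end Cft
end

section
open IsDedekindDomain NumberField WithZero Polynomial
namespace Cft
universe u
set_option linter.unusedSectionVars false
set_option linter.all false

section
open scoped TensorProduct
variable {E : Type*} [Field E] {A : Type*} [DivisionRing A] [Algebra E A] [Algebra.IsCentral E A]

lemma central_mem {D : Type*} [Ring D] [Algebra E D] [Algebra.IsCentral E D] {x : D} (h : ∀ y, y * x = x * y) : ∃ e : E, algebraMap E D e = x := by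
  have h1 : x ∈ Subalgebra.center E D := Subalgebra.mem_center_iff.2 h
  have := Algebra.IsCentral.out h1
  exact Algebra.mem_bot.1 this

lemma lin0 {R : Type*} [Ring R] [Algebra E R] (f : A →ₐ[E] R) {ι : Type*} {c : ι → R}
    (hc : LinearIndependent E c) (hcomm : ∀ x i, Commute (f x) (c i)) (s : Finset ι) : ∀ (a : ι → A)
    (h : ∑ i ∈ s, f (a i) * c i = 0), ∀ i ∈ s, a i = 0 := by
  classical
  induction s using Finset.induction_on with
  | empty => simp
  | insert k s hk ih =>
    intro a h
    have key : a k = 0 := by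
      by_contra h0
      have h1 : ∑ i ∈ insert k s, f ((a k)⁻¹ * a i) * c i = 0 := by
        have : ∑ i ∈ insert k s, f ((a k)⁻¹ * a i) * c i = f (a k)⁻¹ * ∑ i ∈ insert k s, f (a i) * c i := by
          rw [Finset.mul_sum]
          exact Finset.sum_congr rfl fun i _ => by rw [map_mul, mul_assoc]
        rw [this, h, mul_zero]
      set b := fun i => (a k)⁻¹ * a i with hb
      have hbk : b k = 1 := inv_mul_cancel₀ h0
      have h2 : ∀ x, ∀ i ∈ s, x * b i - b i * x = 0 := by
        intro x
        apply ih
        have h3 : ∑ i ∈ insert k s, f (x * b i - b i * x) * c i = 0 := by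
          have : ∑ i ∈ insert k s, f (x * b i - b i * x) * c i =
              f x * (∑ i ∈ insert k s, f (b i) * c i) - (∑ i ∈ insert k s, f (b i) * c i) * f x := by
            rw [Finset.mul_sum, Finset.sum_mul, ← Finset.sum_sub_distrib]
            refine Finset.sum_congr rfl fun i _ => ?_
            have := (hcomm x i).eq
            have aux : ∀ y, f (x * y - y * x) * c i = f x * (f y * c i) - f y * c i * f x := by
              intro y
              rw [map_sub, map_mul, map_mul, sub_mul, mul_assoc, mul_assoc, this, mul_assoc]
            exact aux (b i)
          rw [this, h1, mul_zero, zero_mul, sub_zero]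
        rw [Finset.sum_insert hk, hbk] at h3
        simpa using h3
      have h4 : ∀ i ∈ insert k s, ∃ e : E, algebraMap E A e = b i := by
        intro i hi
        rcases Finset.mem_insert.1 hi with rfl | hi
        · exact ⟨1, by rw [hbk, map_one]⟩
        · exact central_mem fun y => sub_eq_zero.1 (h2 y i hi)
      choose! e he using h4
      have h5 : ∑ i ∈ insert k s, e i • c i = 0 := by
        rw [← h1]
        refine Finset.sum_congr rfl fun i hi => ?_
        show _ = f (b i) * c i
        rw [← he i hi, AlgHom.commutes, Algebra.smul_def]
      have h6 := linearIndependent_iff'.1 hc _ e h5 k (Finset.mem_insert_self _ _)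
      have h7 := he k (Finset.mem_insert_self _ _)
      rw [h6, map_zero, hbk] at h7
      exact zero_ne_one h7
    intro i hi
    rcases Finset.mem_insert.1 hi with rfl | hi
    · exact key
    · rw [Finset.sum_insert hk, key, map_zero, zero_mul, zero_add] at h
      exact ih a h i hi

lemma lift_inj {R D : Type*} [Ring R] [Algebra E R] [Ring D] [Algebra E D] (f : A →ₐ[E] R) (g : D →ₐ[E] R)
    (hg : Function.Injective g) (hfg : ∀ x y, Commute (f x) (g y)) :
    Function.Injective (Algebra.TensorProduct.lift f g hfg) := by
  classical
  rw [injective_iff_map_eq_zero]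
  intro t ht
  let e := Module.Basis.ofVectorSpace E D
  obtain ⟨b, rfl⟩ := (TensorProduct.equivFinsuppOfBasisRight (M := A) e).symm.surjective t
  have h1 : (TensorProduct.equivFinsuppOfBasisRight (M := A) e).symm b = ∑ i ∈ b.support, b i ⊗ₜ e i := by
    have := congrArg (fun F => F b) (TensorProduct.equivFinsuppOfBasisRight_symm (M := A) e)
    simpa [Finsupp.sum] using this
  rw [h1, map_sum] at ht
  simp only [Algebra.TensorProduct.lift_tmul] at ht
  have hc : LinearIndependent E (fun i => g (e i)) := e.linearIndependent.map' g.toLinearMap (LinearMap.ker_eq_bot.2 hg)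
  have h2 := lin0 f hc (fun x i => hfg x _) b.support b ht
  have : b = 0 := by
    ext i
    by_cases hi : i ∈ b.support
    · exact h2 i hi
    · simpa using hi
  rw [this, map_zero]

/-- right multiplication representation -/
noncomputable def rmul {B : Type*} [Ring B] [Algebra E B] (f : A →ₐ[E] B) : Aᵐᵒᵖ →ₐ[E] Module.End E B :=
  AlgHom.ofLinearMap ((LinearMap.mul E B).flip ∘ₗ f.toLinearMap ∘ₗ (MulOpposite.opLinearEquiv E).symm.toLinearMap)
    (by ext x; simp) (by intro x y; ext z; simp [mul_assoc])

lemma rmul_apply {B : Type*} [Ring B] [Algebra E B] (f : A →ₐ[E] B) (x : Aᵐᵒᵖ) (z : B) : rmul f x z = z * f x.unop := by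
  simp [rmul]

lemma rmul_comm {B : Type*} [Ring B] [Algebra E B] (f : A →ₐ[E] B) (x : A) (y : Aᵐᵒᵖ) :
    Commute (((Algebra.lmul E B).comp f) x) (rmul f y) := by
  ext z
  simp [rmul_apply, mul_assoc]

lemma cent_comm {B : Type*} [Ring B] [Algebra E B] (f : A →ₐ[E] B) (x : A) (y : Subalgebra.centralizer E (Set.range f)) :
    Commute (f x) ((Subalgebra.centralizer E (Set.range f)).val y) :=
  (Subalgebra.mem_centralizer_iff E).1 y.2 (f x) (Set.mem_range_self x)

noncomputable def bim {B : Type*} [Ring B] [Algebra E B] (f : A →ₐ[E] B) : (A ⊗[E] Aᵐᵒᵖ) →ₐ[E] Module.End E B :=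
  Algebra.TensorProduct.lift ((Algebra.lmul E B).comp f) (rmul f) (rmul_comm f)

lemma bim_tmul {B : Type*} [Ring B] [Algebra E B] (f : A →ₐ[E] B) (x : A) (y : Aᵐᵒᵖ) (z : B) :
    bim f (x ⊗ₜ y) z = f x * (z * f y.unop) := by
  rw [bim, Algebra.TensorProduct.lift_tmul]
  simp [rmul_apply]

lemma bim_bij [FiniteDimensional E A] : Function.Bijective (bim (AlgHom.id E A)) := by
  have h1 : Function.Injective (bim (AlgHom.id E A)) := by
    apply lift_inj
    intro x y h
    have := congrArg (fun F : Module.End E A => F 1) h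
    simp only [rmul_apply] at this
    simpa using this
  refine ⟨h1, ?_⟩
  have h2 := LinearMap.injective_iff_surjective_of_finrank_eq_finrank (f := (bim (AlgHom.id E A)).toLinearMap) (by
    rw [Module.finrank_tensorProduct, Module.finrank_linearMap, (MulOpposite.opLinearEquiv E (M := A)).finrank_eq])
  exact h2.1 h1

/-- every element of `B` is a sum of products -/
lemma mem_prod [FiniteDimensional E A] {B : Type*} [Ring B] [Algebra E B] (f : A →ₐ[E] B) {ι : Type*} [Fintype ι] (e : Module.Basis ι E A)
    (z : B) : ∃ c : ι → B, (∀ x i, Commute (f x) (c i)) ∧ z = ∑ i, f (e i) * c i := by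
  have hs := (bim_bij (E := E) (A := A)).2
  have hi := (bim_bij (E := E) (A := A)).1
  choose τ hτ using fun k => hs ((e.coord k).smulRight (1 : A))
  refine ⟨fun k => bim f (τ k) z, ?_, ?_⟩
  · intro x k
    have h1 : (x ⊗ₜ 1) * τ k = (1 ⊗ₜ MulOpposite.op x) * τ k := by
      apply hi
      rw [map_mul, map_mul, hτ]
      ext y
      simp [bim_tmul, Module.End.mul_apply]
    have h2 := congrArg (fun t => bim f t z) h1
    show f x * _ = _ * f x
    simpa [bim_tmul, Module.End.mul_apply] using h2
  · have h1 : ∑ k, (e k ⊗ₜ 1) * τ k = 1 := by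
      apply hi
      rw [map_sum, map_one]
      simp only [map_mul, hτ]
      ext y
      simp only [LinearMap.sum_apply, Module.End.mul_apply, bim_tmul, LinearMap.smulRight_apply]
      simpa using e.sum_repr y
    have h2 := congrArg (fun t => bim f t z) h1
    simp only [map_sum, map_mul, map_one, LinearMap.sum_apply, Module.End.mul_apply, bim_tmul, Module.End.one_apply] at h2
    simpa using h2.symm

theorem tensor_bij [FiniteDimensional E A] {B : Type*} [Ring B] [Algebra E B] (f : A →ₐ[E] B) :
    Function.Bijective (Algebra.TensorProduct.lift f (Subalgebra.centralizer E (Set.range f)).val (cent_comm f)) := by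
  constructor
  · exact lift_inj _ _ Subtype.val_injective _
  · intro z
    obtain ⟨c, hc, hz⟩ := mem_prod f (Module.finBasis E A) z
    refine ⟨∑ i, (Module.finBasis E A i) ⊗ₜ ⟨c i, (Subalgebra.mem_centralizer_iff E).2 ?_⟩, ?_⟩
    · rintro _ ⟨x, rfl⟩
      exact hc x i
    · rw [map_sum, hz]
      exact Finset.sum_congr rfl fun i _ => by rw [Algebra.TensorProduct.lift_tmul]; rfl
end
end Cft
end

section
open IsDedekindDomain NumberField WithZero Polynomial
namespace Cft
universe u
set_option linter.unusedSectionVars false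
set_option linter.all false

section
open scoped TensorProduct
variable {E : Type*} [Field E] {A : Type*} [DivisionRing A] [Algebra E A] [Algebra.IsCentral E A] [FiniteDimensional E A]

lemma lin1 {ι : Type*} [Fintype ι] (e : Module.Basis ι E A) (b : ι → A) (h : ∀ x, ∑ i, e i * (x * b i) = 0) : ∀ i, b i = 0 := by
  classical
  have h1 : ∑ i, e i ⊗ₜ[E] MulOpposite.op (b i) = 0 := by
    apply (bim_bij (E := E) (A := A)).1
    rw [map_zero, map_sum]
    ext x
    simpa [bim_tmul] using h x
  have h2 := congrArg (TensorProduct.equivFinsuppOfBasisLeft (N := Aᵐᵒᵖ) e) h1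
  rw [map_sum, map_zero] at h2
  intro i
  have h3 := congrArg (fun F => F i) h2
  simp only [Finsupp.finsetSum_apply, TensorProduct.equivFinsuppOfBasisLeft_apply_tmul_apply] at h3
  simpa [Finsupp.single_apply] using h3

lemma split_of_max {K : Type*} [Field K] [Algebra E K] (j : K →ₐ[E] A)
    (hmax : ∀ x, (∀ k, j k * x = x * j k) → ∃ k, j k = x) :
    ∃ n, Module.finrank E A = n ^ 2 ∧ Module.finrank E K = n ∧ Nonempty (A →ₐ[E] Matrix (Fin n) (Fin n) K) := by
  classical
  letI : Module K A :=
    { smul := fun k a => a * j k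
      one_smul := fun a => by show a * j 1 = a; simp
      mul_smul := fun k l a => by show a * j (k * l) = (a * j l) * j k; rw [mul_comm, map_mul, mul_assoc]
      smul_zero := fun k => by show (0:A) * j k = 0; simp
      zero_smul := fun a => by show a * j 0 = 0; simp
      smul_add := fun k a b => by show (a + b) * j k = a * j k + b * j k; rw [add_mul]
      add_smul := fun k l a => by show a * j (k + l) = a * j k + a * j l; rw [map_add, mul_add] }
  have smul_def : ∀ (k : K) (a : A), k • a = a * j k := fun _ _ => rfl
  haveI : IsScalarTower E K A := ⟨fun e k a => by
    rw [smul_def, smul_def, map_smul, mul_smul_comm]⟩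
  haveI : FiniteDimensional K A := Module.Finite.of_restrictScalars_finite E K A
  have hKfin : FiniteDimensional E K := FiniteDimensional.of_injective j.toLinearMap j.injective
  set m := Module.finrank K A with hm
  have hm0 : 0 < m := Module.finrank_pos
  have htower : Module.finrank E K * m = Module.finrank E A := Module.finrank_mul_finrank E K A
  let ι := Fin (Module.finrank E A)
  let e : Module.Basis ι E A := Module.finBasis E A
  let lm : A →ₐ[E] Module.End K A := AlgHom.ofLinearMap
    { toFun := fun a => { toFun := fun x => a * x, map_add' := mul_add a, map_smul' := fun k x => by
                              simp only [smul_def, RingHom.id_apply, mul_assoc] }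
      map_add' := fun a b => by ext x; exact add_mul a b x
      map_smul' := fun r a => by ext x; simp } (by ext x; simp) (by intro a b; ext x; simp [mul_assoc])
  have lm_apply : ∀ a x, lm a x = a * x := fun _ _ => rfl
  let Φ : (ι → K) →ₗ[K] Module.End K A := Fintype.linearCombination K (fun i => lm (e i))
  have hΦ : ∀ b x, Φ b x = ∑ i, e i * (x * j (b i)) := by
    intro b x
    simp only [Φ, Fintype.linearCombination_apply, LinearMap.sum_apply, LinearMap.smul_apply, lm_apply, smul_def, mul_assoc]
  have hbij : Function.Bijective Φ := by
    constructor
    · rw [injective_iff_map_eq_zero]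
      intro b hb
      have h1 := lin1 e (fun i => j (b i)) (fun x => by rw [← hΦ, hb]; rfl)
      ext i
      have := h1 i
      rwa [map_eq_zero] at this
    · intro φ
      have hφ : ∀ k x, φ (x * j k) = φ x * j k := fun k x => φ.map_smul k x
      obtain ⟨c, hc, hz⟩ := mem_prod (Algebra.lmul E A) e (φ.restrictScalars E)
      have hc1 : ∀ i x, c i x = x * c i 1 := by
        intro i x
        have := congrArg (fun F : Module.End E A => F 1) (hc x i).eq
        simpa using this.symm
      have hz1 : ∀ x, φ x = ∑ i, e i * (x * c i 1) := by
        intro x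
        have := congrArg (fun F : Module.End E A => F x) hz
        simp only [LinearMap.sum_apply, LinearMap.restrictScalars_apply, Module.End.mul_apply] at this
        rw [this]
        refine Finset.sum_congr rfl fun i _ => ?_
        rw [hc1 i x]; rfl
      have hk : ∀ k, ∀ i, j k * c i 1 - c i 1 * j k = 0 := by
        intro k
        apply lin1 e
        intro x
        have h1 := hφ k x
        rw [hz1, hz1, Finset.sum_mul] at h1
        rw [← sub_eq_zero, ← Finset.sum_sub_distrib] at h1
        rw [← h1]
        refine Finset.sum_congr rfl fun i _ => ?_
        simp only [mul_sub, mul_assoc]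
      choose b hb using fun i => hmax (c i 1) (fun k => sub_eq_zero.1 (hk k i))
      refine ⟨b, ?_⟩
      ext x
      rw [hΦ, hz1]
      simp only [hb]
  have hd := (LinearEquiv.ofBijective Φ hbij).finrank_eq
  rw [Module.finrank_fintype_fun_eq_card, Fintype.card_fin, Module.finrank_linearMap, ← hm] at hd
  have hKm : Module.finrank E K = m := Nat.eq_of_mul_eq_mul_right hm0 (by rw [htower, hd])
  refine ⟨m, by rw [hd, sq], hKm, ⟨?_⟩⟩
  exact ((LinearMap.toMatrixAlgEquiv (Module.finBasis K A)).toAlgHom.restrictScalars E).comp lm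

theorem exists_split (E : Type*) [Field E] (A : Type u) [DivisionRing A] [Algebra E A] [Algebra.IsCentral E A] [FiniteDimensional E A] : 
    ∃ n, Module.finrank E A = n ^ 2 ∧ ∃ (K : Type u) (_ : Field K) (_ : Algebra E K), Module.finrank E K = n ∧ 
      Nonempty (A →ₐ[E] Matrix (Fin n) (Fin n) K) := by
  let P : Subalgebra E A → Prop := fun K => ∀ x ∈ K, ∀ y ∈ K, x * y = y * x
  have hex : ∃ K, P K ∧ ∀ K', P K' → Module.finrank E K' ≤ Module.finrank E K := by
    obtain ⟨K, hK, hK2⟩ := WellFounded.has_min (measure (fun K : Subalgebra E A => Module.finrank E A - Module.finrank E K)).wf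
      {K | P K} ⟨⊥, by
        intro x hx y hy
        obtain ⟨r, rfl⟩ := Algebra.mem_bot.1 hx
        exact Algebra.commutes r y⟩
    refine ⟨K, hK, fun K' hK' => ?_⟩
    have h1 := hK2 K' hK'
    have h2 : Module.finrank E K' ≤ Module.finrank E A := Submodule.finrank_le (Subalgebra.toSubmodule K')
    have h3 : ¬ (Module.finrank E A - Module.finrank E K' < Module.finrank E A - Module.finrank E K) := h1
    omega
  obtain ⟨K, hK, hmax⟩ := hex
  have hcent : ∀ x, (∀ k ∈ K, k * x = x * k) → x ∈ K := by
    intro x hx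
    have hcomm : ∀ a ∈ (K : Set A) ∪ {x}, ∀ b ∈ (K : Set A) ∪ {x}, a * b = b * a := by
      rintro a (ha | rfl) b (hb | rfl)
      · exact hK a ha b hb
      · exact hx a ha
      · exact (hx b hb).symm
      · rfl
    let K' := Algebra.adjoin E ((K : Set A) ∪ {x})
    have hK' : P K' := by
      intro a ha b hb
      exact congrArg Subtype.val ((Algebra.adjoinCommRingOfComm E hcomm).mul_comm ⟨a, ha⟩ ⟨b, hb⟩)
    have hle : K ≤ K' := fun y hy => Algebra.subset_adjoin (Or.inl hy)
    have := Subalgebra.eq_of_le_of_finrank_le hle (hmax K' hK')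
    rw [this]
    exact Algebra.subset_adjoin (Or.inr rfl)
  letI : CommRing K := { (inferInstance : Ring K) with mul_comm := fun a b => Subtype.ext (hK a a.2 b b.2) }
  letI : Field K := fieldOfFiniteDimensional E K
  obtain ⟨n, h1, h2, h3⟩ := split_of_max (E := E) (A := A) (K := K) K.val (fun x hx => ⟨⟨x, hcent x fun k hk => hx ⟨k, hk⟩⟩, rfl⟩)
  exact ⟨n, h1, K, inferInstance, inferInstance, h2, h3⟩
end
end Cft
end

section
open IsDedekindDomain NumberField WithZero Polynomial
namespace Cft
universe u
set_option linter.unusedSectionVars false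
set_option linter.all false

section
open scoped TensorProduct
variable {E : Type*} [Field E] {A : Type*} [DivisionRing A] [Algebra E A] [Algebra.IsCentral E A] [FiniteDimensional E A]

lemma sc_comm {K : Type*} [Field K] [Algebra E K] {n : ℕ} (ρ : A →ₐ[E] Matrix (Fin n) (Fin n) K) (x : A) (k : K) :
    Commute (ρ x) ((IsScalarTower.toAlgHom E K (Matrix (Fin n) (Fin n) K)) k) := by
  rw [IsScalarTower.coe_toAlgHom']
  exact (Algebra.commute_algebraMap_left k (ρ x)).symm

noncomputable def Phi {K : Type*} [Field K] [Algebra E K] {n : ℕ} (ρ : A →ₐ[E] Matrix (Fin n) (Fin n) K) :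
    A ⊗[E] K →ₐ[E] Matrix (Fin n) (Fin n) K :=
  Algebra.TensorProduct.lift ρ (IsScalarTower.toAlgHom E K (Matrix (Fin n) (Fin n) K)) (sc_comm ρ)

lemma Phi_tmul {K : Type*} [Field K] [Algebra E K] {n : ℕ} (ρ : A →ₐ[E] Matrix (Fin n) (Fin n) K) (x : A) (k : K) :
    Phi ρ (x ⊗ₜ k) = ρ x * algebraMap K _ k := by
  simp [Phi]

lemma Phi_bij {K : Type*} [Field K] [Algebra E K] [FiniteDimensional E K] {n : ℕ} (hn : Module.finrank E A = n ^ 2)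
    (ρ : A →ₐ[E] Matrix (Fin n) (Fin n) K) : Function.Bijective (Phi ρ) := by
  have hn0 : n ≠ 0 := by
    rintro rfl
    have : 0 < Module.finrank E A := Module.finrank_pos
    omega
  haveI : NeZero n := ⟨hn0⟩
  have hi : Function.Injective (Phi ρ) := by
    apply lift_inj
    intro x y h
    simp only [IsScalarTower.coe_toAlgHom'] at h
    exact (algebraMap K (Matrix (Fin n) (Fin n) K)).injective h
  refine ⟨hi, ?_⟩
  have hf : Module.finrank E (A ⊗[E] K) = Module.finrank E (Matrix (Fin n) (Fin n) K) := by
    rw [Module.finrank_tensorProduct, Module.finrank_matrix, hn, Fintype.card_fin]; ring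
  haveI : FiniteDimensional E (Matrix (Fin n) (Fin n) K) := inferInstance
  exact (LinearMap.injective_iff_surjective_of_finrank_eq_finrank (f := (Phi ρ).toLinearMap) hf).1 hi

lemma comm_all {K : Type*} [Field K] [Algebra E K] [FiniteDimensional E K] {n : ℕ} (hn : Module.finrank E A = n ^ 2)
    (ρ : A →ₐ[E] Matrix (Fin n) (Fin n) K) (G : Matrix (Fin n) (Fin n) K) (hG : ∀ x, ρ x * G = G * ρ x) :
    ∃ b : K, G = algebraMap K _ b := by
  have h1 : ∀ M, M * G = G * M := by
    intro M
    obtain ⟨t, rfl⟩ := (Phi_bij hn ρ).2 M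
    induction t with
    | zero => simp
    | tmul x k => rw [Phi_tmul, mul_assoc, Algebra.commutes, ← mul_assoc, hG, mul_assoc]
    | add x y hx hy => rw [map_add, add_mul, mul_add, hx, hy]
  have := Matrix.mem_range_scalar_of_commute_single (M := G) (fun i j _ => h1 _)
  obtain ⟨b, hb⟩ := this
  exact ⟨b, by rw [← hb]; rfl⟩

theorem skolem {K : Type*} [Field K] [Algebra E K] [FiniteDimensional E K] {n : ℕ} (hn : Module.finrank E A = n ^ 2)
    (ρ ρ' : A →ₐ[E] Matrix (Fin n) (Fin n) K) : ∃ g h : Matrix (Fin n) (Fin n) K, g * h = 1 ∧ h * g = 1 ∧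
      ∀ x, ρ x * g = g * ρ' x := by
  let e1 := AlgEquiv.ofBijective (Phi ρ) (Phi_bij hn ρ)
  let e2 := AlgEquiv.ofBijective (Phi ρ') (Phi_bij hn ρ')
  let f0 : Matrix (Fin n) (Fin n) K ≃ₐ[E] Matrix (Fin n) (Fin n) K := e2.symm.trans e1
  have hf0 : ∀ t, f0 (Phi ρ' t) = Phi ρ t := by
    intro t
    show e1 (e2.symm (e2 t)) = e1 t
    rw [AlgEquiv.symm_apply_apply]
  have hx : ∀ x, f0 (ρ' x) = ρ x := by
    intro x
    have := hf0 (x ⊗ₜ 1)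
    simpa [Phi_tmul] using this
  have hk : ∀ k, f0 (algebraMap K _ k) = algebraMap K _ k := by
    intro k
    have := hf0 (1 ⊗ₜ k)
    rw [Phi_tmul, Phi_tmul, map_one, map_one, one_mul] at this
    exact this
  let f1 : Matrix (Fin n) (Fin n) K ≃ₐ[K] Matrix (Fin n) (Fin n) K := AlgEquiv.ofRingEquiv (f := f0.toRingEquiv) hk
  let τ : Matrix (Fin n) (Fin n) K ≃ₐ[K] Module.End K (Fin n → K) := Matrix.toLinAlgEquiv'
  let f2 : Module.End K (Fin n → K) ≃ₐ[K] Module.End K (Fin n → K) := (τ.symm.trans f1).trans τ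
  obtain ⟨T, hT⟩ := f2.eq_linearEquivConjAlgEquiv
  have hT1 : (T : Module.End K (Fin n → K)) * (T.symm : Module.End K (Fin n → K)) = 1 := by
    ext1 v; ext; simp
  have hT2 : (T.symm : Module.End K (Fin n → K)) * (T : Module.End K (Fin n → K)) = 1 := by
    ext1 v; ext; simp
  refine ⟨τ.symm T, τ.symm T.symm, ?_, ?_, ?_⟩
  · rw [← map_mul, hT1, map_one]
  · rw [← map_mul, hT2, map_one]
  · intro x
    apply τ.injective
    rw [map_mul, map_mul, AlgEquiv.apply_symm_apply]
    have h1 : f2 (τ (ρ' x)) = τ (ρ x) := by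
      show τ (f1 (τ.symm (τ (ρ' x)))) = _
      rw [AlgEquiv.symm_apply_apply]
      show τ (f0 (ρ' x)) = _
      rw [hx]
    rw [← h1, hT]
    apply LinearMap.ext
    intro v
    simp [LinearEquiv.conjAlgEquiv_apply]

theorem semi {p : ℕ} [hp : Fact p.Prime] {Z K : Type*} [Field Z] [Field K] [Algebra E Z] [Algebra E K] [Algebra Z K]
    [IsScalarTower E Z K] [FiniteDimensional E K] {ζ a : Z} {α : K} {σ : K ≃ₐ[Z] K} (hk : Kum p ζ a α σ)
    {n : ℕ} (hn : Module.finrank E A = n ^ 2)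
    (ρ : A →ₐ[E] Matrix (Fin n) (Fin n) K) : ∃ (b : Zˣ) (φ : Module.End Z (Fin n → K)),
      φ ^ p = algebraMap Z _ (b : Z) ∧ (∀ (k : K) v, φ (k • v) = σ k • φ v) ∧
      ∀ x v, φ (Matrix.mulVec (ρ x) v) = Matrix.mulVec (ρ x) (φ v) := by
  have hn0 : n ≠ 0 := by
    rintro rfl
    have : 0 < Module.finrank E A := Module.finrank_pos
    omega
  haveI : NeZero n := ⟨hn0⟩
  obtain ⟨g, h, hgh, hhg, hg⟩ := skolem hn ρ ((((σ.restrictScalars E) : K →ₐ[E] K).mapMatrix).comp ρ)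
  let s : Module.End Z (Fin n → K) := LinearMap.compLeft (σ.toLinearMap) (Fin n)
  have hs : ∀ v i, s v i = σ (v i) := fun _ _ => rfl
  have hsmv : ∀ (M : Matrix (Fin n) (Fin n) K) v, s (Matrix.mulVec M v) = Matrix.mulVec (M.map σ) (s v) := by
    intro M v
    ext i
    simp [hs, Matrix.mulVec, dotProduct]
  let φ : Module.End Z (Fin n → K) := (Matrix.toLin' g).restrictScalars Z ∘ₗ s
  have hφ : ∀ v, φ v = Matrix.mulVec g (s v) := fun _ => rfl
  have hsemi : ∀ (k : K) v, φ (k • v) = σ k • φ v := by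
    intro k v
    rw [hφ, hφ, ← Matrix.mulVec_smul]
    congr 1
    ext i
    simp [hs]
  have hcomm : ∀ x v, φ (Matrix.mulVec (ρ x) v) = Matrix.mulVec (ρ x) (φ v) := by
    intro x v
    rw [hφ, hφ, hsmv, Matrix.mulVec_mulVec, Matrix.mulVec_mulVec]
    congr 1
    exact (hg x).symm
  have hinj : Function.Injective φ := by
    intro v w hvw
    rw [hφ, hφ] at hvw
    have h1 := congrArg (Matrix.mulVec h) hvw
    rw [Matrix.mulVec_mulVec, Matrix.mulVec_mulVec, hhg, Matrix.one_mulVec, Matrix.one_mulVec] at h1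
    ext i
    exact σ.injective (congrFun h1 i)
  have hpsemi : ∀ (i : ℕ) (k : K) v, (φ ^ i) (k • v) = (σ ^ i) k • (φ ^ i) v := by
    intro i k v
    induction i with
    | zero => simp
    | succ i ih => rw [pow_succ', pow_succ', Module.End.mul_apply, ih, hsemi]; rfl
  have hpcomm : ∀ (i : ℕ) x v, (φ ^ i) (Matrix.mulVec (ρ x) v) = Matrix.mulVec (ρ x) ((φ ^ i) v) := by
    intro i x v
    induction i with
    | zero => simp
    | succ i ih => rw [pow_succ', Module.End.mul_apply, ih, hcomm]; rfl
  have hpinj : ∀ i : ℕ, Function.Injective (φ ^ i) := by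
    intro i
    rw [Module.End.coe_pow]
    exact hinj.iterate i
  have hσp : σ ^ p = 1 := by rw [← hk.order]; exact pow_orderOf_eq_one σ
  let ψ : (Fin n → K) →ₗ[K] (Fin n → K) :=
    { toFun := fun v => (φ ^ p) v, map_add' := map_add _, map_smul' := fun k v => by
        show (φ ^ p) (k • v) = k • (φ ^ p) v
        rw [hpsemi, hσp]; rfl }
  have hψ : ∀ v, ψ v = (φ ^ p) v := fun _ => rfl
  obtain ⟨b, hb⟩ := comm_all hn ρ (LinearMap.toMatrix' ψ) (by
    intro x
    apply Matrix.toLin'.injective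
    rw [Matrix.toLin'_mul, Matrix.toLin'_mul, Matrix.toLin'_toMatrix']
    apply LinearMap.ext
    intro v
    simp only [LinearMap.comp_apply, Matrix.toLin'_apply, hψ]
    exact (hpcomm p x v).symm)
  have hb' : ∀ v, (φ ^ p) v = b • v := by
    intro v
    rw [← hψ, ← Matrix.toLin'_toMatrix' ψ, hb, Matrix.toLin'_apply, Matrix.algebraMap_eq_diagonal]
    ext i
    simp [Matrix.mulVec_diagonal]
  have hne : (Pi.single 0 1 : Fin n → K) ≠ 0 := by simp
  have hσb : σ b = b := by
    have h1 : φ (b • (Pi.single 0 1 : Fin n → K)) = b • φ (Pi.single 0 1) := by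
      rw [← hb', ← hb', ← Module.End.mul_apply, ← Module.End.mul_apply, ← pow_succ, ← pow_succ']
    rw [hsemi] at h1
    exact smul_left_injective K (fun h0 => hne (hinj (by rw [h0, map_zero]))) h1
  obtain ⟨b0, hb0⟩ := hk.fixed hσb
  have hb00 : b0 ≠ 0 := by
    rintro rfl
    rw [map_zero] at hb0
    apply hne
    apply hpinj p
    rw [hb', ← hb0, zero_smul, map_zero]
  refine ⟨Units.mk0 b0 hb00, φ, ?_, hsemi, hcomm⟩
  apply LinearMap.ext
  intro v
  rw [hb', Units.val_mk0, Module.algebraMap_end_apply, ← hb0, algebraMap_smul]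
end
end Cft
end

section
open IsDedekindDomain NumberField WithZero Polynomial
namespace Cft
universe u
set_option linter.unusedSectionVars false
set_option linter.all false

section
variable {L W : Type*} [Field L] [AddCommGroup W] [Module L W] [FiniteDimensional L W]

lemma tr_zero (u M : Module.End L W) (hu : IsUnit u) (c : L) (hc : c ≠ 1) (h : u * M = c • (M * u)) :
    LinearMap.trace L W M = 0 := by
  obtain ⟨u, rfl⟩ := hu
  have h1 : LinearMap.trace L W M = c * LinearMap.trace L W M := by
    conv_lhs => rw [show M = (↑u⁻¹ : Module.End L W) * (u * M) by rw [← mul_assoc]; simp]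
    rw [h, LinearMap.trace_mul_comm, smul_mul_assoc, map_smul, mul_assoc]; simp
  have h2 : (1 - c) * LinearMap.trace L W M = 0 := by rw [sub_mul, one_mul, ← h1, sub_self]
  rcases mul_eq_zero.1 h2 with h3 | h3
  · exact absurd (sub_eq_zero.1 h3).symm hc
  · exact h3

lemma q_pow {R : Type*} [Ring R] [Algebra L R] {x y : R} {c : L} (h : x * y = c • (y * x)) (i : ℕ) :
    x * y ^ i = c ^ i • (y ^ i * x) := by
  induction i with
  | zero => simp
  | succ i ih => rw [pow_succ, ← mul_assoc, ih, smul_mul_assoc, mul_assoc, h, mul_smul_comm, smul_smul, ← pow_succ, mul_assoc]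

theorem tr_dim [CharZero L] {p : ℕ} [hp : Fact p.Prime] {ζ : L} (hζ : IsPrimitiveRoot ζ p) (P Q T1 T2 : Module.End L W)
    (hPQ : P * Q = Q * P) (hP : P ^ p = 1) (hQ : Q ^ p = 1) (h1 : IsUnit T1) (h2 : IsUnit T2)
    (h1P : T1 * P = ζ • (P * T1)) (h1Q : T1 * Q = Q * T1) (h2P : T2 * P = P * T2) (h2Q : Q * T2 = ζ • (T2 * Q)) :
    Module.finrank L ↥(LinearMap.ker (P - 1) ⊓ LinearMap.ker (Q - 1)) * p ^ 2 = Module.finrank L W := by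
  have hζ0 : ζ ≠ 0 := hζ.ne_zero hp.out.ne_zero
  have hp0 : (p : L) ≠ 0 := Nat.cast_ne_zero.2 hp.out.ne_zero
  have hpow : ∀ i, i < p → i ≠ 0 → ζ ^ i ≠ 1 := by
    intro i hi hi0 h
    have := Nat.le_of_dvd (Nat.pos_of_ne_zero hi0) (hζ.dvd_of_pow_eq_one i h)
    omega
  have htr : ∀ i ∈ Finset.range p, ∀ j ∈ Finset.range p, LinearMap.trace L W (P ^ i * Q ^ j) =
      if i = 0 then if j = 0 then (Module.finrank L W : L) else 0 else 0 := by
    intro i hi j hj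
    rw [Finset.mem_range] at hi hj
    split_ifs with hi0 hj0
    · subst hi0; subst hj0; simp [LinearMap.trace_one]
    · subst hi0
      have hq : T2 * Q = ζ⁻¹ • (Q * T2) := by rw [h2Q, smul_smul, inv_mul_cancel₀ hζ0, one_smul]
      apply tr_zero T2 _ h2 (ζ⁻¹ ^ j) _ _
      · rw [inv_pow]; intro h; exact hpow j hj hj0 (inv_eq_one.1 h)
      · rw [pow_zero, one_mul, q_pow hq]
    · apply tr_zero T1 _ h1 (ζ ^ i) (hpow i hi hi0)
      rw [← mul_assoc, q_pow h1P, smul_mul_assoc, mul_assoc, mul_assoc, (Commute.pow_right (show Commute T1 Q from h1Q) j).eq]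
  let sP := ∑ i ∈ Finset.range p, P ^ i
  let sQ := ∑ i ∈ Finset.range p, Q ^ i
  have hsP : (P - 1) * sP = 0 := by rw [mul_geom_sum, hP, sub_self]
  have hsQ : (Q - 1) * sQ = 0 := by rw [mul_geom_sum, hQ, sub_self]
  have hPsQ : Commute sP sQ := by
    apply Commute.sum_left; intro i _; apply Commute.sum_right; intro j _
    exact Commute.pow_pow hPQ i j
  have fixpow : ∀ (R : Module.End L W) w, R w = w → ∀ i : ℕ, (R ^ i) w = w := by
    intro R w h i
    induction i with
    | zero => simp
    | succ i ih => rw [pow_succ, Module.End.mul_apply, h, ih]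
  let π : Module.End L W := ((p : L) ^ 2)⁻¹ • (sP * sQ)
  have hπ : LinearMap.IsProj (LinearMap.ker (P - 1) ⊓ LinearMap.ker (Q - 1)) π := by
    constructor
    · intro w
      simp only [Submodule.mem_inf, LinearMap.mem_ker]
      constructor
      · rw [← Module.End.mul_apply]
        have : (P - 1) * π = 0 := by rw [mul_smul_comm, ← mul_assoc, hsP, zero_mul, smul_zero]
        rw [this]; rfl
      · rw [← Module.End.mul_apply]
        have : (Q - 1) * π = 0 := by rw [mul_smul_comm, hPsQ.eq, ← mul_assoc, hsQ, zero_mul, smul_zero]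
        rw [this]; rfl
    · intro w hw
      simp only [Submodule.mem_inf, LinearMap.mem_ker, LinearMap.sub_apply, Module.End.one_apply, sub_eq_zero] at hw
      have e1 : sP w = (p : L) • w := by
        simp only [sP, LinearMap.sum_apply, fixpow P w hw.1]
        simp [Nat.cast_smul_eq_nsmul]
      have e2 : sQ w = (p : L) • w := by
        simp only [sQ, LinearMap.sum_apply, fixpow Q w hw.2]
        simp [Nat.cast_smul_eq_nsmul]
      show ((p : L) ^ 2)⁻¹ • (sP (sQ w)) = w
      rw [e2, map_smul, e1, smul_smul, smul_smul, mul_assoc, ← pow_two, inv_mul_cancel₀ (pow_ne_zero 2 hp0), one_smul]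
  have ht := hπ.trace
  have ht2 : LinearMap.trace L W (sP * sQ) = Module.finrank L W := by
    simp only [sP, sQ, Finset.sum_mul_sum, map_sum]
    rw [Finset.sum_congr rfl (fun i hi => Finset.sum_congr rfl (htr i hi))]
    rw [Finset.sum_eq_single 0 (by intro b _ hb; simp [hb]) (by simp [hp.out.pos])]
    rw [Finset.sum_eq_single 0 (by intro b _ hb; simp [hb]) (by simp [hp.out.pos])]
    simp
  rw [map_smul, ht2, smul_eq_mul] at ht
  have : (Module.finrank L W : L) = Module.finrank L ↥(LinearMap.ker (P - 1) ⊓ LinearMap.ker (Q - 1)) * p ^ 2 := by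
    rw [← ht]; field_simp
  exact_mod_cast this.symm

theorem act_mat {E A : Type*} [Field E] [Ring A] [Algebra E A] [Algebra E L] {n : ℕ} (S : Submodule L W) (hS : Module.finrank L S = n)
    (r : A →+* Module.End L W) (hr : ∀ x, ∀ w ∈ S, r x w ∈ S) (hE : ∀ e w, r (algebraMap E A e) w = algebraMap E L e • w) :
    Nonempty (A →ₐ[E] Matrix (Fin n) (Fin n) L) := by
  let r' : A →+* Module.End L S :=
    { toFun := fun x => (r x).restrict (hr x)
      map_one' := by ext w; simp
      map_mul' := fun x y => by ext w; simp
      map_zero' := by ext w; simp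
      map_add' := fun x y => by ext w; simp }
  let b : Module.Basis (Fin n) L S := Module.finBasisOfFinrankEq L S hS
  let m := LinearMap.toMatrixAlgEquiv b
  refine ⟨{ (m : Module.End L S →+* _).comp r' with commutes' := fun e => ?_ }⟩
  show m (r' (algebraMap E A e)) = _
  have : r' (algebraMap E A e) = algebraMap L _ (algebraMap E L e) := by
    ext w
    show r (algebraMap E A e) w = _
    rw [hE]; rfl
  rw [this, AlgEquiv.commutes]
  rw [← IsScalarTower.algebraMap_apply]

lemma Sym.dual {p : ℕ} [hp : Fact p.Prime] {ζ a b : L} (hζ : ζ ≠ 0) (ha : a ≠ 0) (hb : b ≠ 0) (h : Sym p ζ a b) :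
    ∃ X Y : Module.End L (Fin p → L), X ^ p = algebraMap L _ a⁻¹ ∧ Y ^ p = algebraMap L _ b⁻¹ ∧ X * Y = ζ • (Y * X) := by
  obtain ⟨Y, X, hY, hX, hXY⟩ := h.symm
  have key : ∀ (R : Module.End L (Fin p → L)) (c : L), c ≠ 0 → R ^ p = algebraMap L _ c → ∃ R' : Module.End L (Fin p → L),
      R * R' = 1 ∧ R' * R = 1 ∧ R' ^ p = algebraMap L _ c⁻¹ := by
    intro R c hc hR
    have hu : IsUnit R := by
      rw [← isUnit_pow_iff hp.out.ne_zero, hR]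
      exact (IsUnit.mk0 c hc).map (algebraMap L (Module.End L (Fin p → L)))
    obtain ⟨R, rfl⟩ := hu
    refine ⟨↑R⁻¹, R.mul_inv, R.inv_mul, ?_⟩
    have h1 : (↑R⁻¹ : Module.End L (Fin p → L)) ^ p * (R : Module.End L (Fin p → L)) ^ p = 1 := by
      rw [← Units.val_pow_eq_pow_val, ← Units.val_pow_eq_pow_val, inv_pow, Units.inv_mul]
    calc (↑R⁻¹ : Module.End L (Fin p → L)) ^ p = ↑R⁻¹ ^ p * ((R : Module.End L (Fin p → L)) ^ p * algebraMap L _ c⁻¹) := by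
          rw [hR, ← map_mul, mul_inv_cancel₀ hc, map_one, mul_one]
      _ = algebraMap L _ c⁻¹ := by rw [← mul_assoc, h1, one_mul]
  let τ : Matrix (Fin p) (Fin p) L ≃ₐ[L] Module.End L (Fin p → L) := Matrix.toLinAlgEquiv'
  obtain ⟨X', hX1, hX2, hX3⟩ := key (τ X) a ha (by rw [← map_pow, hX, AlgEquiv.commutes])
  obtain ⟨Y', hY1, hY2, hY3⟩ := key (τ Y) b hb (by rw [← map_pow, hY, AlgEquiv.commutes])
  have h3 : τ X * τ Y = ζ • (τ Y * τ X) := by rw [← map_mul, hXY, map_smul, map_mul]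
  refine ⟨X', Y', hX3, hY3, ?_⟩
  calc X' * Y' = (X' * Y') * ((τ X * τ Y) * (Y' * X')) := by
        rw [mul_assoc (τ X), ← mul_assoc (τ Y), hY1, one_mul, hX1, mul_one]
    _ = ζ • (X' * (Y' * τ Y) * τ X * (Y' * X')) := by rw [h3]; simp only [smul_mul_assoc, mul_smul_comm, mul_assoc]
    _ = ζ • (Y' * X') := by rw [hY2, mul_one, hX2, one_mul]
end

section
open scoped TensorProduct
variable {E : Type*} [Field E] {A : Type*} [DivisionRing A] [Algebra E A] [Algebra.IsCentral E A] [FiniteDimensional E A]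

theorem core {p : ℕ} [hp : Fact p.Prime] {Z L U V : Type*} [Field Z] [Field L] [CharZero L] [Algebra Z L] [Algebra E Z]
    [Algebra E L] [IsScalarTower E Z L] [AddCommGroup U] [AddCommGroup V] [Module L U] [Module Z U] [IsScalarTower Z L U] [Module Z V]
    [FiniteDimensional L U] [FiniteDimensional Z V] {ζ a b : Z} (hζ : IsPrimitiveRoot ζ p) (ha0 : a ≠ 0) (hb0 : b ≠ 0)
    (x y : Module.End L U) (m φ : Module.End Z V) {n : ℕ} (hU : Module.finrank L U = p) (hV : Module.finrank Z V = n * p)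
    (hx : x ^ p = algebraMap L _ (algebraMap Z L a)⁻¹) (hy : y ^ p = algebraMap L _ (algebraMap Z L b)⁻¹)
    (hm : m ^ p = algebraMap Z _ a) (hφp : φ ^ p = algebraMap Z _ b) (hxy : x * y = algebraMap Z L ζ • (y * x))
    (hφm : φ * m = ζ • (m * φ)) (rA : A →+* Module.End Z V) (hrm : ∀ z, rA z * m = m * rA z) (hrφ : ∀ z, rA z * φ = φ * rA z)
    (hrE : ∀ e, rA (algebraMap E A e) = algebraMap Z _ (algebraMap E Z e)) : Nonempty (A →ₐ[E] Matrix (Fin n) (Fin n) L) := by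
  haveI : FiniteDimensional L (U ⊗[Z] V) := Module.Finite.of_basis
    ((Module.finBasis L U).tensorProduct (Module.finBasis Z V))
  have hinjL : Function.Injective (algebraMap Z L) := (algebraMap Z L).injective
  have hφu : IsUnit φ := by
    rw [← isUnit_pow_iff hp.out.ne_zero, hφp]
    exact (IsUnit.mk0 b hb0).map (algebraMap Z (Module.End Z V))
  have hmu : IsUnit m := by
    rw [← isUnit_pow_iff hp.out.ne_zero, hm]
    exact (IsUnit.mk0 a ha0).map (algebraMap Z (Module.End Z V))
  have hxy' : x * y = ζ • (y * x) := by rw [hxy, algebraMap_smul]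
  obtain ⟨Θ, hΘ⟩ : ∃ Θ : (Module.End L U ⊗[Z] Module.End Z V) →ₐ[L] Module.End L (U ⊗[Z] V), Θ = Θ := ⟨Module.endTensorEndAlgHom, rfl⟩
  have hone : ∀ c : Z, c ≠ 0 → (algebraMap L (Module.End L U) (algebraMap Z L c)⁻¹) ⊗ₜ[Z] (algebraMap Z (Module.End Z V) c) = 1 := by
    intro c hc
    rw [← map_inv₀, ← IsScalarTower.algebraMap_apply, Algebra.algebraMap_eq_smul_one, Algebra.algebraMap_eq_smul_one,
      TensorProduct.smul_tmul, smul_smul, inv_mul_cancel₀ hc, one_smul]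
    rfl
  have hP : (x ⊗ₜ[Z] m) ^ p = 1 := by
    rw [Algebra.TensorProduct.tmul_pow, hx, hm, hone a ha0]
  have hQ : (y ⊗ₜ[Z] φ) ^ p = 1 := by
    rw [Algebra.TensorProduct.tmul_pow, hy, hφp, hone _ hb0]
  have hPQ : (x ⊗ₜ[Z] m) * (y ⊗ₜ[Z] φ) = (y ⊗ₜ[Z] φ) * (x ⊗ₜ[Z] m) := by
    rw [Algebra.TensorProduct.tmul_mul_tmul, Algebra.TensorProduct.tmul_mul_tmul, hφm, hxy', TensorProduct.smul_tmul]
  have smulL : ∀ (r : Module.End L U ⊗[Z] Module.End Z V), ζ • r = algebraMap Z L ζ • r := by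
    intro r; rw [algebraMap_smul]
  have h1P : (1 ⊗ₜ[Z] φ) * (x ⊗ₜ[Z] m) = algebraMap Z L ζ • ((x ⊗ₜ[Z] m) * (1 ⊗ₜ[Z] φ)) := by
    rw [← smulL, Algebra.TensorProduct.tmul_mul_tmul, Algebra.TensorProduct.tmul_mul_tmul,
      hφm, TensorProduct.tmul_smul, one_mul, mul_one]
  have h1Q : ((1 : Module.End L U) ⊗ₜ[Z] φ) * (y ⊗ₜ[Z] φ) = (y ⊗ₜ[Z] φ) * (1 ⊗ₜ[Z] φ) := by
    rw [Algebra.TensorProduct.tmul_mul_tmul, Algebra.TensorProduct.tmul_mul_tmul, one_mul, mul_one]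
  have h2P : ((1 : Module.End L U) ⊗ₜ[Z] m) * (x ⊗ₜ[Z] m) = (x ⊗ₜ[Z] m) * (1 ⊗ₜ[Z] m) := by
    rw [Algebra.TensorProduct.tmul_mul_tmul, Algebra.TensorProduct.tmul_mul_tmul, one_mul, mul_one]
  have h2Q : (y ⊗ₜ[Z] φ) * (1 ⊗ₜ[Z] m) = algebraMap Z L ζ • ((1 ⊗ₜ[Z] m) * (y ⊗ₜ[Z] φ)) := by
    rw [← smulL, Algebra.TensorProduct.tmul_mul_tmul, Algebra.TensorProduct.tmul_mul_tmul,
      hφm, TensorProduct.tmul_smul, one_mul, mul_one]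
  have uT : ∀ g : Module.End Z V, IsUnit g → IsUnit (Θ (1 ⊗ₜ g)) := by
    intro g hg
    exact (hg.map (Algebra.TensorProduct.includeRight : Module.End Z V →ₐ[Z] Module.End L U ⊗[Z] Module.End Z V)).map Θ
  have hdim := tr_dim (hζ.map_of_injective hinjL) (Θ (x ⊗ₜ m)) (Θ (y ⊗ₜ φ)) (Θ (1 ⊗ₜ φ)) (Θ (1 ⊗ₜ m))
    (by rw [← map_mul, hPQ, map_mul]) (by rw [← map_pow, hP, map_one]) (by rw [← map_pow, hQ, map_one])
    (uT _ hφu) (uT _ hmu) (by rw [← map_mul, h1P, map_smul, map_mul]) (by rw [← map_mul, h1Q, map_mul])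
    (by rw [← map_mul, h2P, map_mul]) (by rw [← map_mul, h2Q, map_smul, map_mul])
  have hW : Module.finrank L (U ⊗[Z] V) = n * p ^ 2 := by
    rw [Module.finrank_tensorProduct, hU, hV]; ring
  rw [hW] at hdim
  have hdim' := Nat.eq_of_mul_eq_mul_right (pow_pos hp.out.pos 2) hdim
  let r : A →+* Module.End L (U ⊗[Z] V) := (Θ : (Module.End L U ⊗[Z] Module.End Z V) →+* _).comp
    (((Algebra.TensorProduct.includeRight : Module.End Z V →ₐ[Z] Module.End L U ⊗[Z] Module.End Z V) : _ →+* _).comp rA)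
  have hr : ∀ z, r z = Θ (1 ⊗ₜ rA z) := fun _ => rfl
  have hrP : ∀ z, r z * Θ (x ⊗ₜ m) = Θ (x ⊗ₜ m) * r z := by
    intro z
    rw [hr, ← map_mul, ← map_mul, Algebra.TensorProduct.tmul_mul_tmul, Algebra.TensorProduct.tmul_mul_tmul, one_mul, mul_one, hrm]
  have hrQ : ∀ z, r z * Θ (y ⊗ₜ φ) = Θ (y ⊗ₜ φ) * r z := by
    intro z
    rw [hr, ← map_mul, ← map_mul, Algebra.TensorProduct.tmul_mul_tmul, Algebra.TensorProduct.tmul_mul_tmul, one_mul, mul_one, hrφ]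
  refine act_mat (LinearMap.ker (Θ (x ⊗ₜ m) - 1) ⊓ LinearMap.ker (Θ (y ⊗ₜ φ) - 1)) hdim' r ?_ ?_
  · intro z w hw
    simp only [Submodule.mem_inf, LinearMap.mem_ker, LinearMap.sub_apply, Module.End.one_apply, sub_eq_zero] at hw ⊢
    rw [← Module.End.mul_apply, ← hrP, ← Module.End.mul_apply, ← hrQ, Module.End.mul_apply, Module.End.mul_apply, hw.1, hw.2]
    exact ⟨rfl, rfl⟩
  · intro e w
    rw [hr, hrE, Algebra.algebraMap_eq_smul_one, TensorProduct.tmul_smul]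
    have h2 : ((1 : Module.End L U) ⊗ₜ[Z] (1 : Module.End Z V)) = 1 := rfl
    rw [h2, ← algebraMap_smul L, map_smul, map_one, ← IsScalarTower.algebraMap_apply]
    rfl

theorem descend {p : ℕ} [hp : Fact p.Prime] {Z K : Type*} [Field Z] [CharZero Z] [Field K] [Algebra E Z] [Algebra E K] [Algebra Z K]
    [IsScalarTower E Z K] [FiniteDimensional E K] {ζ a : Z} {α : K} {σ : K ≃ₐ[Z] K} (hk : Kum p ζ a α σ)
    {n : ℕ} (hn : Module.finrank E A = n ^ 2)
    (ρ : A →ₐ[E] Matrix (Fin n) (Fin n) K) : ∃ b : Zˣ, ∀ (L : Type u) [Field L] [Algebra Z L] [Algebra E L] [IsScalarTower E Z L],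
      Sym p (algebraMap Z L ζ) (algebraMap Z L a) (algebraMap Z L b) → Nonempty (A →ₐ[E] Matrix (Fin n) (Fin n) L) := by
  haveI : FiniteDimensional Z K := hk.fd
  obtain ⟨b, φ, hφp, hφs, hφc⟩ := semi hk hn ρ
  refine ⟨b, fun L _ _ _ _ hsym => ?_⟩
  have hζ0 : ζ ≠ 0 := hk.hζ.ne_zero hp.out.ne_zero
  have ha0 : a ≠ 0 := hk.a_ne
  haveI : CharZero L := charZero_of_injective_algebraMap (algebraMap Z L).injective
  obtain ⟨x, y, hx, hy, hxy⟩ := hsym.dual (by simpa using hζ0) (by simpa using ha0) (by simp)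
  let rA : A →+* Module.End Z (Fin n → K) :=
    { toFun := fun z => (Matrix.toLin' (ρ z)).restrictScalars Z
      map_one' := by
        apply LinearMap.ext; intro v; simp
      map_mul' := fun z w => by
        apply LinearMap.ext; intro v; simp
      map_zero' := by
        apply LinearMap.ext; intro v; simp
      map_add' := fun z w => by
        apply LinearMap.ext; intro v; simp [Matrix.add_mulVec] }
  have hrA : ∀ z v, rA z v = Matrix.mulVec (ρ z) v := fun _ _ => rfl
  have hm : ∀ (k : K) (v : Fin n → K), (Algebra.lsmul Z Z (Fin n → K)) k v = k • v := fun _ _ => rfl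
  refine core hk.hζ ha0 b.ne_zero x y (Algebra.lsmul Z Z (Fin n → K) α) φ (by simp) ?_ hx hy ?_ hφp hxy ?_ rA ?_ ?_ ?_
  · rw [Module.finrank_pi_fintype]; simp [hk.hfin]
  · rw [← map_pow, hk.hα, AlgHom.commutes]
  · apply LinearMap.ext
    intro v
    rw [Module.End.mul_apply, hm, LinearMap.smul_apply, Module.End.mul_apply, hm]
    rw [hφs, hk.hσ, ← smul_smul, algebraMap_smul]
  · intro z
    apply LinearMap.ext; intro v
    rw [Module.End.mul_apply, Module.End.mul_apply, hrA, hrA, hm, hm, Matrix.mulVec_smul]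
  · intro z
    apply LinearMap.ext; intro v
    rw [Module.End.mul_apply, Module.End.mul_apply, hrA, hrA, hφc]
  · intro e
    apply LinearMap.ext; intro v
    rw [hrA, AlgHom.commutes, Module.algebraMap_end_apply, IsScalarTower.algebraMap_apply E K (Matrix (Fin n) (Fin n) K),
      Matrix.algebraMap_eq_diagonal, IsScalarTower.algebraMap_apply E Z K]
    ext i
    simp [Matrix.mulVec_diagonal, Algebra.smul_def]
end
end Cft
end

section
open IsDedekindDomain NumberField WithZero Polynomial
namespace Cft
universe u
set_option linter.unusedSectionVars false
set_option linter.all false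

section
variable {Γ : Type*} [Group Γ] [Finite Γ] {p : ℕ} [hp : Fact p.Prime]

lemma grp1 (H : Subgroup Γ) (hH : p ∣ H.index) (P : Sylow p Γ) : ∃ (x : Γ) (P1 Q1 : Subgroup Γ),
    P1 ≤ Q1 ∧ Q1 ≤ P ∧ (∀ g ∈ P1, x⁻¹ * g * x ∈ H) ∧ P1.relIndex Q1 = p ∧
      (P1.subgroupOf Q1).Normal ∧ Q1.relIndex P * p ∣ H.index := by
  have S : Sylow p H := default
  have hS := S.card_eq_multiplicity
  have hSp : IsPGroup p ((S : Subgroup H).map H.subtype) := S.isPGroup'.map _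
  have hScard : Nat.card ((S : Subgroup H).map H.subtype) = p ^ (Nat.card H).factorization p := by
    rw [← hS]
    exact (Nat.card_congr ((S : Subgroup H).equivMapOfInjective H.subtype H.subtype_injective).toEquiv).symm
  obtain ⟨P', hP'⟩ := hSp.exists_le_sylow
  obtain ⟨x, rfl⟩ := MulAction.exists_smul_eq Γ P' P
  obtain ⟨P1, hP1⟩ : ∃ P1 : Subgroup Γ, P1 = ((S : Subgroup H).map H.subtype).map (MulAut.conj x).toMonoidHom := ⟨_, rfl⟩
  have hP1card : Nat.card P1 = p ^ (Nat.card H).factorization p := by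
    rw [← hScard, hP1]
    exact (Nat.card_congr (Subgroup.equivMapOfInjective _ _ (MulAut.conj x).injective).toEquiv).symm
  have hP1P : P1 ≤ ((x • P' : Sylow p Γ) : Subgroup Γ) := by
    rw [hP1, Sylow.smul_def]
    rintro _ ⟨y, hy, rfl⟩
    exact ⟨y, hP' hy, rfl⟩
  have hP1H : ∀ g ∈ P1, x⁻¹ * g * x ∈ H := by
    rw [hP1]
    rintro _ ⟨_, ⟨z, _, rfl⟩, rfl⟩
    simp [mul_assoc]
  set P : Sylow p Γ := x • P' with hPdef
  have hPc : Nat.card P = p ^ (Nat.card Γ).factorization p := P.card_eq_multiplicity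
  have hidx : H.index ≠ 0 := Subgroup.index_ne_zero_of_finite
  have hfac : (Nat.card Γ).factorization p = (Nat.card H).factorization p + H.index.factorization p := by
    rw [← H.card_mul_index, Nat.factorization_mul Nat.card_pos.ne' hidx]; rfl
  have hv : 1 ≤ H.index.factorization p := (hp.out.dvd_iff_one_le_factorization hidx).1 hH
  set s := (Nat.card H).factorization p with hs
  obtain ⟨K, hK, hKle⟩ := Sylow.exists_subgroup_card_pow_succ (G := P) (p := p) (n := s)
    (by rw [hPc, hfac]; exact pow_dvd_pow _ (by omega)) (H := P1.subgroupOf P)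
    (by rw [← hP1card]; exact Nat.card_congr (Subgroup.subgroupOfEquivOfLe hP1P).toEquiv)
  obtain ⟨Q1, hQ1⟩ : ∃ Q1 : Subgroup Γ, Q1 = K.map (P : Subgroup Γ).subtype := ⟨_, rfl⟩
  have hQ1card : Nat.card Q1 = p ^ (s + 1) := by
    rw [← hK, hQ1]
    exact (Nat.card_congr (Subgroup.equivMapOfInjective _ _ (Subgroup.subtype_injective _)).toEquiv).symm
  have hQ1P : Q1 ≤ P := by rw [hQ1]; exact Subgroup.map_subtype_le K
  have hPQ : P1 ≤ Q1 := by
    rw [hQ1]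
    intro g hg
    exact ⟨⟨g, hP1P hg⟩, hKle (by simpa [Subgroup.mem_subgroupOf] using hg), rfl⟩
  have cr : ∀ {A B : Subgroup Γ}, A ≤ B → Nat.card A * A.relIndex B = Nat.card B := by
    intro A B h
    rw [← (A.subgroupOf B).card_mul_index, Nat.card_congr (Subgroup.subgroupOfEquivOfLe h).toEquiv]; rfl
  have hrel : P1.relIndex Q1 = p := by
    have := cr hPQ
    rw [hP1card, hQ1card, pow_succ] at this
    exact Nat.eq_of_mul_eq_mul_left (pow_pos hp.out.pos _) this
  refine ⟨x, P1, Q1, hPQ, hQ1P, hP1H, hrel, ?_, ?_⟩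
  · apply Subgroup.normal_of_index_eq_minFac_card
    rw [hQ1card, hp.out.pow_minFac (by omega)]
    exact hrel
  · have h1 := cr hQ1P
    rw [hQ1card, show Nat.card (P : Subgroup Γ) = _ from hPc, hfac] at h1
    have h2 : Q1.relIndex P * p = p ^ H.index.factorization p := by
      apply Nat.eq_of_mul_eq_mul_left (pow_pos hp.out.pos s)
      rw [← pow_add, ← h1, pow_succ]; ring
    rw [h2]
    exact Nat.ordProj_dvd _ _

lemma grp2 (H1 H2 : Subgroup Γ) (hH1 : p ∣ H1.index) (hH2 : p ∣ H2.index) : ∃ (x1 x2 : Γ) (P1 P2 R : Subgroup Γ),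
    IsPGroup p R ∧ (∀ g ∈ P1, x1⁻¹ * g * x1 ∈ H1) ∧ (∀ g ∈ P2, x2⁻¹ * g * x2 ∈ H2) ∧
    P1.relIndex R ∣ p ∧ P2.relIndex R ∣ p ∧ (P1.subgroupOf R).Normal ∧ (P2.subgroupOf R).Normal ∧
    ¬ (H1.index * H2.index ∣ R.index * p) := by
  have P : Sylow p Γ := default
  obtain ⟨x1, P1, Q1, hPQ1, hQP1, hc1, hr1, hn1, hd1⟩ := grp1 H1 hH1 P
  obtain ⟨x2, P2, Q2, hPQ2, hQP2, hc2, hr2, hn2, hd2⟩ := grp1 H2 hH2 P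
  have key : ∀ {P1 Q1 R : Subgroup Γ}, P1 ≤ Q1 → P1.relIndex Q1 = p → (P1.subgroupOf Q1).Normal → R ≤ Q1 →
      P1.relIndex R ∣ p ∧ (P1.subgroupOf R).Normal := by
    intro P1 Q1 R h1 h2 h3 h4
    constructor
    · rw [← Subgroup.relIndex_subgroupOf h4, ← h2]
      exact Subgroup.relIndex_dvd_index_of_normal _ _
    · constructor
      intro n hn g
      have := h3.conj_mem ⟨n, h4 n.2⟩ hn ⟨g, h4 g.2⟩
      exact this
  have hk1 := key hPQ1 hr1 hn1 (inf_le_left : Q1 ⊓ Q2 ≤ Q1)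
  have hk2 := key hPQ2 hr2 hn2 (inf_le_right : Q1 ⊓ Q2 ≤ Q2)
  have hRP : Q1 ⊓ Q2 ≤ P := inf_le_left.trans hQP1
  refine ⟨x1, x2, P1, P2, Q1 ⊓ Q2, P.isPGroup'.to_le hRP, hc1, hc2, hk1.1, hk2.1, hk1.2, hk2.2, ?_⟩
  intro hdvd
  rw [← Subgroup.relIndex_mul_index hRP] at hdvd
  obtain ⟨t, ht⟩ := IsPGroup.iff_card.1 P.isPGroup'
  have hpp : ∀ A : Subgroup Γ, ∃ k, A.relIndex P = p ^ k := by
    intro A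
    have : A.relIndex P ∣ p ^ t := by rw [← ht]; exact Subgroup.index_dvd_card _
    obtain ⟨k, _, hk⟩ := (Nat.dvd_prime_pow hp.out).1 this
    exact ⟨k, hk⟩
  obtain ⟨k, hk⟩ := hpp (Q1 ⊓ Q2)
  obtain ⟨k1, hk1⟩ := hpp Q1
  obtain ⟨k2, hk2⟩ := hpp Q2
  have hle := Subgroup.relIndex_inf_le (H := Q1) (K := Q2) (L := P)
  rw [hk, hk1, hk2, ← pow_add] at hle
  have hle' : k ≤ k1 + k2 := (Nat.pow_le_pow_iff_right hp.out.one_lt).1 hle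
  rw [hk1, ← pow_succ] at hd1
  rw [hk2, ← pow_succ] at hd2
  have h3 := (mul_dvd_mul hd1 hd2).trans hdvd
  rw [hk, ← pow_add, show p ^ k * (P : Subgroup Γ).index * p = p ^ (k + 1) * (P : Subgroup Γ).index by ring] at h3
  have hcop : Nat.Coprime (p ^ (k1 + 1 + (k2 + 1))) (P : Subgroup Γ).index :=
    Nat.Coprime.pow_left _ ((Nat.Prime.coprime_iff_not_dvd hp.out).2 P.not_dvd_index)
  have h4 := (Nat.pow_dvd_pow_iff_le_right hp.out.one_lt).1 (hcop.dvd_of_dvd_mul_right h3)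
  omega
end
end Cft
end

section
open IsDedekindDomain NumberField WithZero Polynomial
namespace Cft
universe u
set_option linter.unusedSectionVars false
set_option linter.all false

section
open scoped TensorProduct IntermediateField
variable {p : ℕ} [hp : Fact p.Prime]

theorem kum_exists {Z K : Type*} [Field Z] [Field K] [Algebra Z K] [IsGalois Z K] (hfin : Module.finrank Z K = p)
    {ζ : Z} (hζ : IsPrimitiveRoot ζ p) : ∃ (a : Z) (α : K) (σ : K ≃ₐ[Z] K), Kum p ζ a α σ := by
  haveI : FiniteDimensional Z K := FiniteDimensional.of_finrank_pos (by rw [hfin]; exact hp.out.pos)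
  have hcard : Nat.card (K ≃ₐ[Z] K) = p := by rw [IsGalois.card_aut_eq_finrank, hfin]
  haveI : IsCyclic (K ≃ₐ[Z] K) := isCyclic_of_prime_card hcard
  obtain ⟨α, ⟨a, ha⟩, hα⟩ := exists_root_adjoin_eq_top_of_isCyclic Z K
    (by rw [hfin]; exact ⟨ζ, (mem_primitiveRoots hp.out.pos).2 hζ⟩)
  rw [hfin] at ha
  haveI : Nontrivial (K ≃ₐ[Z] K) := by
    rw [← Finite.one_lt_card_iff_nontrivial, hcard]; exact hp.out.one_lt
  obtain ⟨τ, hτ⟩ := exists_ne (1 : K ≃ₐ[Z] K)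
  have hτα : τ α ≠ α := by
    intro h
    apply hτ
    have h1 : (τ : K →ₐ[Z] K) = AlgHom.id Z K := by
      have hα' : Algebra.adjoin Z {α} = ⊤ := by
        have h2 := IntermediateField.adjoin_simple_toSubalgebra_of_isAlgebraic (F := Z) (α := α) (Algebra.IsAlgebraic.isAlgebraic α)
        rw [hα] at h2
        rw [← h2]; rfl
      apply AlgHom.ext_of_adjoin_eq_top hα'
      intro x hx
      rw [Set.mem_singleton_iff.1 hx]
      exact h
    ext x
    exact DFunLike.congr_fun h1 x
  have hα0 : α ≠ 0 := by
    rintro rfl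
    exact hτα (map_zero τ)
  have hζK : IsPrimitiveRoot (algebraMap Z K ζ) p := hζ.map_of_injective (algebraMap Z K).injective
  haveI : NeZero p := ⟨hp.out.ne_zero⟩
  obtain ⟨i, hi, hi2⟩ := hζK.eq_pow_of_pow_eq_one (ξ := τ α / α) (by
    rw [div_pow, ← map_pow, ← ha, AlgEquiv.commutes, div_self]
    rw [ha]; exact pow_ne_zero _ hα0)
  have hi3 : τ α = algebraMap Z K (ζ ^ i) * α := by
    rw [map_pow, hi2, div_mul_cancel₀ _ hα0]
  have hi0 : i ≠ 0 := by
    rintro rfl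
    apply hτα
    rw [hi3]; simp
  have hpow : ∀ k : ℕ, (τ ^ k) α = algebraMap Z K (ζ ^ (i * k)) * α := by
    intro k
    induction k with
    | zero => simp
    | succ k ih =>
      rw [pow_succ', AlgEquiv.mul_apply, ih, map_mul, AlgEquiv.commutes, hi3, ← mul_assoc, ← map_mul, ← pow_add]
      ring_nf
  have hcop : Nat.Coprime i p := (Nat.coprime_of_lt_prime hi0 hi hp.out).symm
  obtain ⟨m, -, hm⟩ := Nat.exists_mul_mod_eq_one_of_coprime hcop hp.out.one_lt
  refine ⟨a, α, τ ^ m, hζ, ?_, ha.symm, hfin, ?_⟩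
  · rintro y rfl
    have hy0 : algebraMap Z K y ≠ 0 := by
      intro h
      rw [map_pow, h, zero_pow hp.out.ne_zero] at ha
      exact hα0 (pow_eq_zero_iff hp.out.ne_zero |>.1 ha.symm)
    obtain ⟨j, hj, hj2⟩ := hζK.eq_pow_of_pow_eq_one (ξ := α / algebraMap Z K y) (by
      rw [div_pow, ← map_pow, ← ha, div_self]
      rw [map_pow]; exact pow_ne_zero _ hy0)
    have h3 : α = algebraMap Z K (ζ ^ j * y) := by
      rw [map_mul, map_pow, hj2, div_mul_cancel₀ _ hy0]
    apply hτα
    rw [h3, AlgEquiv.commutes]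
  · rw [hpow, ← pow_mod_orderOf, ← hζ.eq_orderOf, hm, pow_one]
end

section
variable {E : Type*} {A : Type*} [Field E] [DivisionRing A] [Algebra E A] [Algebra.IsCentral E A] [FiniteDimensional E A]

theorem gal_step {p : ℕ} [hp : Fact p.Prime] {Z K : Type*} [Field Z] [CharZero Z] [Field K] [Algebra E Z] [Algebra E K] [Algebra Z K]
    [IsScalarTower E Z K] [FiniteDimensional E K] [IsGalois Z K] (hfin : Module.finrank Z K ∣ p) {ζ : Z} (hζ : IsPrimitiveRoot ζ p)
    {n : ℕ} (hn : Module.finrank E A = n ^ 2)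
    (ρ : A →ₐ[E] Matrix (Fin n) (Fin n) K) : ∃ a b : Zˣ, ∀ (L : Type u) [Field L] [Algebra Z L] [Algebra E L] [IsScalarTower E Z L],
      Sym p (algebraMap Z L ζ) (algebraMap Z L a) (algebraMap Z L b) → Nonempty (A →ₐ[E] Matrix (Fin n) (Fin n) L) := by
  rcases (Nat.dvd_prime hp.out).1 hfin with h1 | h1
  · refine ⟨1, 1, fun L _ _ _ _ _ => ?_⟩
    have hb : Function.Bijective (algebraMap Z K) := by
      refine ⟨(algebraMap Z K).injective, fun x => ?_⟩
      have h2 := (Subalgebra.bot_eq_top_iff_finrank_eq_one (F := Z) (E := K)).2 h1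
      have h3 : x ∈ (⊥ : Subalgebra Z K) := by rw [h2]; trivial
      exact Algebra.mem_bot.1 h3
    let e : Z ≃ₐ[E] K := AlgEquiv.ofBijective (IsScalarTower.toAlgHom E Z K) hb
    exact ⟨(AlgHom.mapMatrix ((IsScalarTower.toAlgHom E Z L).comp e.symm.toAlgHom)).comp ρ⟩
  · obtain ⟨a, α, σ, hk⟩ := kum_exists h1 hζ
    obtain ⟨b, hb⟩ := descend hk hn ρ
    exact ⟨Units.mk0 a hk.a_ne, b, fun L _ _ _ _ h => hb L h⟩
end

section
/-- a p-group of automorphisms fixes the p-th roots of unity -/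
theorem fix_root {p : ℕ} [hp : Fact p.Prime] {E K : Type*} [Field E] [Field K] [Algebra E K] {ζ : K} (hζ : IsPrimitiveRoot ζ p)
    (g : K ≃ₐ[E] K) (k : ℕ) (hg : g ^ (p ^ k) = 1) : g ζ = ζ := by
  haveI : NeZero p := ⟨hp.out.ne_zero⟩
  have hfo : IsOfFinOrder ζ := isOfFinOrder_iff_pow_eq_one.2 ⟨p, hp.out.pos, hζ.pow_eq_one⟩
  obtain ⟨i, hi, hi2⟩ := hζ.eq_pow_of_pow_eq_one (ξ := g ζ) (by rw [← map_pow, hζ.pow_eq_one, map_one])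
  have hpow : ∀ m : ℕ, (g ^ m) ζ = ζ ^ (i ^ m) := by
    intro m
    induction m with
    | zero => simp
    | succ m ih =>
      rw [pow_succ', AlgEquiv.mul_apply, ih, map_pow, ← hi2, ← pow_mul, ← pow_succ']
  have h1 := hpow (p ^ k)
  rw [hg, AlgEquiv.one_apply] at h1
  have h2 : (i ^ p ^ k : ℕ) ≡ 1 [MOD p] := by
    have h3 : ζ ^ (i ^ p ^ k) = ζ ^ 1 := by rw [← h1, pow_one]
    have h4 := hfo.pow_eq_pow_iff_modEq.1 h3
    rw [← hζ.eq_orderOf] at h4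
    exact h4
  rw [← ZMod.natCast_eq_natCast_iff] at h2
  push_cast at h2
  rw [ZMod.pow_card_pow] at h2
  have h5 : i ≡ 1 [MOD p] := by
    rw [← ZMod.natCast_eq_natCast_iff]; push_cast; exact h2
  have h6 : ζ ^ i = ζ ^ 1 := by
    rw [hfo.pow_eq_pow_iff_modEq, ← hζ.eq_orderOf]; exact h5
  rw [← hi2, h6, pow_one]
end
end Cft
end

section
open IsDedekindDomain NumberField WithZero Polynomial
namespace Cft
universe u
set_option linter.unusedSectionVars false
set_option linter.all false

section
variable {E : Type*} {A : Type*} [Field E] [DivisionRing A] [Algebra E A] [Algebra.IsCentral E A] [FiniteDimensional E A]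

theorem gal_half {p : ℕ} [hp : Fact p.Prime] {Z Ω K : Type*} [Field Z] [CharZero Z] [Field Ω] [Field K] [Algebra E Z] [Algebra E Ω]
    [Algebra Z Ω] [Algebra E K] [IsScalarTower E Z Ω] [FiniteDimensional E Ω] [IsGalois E Ω]
    (R P : Subgroup (Ω ≃ₐ[E] Ω)) (hR : (AlgEquiv.restrictScalarsHom E : (Ω ≃ₐ[Z] Ω) →* (Ω ≃ₐ[E] Ω)).range = R)
    (hP : P.relIndex R ∣ p) (hPn : (P.subgroupOf R).Normal) (j : K →ₐ[E] Ω) (x : Ω ≃ₐ[E] Ω)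
    (hx : ∀ g ∈ P, x⁻¹ * g * x ∈ j.fieldRange.fixingSubgroup) {ζ : Z} (hζ : IsPrimitiveRoot ζ p)
    {n : ℕ} (hn : Module.finrank E A = n ^ 2)
    (ρ : A →ₐ[E] Matrix (Fin n) (Fin n) K) : ∃ a b : Zˣ, ∀ (L : Type u) [Field L] [Algebra Z L] [Algebra E L] [IsScalarTower E Z L],
      Sym p (algebraMap Z L ζ) (algebraMap Z L a) (algebraMap Z L b) → Nonempty (A →ₐ[E] Matrix (Fin n) (Fin n) L) := by
  subst hR
  set ι : (Ω ≃ₐ[Z] Ω) →* (Ω ≃ₐ[E] Ω) := AlgEquiv.restrictScalarsHom E with hι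
  haveI : IsGalois Z Ω := IsGalois.tower_top_of_isGalois E Z Ω
  haveI : FiniteDimensional Z Ω := FiniteDimensional.right E Z Ω
  haveI hN : (P.comap ι).Normal := by
    have h1 : P.comap ι = (P.subgroupOf ι.range).comap ι.rangeRestrict := by
      ext g; simp [Subgroup.mem_subgroupOf]
    rw [h1]
    infer_instance
  have hfin : Module.finrank Z (IntermediateField.fixedField (P.comap ι)) ∣ p := by
    rw [IntermediateField.finrank_eq_fixingSubgroup_index, IntermediateField.fixingSubgroup_fixedField, Subgroup.index_comap]
    exact hP
  have hj : ∀ k, x (j k) ∈ IntermediateField.fixedField (P.comap ι) := by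
    intro k
    rw [IntermediateField.mem_fixedField_iff]
    intro g hg
    have h1 := hx _ (Subgroup.mem_comap.1 hg)
    rw [IntermediateField.mem_fixingSubgroup_iff] at h1
    have h2 := h1 (j k) ⟨k, rfl⟩
    have h3 := congrArg x h2
    simp only [AlgEquiv.mul_apply] at h3
    have h4 : ∀ y, x (x⁻¹ y) = y := fun y => by
      rw [← AlgEquiv.mul_apply, mul_inv_cancel, AlgEquiv.one_apply]
    rw [h4] at h3
    exact h3
  let j1 : K →ₐ[E] IntermediateField.fixedField (P.comap ι) :=
    { toFun := fun k => ⟨x (j k), hj k⟩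
      map_one' := by ext; simp
      map_mul' := fun a b => by ext; simp
      map_zero' := by ext; simp
      map_add' := fun a b => by ext; simp
      commutes' := fun e => by
        apply Subtype.ext
        show x (j (algebraMap E K e)) = _
        rw [AlgHom.commutes, AlgEquiv.commutes]
        rfl }
  haveI : FiniteDimensional E (IntermediateField.fixedField (P.comap ι)) :=
    haveI : FiniteDimensional E Z := FiniteDimensional.left E Z Ω
    Module.Finite.trans Z _
  exact gal_step (K := IntermediateField.fixedField (P.comap ι)) hfin hζ hn ((AlgHom.mapMatrix j1).comp ρ)

end

section
variable {E : Type u} [Field E] [NumberField E]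
  {A : Type*} [DivisionRing A] [Algebra E A] [Algebra.IsCentral E A] [FiniteDimensional E A]
  {C : Type*} [DivisionRing C] [Algebra E C] [Algebra.IsCentral E C] [FiniteDimensional E C]

theorem gal_main {p : ℕ} [hp : Fact p.Prime] {Ω : Type u} [Field Ω] [Algebra E Ω] [FiniteDimensional E Ω] [IsGalois E Ω]
    {ζ : Ω} (hζ : IsPrimitiveRoot ζ p) {K1 K2 : Type*} [Field K1] [Algebra E K1] [Field K2] [Algebra E K2]
    (j1 : K1 →ₐ[E] Ω) (j2 : K2 →ₐ[E] Ω) {n1 n2 : ℕ} (hp1 : p ∣ n1) (hp2 : p ∣ n2)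
    (hK1 : Module.finrank E K1 = n1) (hK2 : Module.finrank E K2 = n2)
    (hn1 : Module.finrank E A = n1 ^ 2) (hn2 : Module.finrank E C = n2 ^ 2)
    (ρ1 : A →ₐ[E] Matrix (Fin n1) (Fin n1) K1) (ρ2 : C →ₐ[E] Matrix (Fin n2) (Fin n2) K2) :
    ∃ (L : Type u) (_ : Field L) (_ : Algebra E L), FiniteDimensional E L ∧ Nonempty (A →ₐ[E] Matrix (Fin n1) (Fin n1) L) ∧
      Nonempty (C →ₐ[E] Matrix (Fin n2) (Fin n2) L) ∧ ¬ (n1 * n2 ∣ Module.finrank E L) := by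
  have hi1 : j1.fieldRange.fixingSubgroup.index = n1 := by
    rw [← IntermediateField.finrank_eq_fixingSubgroup_index, ← hK1]
    exact (AlgEquiv.ofInjectiveField j1).toLinearEquiv.finrank_eq.symm
  have hi2 : j2.fieldRange.fixingSubgroup.index = n2 := by
    rw [← IntermediateField.finrank_eq_fixingSubgroup_index, ← hK2]
    exact (AlgEquiv.ofInjectiveField j2).toLinearEquiv.finrank_eq.symm
  obtain ⟨x1, x2, P1, P2, R, hR, hx1, hx2, hr1, hr2, hN1, hN2, hnd⟩ :=
    grp2 (p := p) j1.fieldRange.fixingSubgroup j2.fieldRange.fixingSubgroup (by rwa [hi1]) (by rwa [hi2])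
  rw [hi1, hi2] at hnd
  have hfr : Module.finrank E (IntermediateField.fixedField R) = R.index := by
    rw [IntermediateField.finrank_eq_fixingSubgroup_index, IntermediateField.fixingSubgroup_fixedField]
  have hrange : (AlgEquiv.restrictScalarsHom E : (Ω ≃ₐ[IntermediateField.fixedField R] Ω) →* (Ω ≃ₐ[E] Ω)).range = R := by
    ext g
    constructor
    · rintro ⟨h, rfl⟩
      have h0 : (AlgEquiv.restrictScalarsHom E) h ∈ (IntermediateField.fixedField R).fixingSubgroup := by
        rw [IntermediateField.mem_fixingSubgroup_iff]
        intro z hz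
        exact h.commutes ⟨z, hz⟩
      rwa [IntermediateField.fixingSubgroup_fixedField] at h0
    · intro hg
      rw [← IntermediateField.fixingSubgroup_fixedField R, IntermediateField.mem_fixingSubgroup_iff] at hg
      exact ⟨AlgEquiv.ofRingEquiv (f := (g : Ω ≃+* Ω)) (fun z => hg z z.2), by ext; rfl⟩
  have hζR : ζ ∈ IntermediateField.fixedField R := by
    rw [IntermediateField.mem_fixedField_iff]
    intro g hg
    obtain ⟨k, hk⟩ := hR ⟨g, hg⟩
    exact fix_root hζ g k (by simpa using congrArg Subtype.val hk)
  have hζ' : IsPrimitiveRoot (⟨ζ, hζR⟩ : IntermediateField.fixedField R) p :=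
    IsPrimitiveRoot.of_map_of_injective (f := algebraMap (IntermediateField.fixedField R) Ω) hζ (algebraMap (IntermediateField.fixedField R) Ω).injective
  haveI : CharZero (IntermediateField.fixedField R) := charZero_of_injective_algebraMap (algebraMap E _).injective
  haveI : NumberField (IntermediateField.fixedField R) := by
    haveI : IsScalarTower ℚ E (IntermediateField.fixedField R) := inferInstance
    exact { to_finiteDimensional := Module.Finite.trans E _ }
  obtain ⟨a, b, hab⟩ := gal_half R P1 hrange hr1 hN1 j1 x1 hx1 hζ' hn1 ρ1
  obtain ⟨c, d, hcd⟩ := gal_half R P2 hrange hr2 hN2 j2 x2 hx2 hζ' hn2 ρ2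
  obtain ⟨L, _, _, hL, hs1, hs2⟩ := main1 hζ' a b c d
  letI : Algebra E L := ((algebraMap (IntermediateField.fixedField R) L).comp (algebraMap E _)).toAlgebra
  haveI : IsScalarTower E (IntermediateField.fixedField R) L := IsScalarTower.of_algebraMap_eq (fun _ => rfl)
  haveI : FiniteDimensional (IntermediateField.fixedField R) L :=
    FiniteDimensional.of_finrank_pos (Nat.pos_of_dvd_of_pos hL hp.out.pos)
  refine ⟨L, inferInstance, inferInstance, Module.Finite.trans (IntermediateField.fixedField R) L, hab L hs1, hcd L hs2, fun h => hnd ?_⟩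
  refine h.trans ?_
  rw [← Module.finrank_mul_finrank E (IntermediateField.fixedField R) L, hfr]
  exact mul_dvd_mul_left _ hL
end
end Cft
end

section
open IsDedekindDomain NumberField WithZero Polynomial
namespace Cft
universe u
set_option linter.unusedSectionVars false
set_option linter.all false

section
open scoped TensorProduct Kronecker IntermediateField

theorem dvd_of_rep {E B L ι : Type*} [Field E] [DivisionRing B] [Algebra E B] [FiniteDimensional E B] [Field L] [Algebra E L]
    [FiniteDimensional E L] [Fintype ι] [DecidableEq ι] (r : B →ₐ[E] Matrix ι ι L) :
    Module.finrank E B ∣ Fintype.card ι * Module.finrank E L := by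
  letI : Module B (ι → L) := Module.compHom _ ((Matrix.toLinAlgEquiv' : Matrix ι ι L ≃ₐ[L] _).toRingEquiv.toRingHom.comp r.toRingHom)
  have hdef : ∀ (b : B) (w : ι → L), b • w = Matrix.mulVec (r b) w := fun b w => rfl
  haveI : IsScalarTower E B (ι → L) := ⟨fun e b w => by
    rw [hdef, hdef, map_smul, Matrix.smul_mulVec]⟩
  have h := Module.finrank_mul_finrank E B (ι → L)
  rw [Module.finrank_pi_fintype] at h
  simp only [Finset.sum_const, Finset.card_univ, smul_eq_mul] at h
  exact ⟨_, h.symm⟩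

variable {E : Type u} [Field E] 

def kl {L : Type*} [Field L] [Algebra E L] (m n : ℕ) :
    Matrix (Fin m) (Fin m) L →ₐ[E] Matrix (Fin m × Fin n) (Fin m × Fin n) L where
  toFun M := M ⊗ₖ 1
  map_one' := Matrix.one_kronecker_one
  map_mul' M N := by rw [← Matrix.mul_kronecker_mul, one_mul]
  map_zero' := Matrix.zero_kronecker _
  map_add' M N := Matrix.add_kronecker _ _ _
  commutes' e := by rw [Algebra.algebraMap_eq_smul_one, Algebra.algebraMap_eq_smul_one, Matrix.smul_kronecker, Matrix.one_kronecker_one]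

def kr {L : Type*} [Field L] [Algebra E L] (m n : ℕ) :
    Matrix (Fin n) (Fin n) L →ₐ[E] Matrix (Fin m × Fin n) (Fin m × Fin n) L where
  toFun M := 1 ⊗ₖ M
  map_one' := Matrix.one_kronecker_one
  map_mul' M N := by rw [← Matrix.mul_kronecker_mul, one_mul]
  map_zero' := Matrix.kronecker_zero _
  map_add' M N := Matrix.kronecker_add _ _ _
  commutes' e := by rw [Algebra.algebraMap_eq_smul_one, Algebra.algebraMap_eq_smul_one, Matrix.kronecker_smul, Matrix.one_kronecker_one]

variable [NumberField E]
  {A : Type*} [DivisionRing A] [Algebra E A] [Algebra.IsCentral E A] [FiniteDimensional E A]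
  {C : Type*} [DivisionRing C] [Algebra E C] [Algebra.IsCentral E C] [FiniteDimensional E C]
  {B : Type*} [DivisionRing B] [Algebra E B] [FiniteDimensional E B]

theorem fin_asm (φ : A ⊗[E] C ≃ₐ[E] B) : Nat.Coprime (Module.finrank E A) (Module.finrank E C) := by
  by_contra hcon
  obtain ⟨p, hp, hpA, hpC⟩ := Nat.Prime.not_coprime_iff_dvd.1 hcon
  haveI : Fact p.Prime := ⟨hp⟩
  obtain ⟨n1, hn1, K1, _, _, hK1, ⟨ρ1⟩⟩ := exists_split E A
  obtain ⟨n2, hn2, K2, _, _, hK2, ⟨ρ2⟩⟩ := exists_split E C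
  have hp1 : p ∣ n1 := hp.dvd_of_dvd_pow (hn1 ▸ hpA)
  have hp2 : p ∣ n2 := hp.dvd_of_dvd_pow (hn2 ▸ hpC)
  have h1 : 0 < n1 := by
    rcases Nat.eq_zero_or_pos n1 with h | h
    · have := Module.finrank_pos (R := E) (M := A)
      rw [hn1, h] at this; simp at this
    · exact h
  have h2 : 0 < n2 := by
    rcases Nat.eq_zero_or_pos n2 with h | h
    · have := Module.finrank_pos (R := E) (M := C)
      rw [hn2, h] at this; simp at this
    · exact h
  haveI : FiniteDimensional E K1 := FiniteDimensional.of_finrank_pos (by omega)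
  haveI : FiniteDimensional E K2 := FiniteDimensional.of_finrank_pos (by omega)
  let i1 : K1 →ₐ[E] AlgebraicClosure E := IsAlgClosed.lift
  let i2 : K2 →ₐ[E] AlgebraicClosure E := IsAlgClosed.lift
  haveI : NeZero (p : AlgebraicClosure E) := ⟨by exact_mod_cast hp.ne_zero⟩
  obtain ⟨ζ, hζ⟩ := HasEnoughRootsOfUnity.exists_primitiveRoot (AlgebraicClosure E) p
  haveI : FiniteDimensional E i1.fieldRange := Module.Finite.equiv (AlgEquiv.ofInjectiveField i1).toLinearEquiv
  haveI : FiniteDimensional E i2.fieldRange := Module.Finite.equiv (AlgEquiv.ofInjectiveField i2).toLinearEquiv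
  haveI : FiniteDimensional E E⟮ζ⟯ := IntermediateField.adjoin.finiteDimensional (Algebra.IsIntegral.isIntegral ζ)
  set M : IntermediateField E (AlgebraicClosure E) := i1.fieldRange ⊔ i2.fieldRange ⊔ E⟮ζ⟯ with hM
  haveI : FiniteDimensional E M := IntermediateField.finiteDimensional_sup _ _
  set N : IntermediateField E (AlgebraicClosure E) := IntermediateField.normalClosure E M (AlgebraicClosure E) with hN
  have hle : i1.fieldRange ⊔ i2.fieldRange ⊔ E⟮ζ⟯ ≤ N := IntermediateField.le_normalClosure M
  haveI : FiniteDimensional E N := inferInstance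
  haveI : Normal E N := inferInstance
  haveI : IsGalois E N := { to_isSeparable := inferInstance, to_normal := inferInstance }
  have hζN : ζ ∈ N := hle (le_sup_right (a := i1.fieldRange ⊔ i2.fieldRange) (IntermediateField.mem_adjoin_simple_self E ζ))
  have hζ' : IsPrimitiveRoot (⟨ζ, hζN⟩ : N) p :=
    IsPrimitiveRoot.of_map_of_injective (f := algebraMap N (AlgebraicClosure E)) hζ (algebraMap N (AlgebraicClosure E)).injective
  let j1 : K1 →ₐ[E] N := i1.codRestrict N.toSubalgebra (fun k => hle ((le_sup_left.trans le_sup_left : i1.fieldRange ≤ _) ⟨k, rfl⟩))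
  let j2 : K2 →ₐ[E] N := i2.codRestrict N.toSubalgebra (fun k => hle ((le_sup_right.trans le_sup_left : i2.fieldRange ≤ _) ⟨k, rfl⟩))
  obtain ⟨L, _, _, hL, ⟨r1⟩, ⟨r2⟩, hnd⟩ := gal_main hζ' j1 j2 hp1 hp2 hK1 hK2 hn1 hn2 ρ1 ρ2
  let f1 := (kl (E := E) (L := L) n1 n2).comp r1
  let f2 := (kr (E := E) (L := L) n1 n2).comp r2
  have hc : ∀ x y, Commute (f1 x) (f2 y) := by
    intro x y
    show (r1 x ⊗ₖ (1 : Matrix _ _ L)) * ((1 : Matrix _ _ L) ⊗ₖ r2 y) = ((1 : Matrix _ _ L) ⊗ₖ r2 y) * (r1 x ⊗ₖ (1 : Matrix _ _ L))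
    rw [← Matrix.mul_kronecker_mul, ← Matrix.mul_kronecker_mul, one_mul, one_mul, mul_one, mul_one]
  have hd := dvd_of_rep ((Algebra.TensorProduct.lift f1 f2 hc).comp φ.symm.toAlgHom)
  rw [← φ.toLinearEquiv.finrank_eq, Module.finrank_tensorProduct, hn1, hn2, Fintype.card_prod, Fintype.card_fin, Fintype.card_fin] at hd
  apply hnd
  have h3 : (n1 * n2) * (n1 * n2) ∣ (n1 * n2) * Module.finrank E L := by
    convert hd using 1; ring
  exact Nat.dvd_of_mul_dvd_mul_left (by positivity) h3
end

section
theorem final (E : Type*) [Field E] [NumberField E] (A B : Type*) [DivisionRing A] [DivisionRing B] [Algebra E A] [Algebra E B]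
    [Algebra.IsCentral E A] [Algebra.IsCentral E B] [FiniteDimensional E A] [FiniteDimensional E B] (f : A →ₐ[E] B) :
    Module.finrank E A ∣ Module.finrank E B ∧ Nat.Coprime (Module.finrank E A) (Module.finrank E B / Module.finrank E A) := by
  let C := Subalgebra.centralizer E (Set.range f)
  letI : DivisionRing C := divisionRingOfFiniteDimensional E C
  have hbij := tensor_bij f
  let φ : TensorProduct E A C ≃ₐ[E] B := AlgEquiv.ofBijective _ hbij
  haveI : Algebra.IsCentral E C := by
    refine ⟨fun c hc => ?_⟩
    rw [Subalgebra.mem_center_iff] at hc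
    have h1 : ∀ y : B, y * (c : B) = c * y := by
      intro y
      obtain ⟨z, rfl⟩ := hbij.2 y
      induction z using TensorProduct.induction_on with
      | zero => simp
      | add x y hx hy => rw [map_add, add_mul, mul_add, hx, hy]
      | tmul x y =>
        rw [Algebra.TensorProduct.lift_tmul]
        have h2 : (y : B) * c = c * y := congrArg Subtype.val (hc y)
        have h3 : f x * (c : B) = c * f x := (Subalgebra.mem_centralizer_iff E).1 c.2 _ ⟨x, rfl⟩
        show f x * (y : B) * c = c * (f x * y)
        rw [mul_assoc, h2, ← mul_assoc, h3, mul_assoc]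
    obtain ⟨e, he⟩ := central_mem (E := E) h1
    exact Algebra.mem_bot.2 ⟨e, Subtype.ext he⟩
  have hfin : Module.finrank E B = Module.finrank E A * Module.finrank E C := by
    rw [← φ.toLinearEquiv.finrank_eq, Module.finrank_tensorProduct]
  have hcop := fin_asm φ
  refine ⟨⟨_, hfin⟩, ?_⟩
  rw [hfin, Nat.mul_div_cancel_left _ Module.finrank_pos]
  exact hcop
end
end Cft
end

/-- **Corollary 2.2.** Let `E` be a number field and let `A` and `B` be central division
algebras over `E`. If there exists an `E`-algebra embedding of `A` into `B`, then
`dim_E A` divides `dim_E B` and the integers `dim_E A` and `dim_E B / dim_E A` are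
relatively prime. -/
theorem stmt_0 (E : Type*) [Field E] [NumberField E]
    (A B : Type*) [DivisionRing A] [DivisionRing B]
    [Algebra E A] [Algebra E B]
    [Algebra.IsCentral E A] [Algebra.IsCentral E B]
    [FiniteDimensional E A] [FiniteDimensional E B]
    (h : ∃ f : A →ₐ[E] B, Function.Injective f) :
    Module.finrank E A ∣ Module.finrank E B ∧
      Nat.Coprime (Module.finrank E A) (Module.finrank E B / Module.finrank E A) := by
  
  obtain ⟨f, _⟩ := h
  exact Cft.final E A B f
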